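/- The monoid of pointed homotopy classes of self-maps of ℝP^{2n+1} (n ≥ 0, with ℝP^{2n+1} the quotient of S^{2n+1} by the antipodal action) under composition is isomorphic to the multiplicative monoid (ℤ, ×), via the mapping degree. -/

import Mathlib

open Metric

open Metric

/-- The `N`-sphere, as the unit sphere in `ℝ^{N+1}`. -/
abbrev Sph (N : ℕ) : Type := Metric.sphere (0 : EuclideanSpace ℝ (Fin (N + 1))) 1

/-- A base point of the sphere. -/
noncomputable def Sph.pt (N : ℕ) : Sph N :=
  ⟨EuclideanSpace.single 0 1, by
    simp [mem_sphere_zero_iff_norm, EuclideanSpace.norm_single]⟩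

/-- The antipodal map of the sphere. -/
def Sph.antipode (N : ℕ) : Sph N → Sph N := fun x =>
  ⟨-x.1, by
    rw [mem_sphere_zero_iff_norm, norm_neg, ← mem_sphere_zero_iff_norm]
    exact x.2⟩

/-- An axiomatization of the Brouwer–Hopf mapping degree for self-maps of `S^N`:
a homotopy-invariant complete invariant (Hopf's theorem), multiplicative under
composition, normalized on the identity, realizing every integer, and taking the
value `(-1)^{N+1}` on the antipodal map. -/
structure SphereDegree (N : ℕ) where
  deg : C(Sph N, Sph N) → ℤ
  deg_id : deg (ContinuousMap.id (Sph N)) = 1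
  deg_comp : ∀ f g : C(Sph N, Sph N), deg (f.comp g) = deg f * deg g
  homotopic_iff : ∀ f g : C(Sph N, Sph N), f.Homotopic g ↔ deg f = deg g
  deg_surjective : Function.Surjective deg
  deg_antipode : ∀ h : Continuous (Sph.antipode N),
    deg ⟨Sph.antipode N, h⟩ = (-1) ^ (N + 1)

/-- Real projective `N`-space, as the quotient of `S^N` identifying antipodes. -/
def RP (N : ℕ) : Type := Quot (fun x y : Sph N => y = x ∨ y = Sph.antipode N x)

noncomputable instance (N : ℕ) : TopologicalSpace (RP N) := by unfold RP; infer_instance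

/-- The covering projection `p : S^N → ℝP^N`. -/
noncomputable def RP.proj (N : ℕ) : C(Sph N, RP N) := ⟨Quot.mk _, continuous_quot_mk⟩

/-- Base point of `ℝP^N`. -/
noncomputable def RP.pt (N : ℕ) : RP N := RP.proj N (Sph.pt N)

/-- Pointed self-maps of a pointed space. -/
def PtdSelfMap (X : Type*) [TopologicalSpace X] (x₀ : X) : Type _ :=
  {f : C(X, X) // f x₀ = x₀}

/-- The set of pointed homotopy classes of pointed self-maps of `(X, x₀)`. -/
def PtdSelfMapClass (X : Type*) [TopologicalSpace X] (x₀ : X) : Type _ :=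
  Quot (fun f g : PtdSelfMap X x₀ => ContinuousMap.HomotopicRel f.1 g.1 {x₀})

/-- Composition of pointed self-maps. -/
def PtdSelfMap.comp {X : Type*} [TopologicalSpace X] {x₀ : X}
    (f g : PtdSelfMap X x₀) : PtdSelfMap X x₀ :=
  ⟨f.1.comp g.1, by simp [g.2, f.2]⟩

/-- The identity as a pointed self-map. -/
def PtdSelfMap.id (X : Type*) [TopologicalSpace X] (x₀ : X) : PtdSelfMap X x₀ :=
  ⟨ContinuousMap.id X, rfl⟩

/-- The pointed homotopy class of a pointed self-map. -/
def PtdSelfMapClass.mk {X : Type*} [TopologicalSpace X] {x₀ : X}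
    (f : PtdSelfMap X x₀) : PtdSelfMapClass X x₀ :=
  Quot.mk _ f

section
open Metric Set Filter Topology
set_option linter.unusedSectionVars false

namespace RPD

section hom
variable {E : Type*} [NormedAddCommGroup E] [NormedSpace ℝ E]
variable {Y : Type*}

/-- clamp to the unit interval -/
noncomputable def clamp (s : ℝ) : ℝ := max 0 (min 1 s)

theorem clamp_mem (s : ℝ) : clamp s ∈ Icc (0:ℝ) 1 := by
  unfold clamp; constructor
  · exact le_max_left _ _
  · exact max_le zero_le_one (min_le_left _ _)

theorem clamp_of_mem {s : ℝ} (h : s ∈ Icc (0:ℝ) 1) : clamp s = s := by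
  unfold clamp; rw [min_eq_right h.2, max_eq_right h.1]

theorem clamp_of_le {s : ℝ} (h : s ≤ 0) : clamp s = 0 := by
  unfold clamp; rw [max_eq_left]; exact (min_le_right _ _).trans h

theorem clamp_of_ge {s : ℝ} (h : 1 ≤ s) : clamp s = 1 := by
  unfold clamp; rw [min_eq_left h]; norm_num

@[fun_prop]
theorem continuous_clamp : Continuous clamp := by
  unfold clamp; fun_prop

/-- nonvanishing homotopy on `C` -/
def Hom [TopologicalSpace Y] (C : Set Y) (h h' : Y → E) : Prop :=
  ∃ H : ℝ × Y → E, Continuous H ∧ (∀ y ∈ C, H (0, y) = h y) ∧ (∀ y ∈ C, H (1, y) = h' y) ∧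
    ∀ t ∈ Icc (0:ℝ) 1, ∀ y ∈ C, H (t, y) ≠ 0

theorem Hom.refl [TopologicalSpace Y] {C : Set Y} {h : Y → E} (hc : Continuous h)
    (h0 : ∀ y ∈ C, h y ≠ 0) : Hom C h h :=
  ⟨fun z => h z.2, by fun_prop, fun _ _ => rfl, fun _ _ => rfl, fun _ _ y hy => h0 y hy⟩

theorem Hom.symm [TopologicalSpace Y] {C : Set Y} {h h' : Y → E} (hh : Hom C h h') :
    Hom C h' h := by
  obtain ⟨H, hc, h0, h1, hn⟩ := hh
  refine ⟨fun z => H (1 - z.1, z.2), by fun_prop, ?_, ?_, ?_⟩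
  · intro y hy; simpa using h1 y hy
  · intro y hy; simpa using h0 y hy
  · intro t ht y hy; exact hn _ ⟨by linarith [ht.2], by linarith [ht.1]⟩ y hy

theorem Hom.trans [TopologicalSpace Y] {C : Set Y} {h h' h'' : Y → E} (hh : Hom C h h')
    (hh' : Hom C h' h'') : Hom C h h'' := by
  obtain ⟨H, hc, h0, h1, hn⟩ := hh
  obtain ⟨H', hc', h0', h1', hn'⟩ := hh'
  refine ⟨fun z => H (clamp (2 * z.1), z.2) + H' (clamp (2 * z.1 - 1), z.2) - H' (0, z.2),
    by fun_prop, ?_, ?_, ?_⟩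
  · intro y hy
    simp [clamp_of_le, h0 y hy]
  · intro y hy
    have e1 : clamp (2 * 1) = 1 := clamp_of_ge (by norm_num)
    have e2 : clamp (2 * 1 - 1) = 1 := clamp_of_ge (by norm_num)
    simp only [e1, e2, h1 y hy, h0' y hy, h1' y hy]
    abel
  · intro t ht y hy
    by_cases h : t ≤ 1/2
    · simp only [clamp_of_le (s := 2 * t - 1) (by linarith)]
      simpa using hn _ (clamp_mem _) y hy
    · simp only [clamp_of_ge (s := 2 * t) (by linarith), h1 y hy, h0' y hy]
      simpa using hn' _ (clamp_mem _) y hy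

theorem Hom.mono [TopologicalSpace Y] {C C' : Set Y} {h h' : Y → E} (hh : Hom C h h')
    (hs : C' ⊆ C) : Hom C' h h' := by
  obtain ⟨H, hc, h0, h1, hn⟩ := hh
  exact ⟨H, hc, fun y hy => h0 y (hs hy), fun y hy => h1 y (hs hy),
    fun t ht y hy => hn t ht y (hs hy)⟩

theorem Hom.congr [TopologicalSpace Y] {C : Set Y} {h h' k k' : Y → E} (hh : Hom C h h')
    (e : ∀ y ∈ C, h y = k y) (e' : ∀ y ∈ C, h' y = k' y) : Hom C k k' := by
  obtain ⟨H, hc, h0, h1, hn⟩ := hh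
  exact ⟨H, hc, fun y hy => (h0 y hy).trans (e y hy), fun y hy => (h1 y hy).trans (e' y hy), hn⟩

theorem Hom.comp {Z : Type*} [TopologicalSpace Y] [TopologicalSpace Z] {C : Set Y} {C' : Set Z}
    {h h' : Y → E} (hh : Hom C h h')
    {φ : Z → Y} (hφ : Continuous φ) (hm : MapsTo φ C' C) : Hom C' (h ∘ φ) (h' ∘ φ) := by
  obtain ⟨H, hc, h0, h1, hn⟩ := hh
  exact ⟨fun z => H (z.1, φ z.2), by fun_prop, fun y hy => h0 _ (hm hy), fun y hy => h1 _ (hm hy),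
    fun t ht y hy => hn t ht _ (hm hy)⟩

/-- straight line homotopy -/
theorem Hom.line [TopologicalSpace Y] {C : Set Y} {h h' : Y → E} (hc : Continuous h)
    (hc' : Continuous h') (hlt : ∀ y ∈ C, ‖h' y - h y‖ < ‖h y‖) : Hom C h h' := by
  refine ⟨fun z => h z.2 + z.1 • (h' z.2 - h z.2), by fun_prop, by simp, by simp, ?_⟩
  intro t ht y hy h0
  have h1 : h y = - (t • (h' y - h y)) := eq_neg_of_add_eq_zero_left h0
  have h2 : ‖h y‖ ≤ ‖h' y - h y‖ := by
    calc ‖h y‖ = ‖t • (h' y - h y)‖ := by rw [← norm_neg (t • _), ← h1]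
      _ = t * ‖h' y - h y‖ := by rw [norm_smul, Real.norm_of_nonneg ht.1]
      _ ≤ 1 * ‖h' y - h y‖ := by gcongr; exact ht.2
      _ = _ := one_mul _
  linarith [hlt y hy]

theorem HEP [MetricSpace Y] {K C : Set Y} (hK : IsCompact K) (hC : IsClosed C)
    {h : Y → E} (hc : Continuous h) {G : ℝ × Y → E} (hG : Continuous G)
    (hG0 : ∀ y ∈ C, G (0, y) = h y) (hGn : ∀ t ∈ Icc (0:ℝ) 1, ∀ y ∈ C, G (t, y) ≠ 0) :
    ∃ H : ℝ × Y → E, Continuous H ∧ (∀ y, H (0, y) = h y) ∧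
      (∀ t ∈ Icc (0:ℝ) 1, ∀ y ∈ C, H (t, y) = G (t, y)) ∧
      (∃ U, IsOpen U ∧ (∀ y ∈ K, h y = 0 → y ∈ U) ∧ ∀ y ∈ U, ∀ t, H (t, y) = h y) ∧
      (∀ t ∈ Icc (0:ℝ) 1, ∀ y ∈ K, H (t, y) = 0 → h y = 0) := by
  set F : ℝ × Y → E := fun z => G z + h z.2 - G (0, z.2) with hF
  have hFc : Continuous F := by fun_prop
  set B : Set Y := Prod.snd '' ((Icc (0:ℝ) 1 ×ˢ K) ∩ F ⁻¹' {0}) with hB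
  have hBc : IsCompact B := by
    apply IsCompact.image _ continuous_snd
    exact (isCompact_Icc.prod hK).inter_right (isClosed_singleton.preimage hFc)
  have hdis : Disjoint B C := by
    rw [Set.disjoint_left]
    rintro y ⟨⟨t, y'⟩, ⟨⟨ht, hy⟩, h0⟩, rfl⟩ hyC
    simp only [hF, mem_preimage, mem_singleton_iff] at h0 ht hyC
    rw [hG0 _ hyC] at h0
    exact hGn t ht _ hyC (by simpa using h0)
  obtain ⟨U, V, hU, hV, hBU, hCV, hUV⟩ := normal_separation hBc.isClosed hC hdis
  obtain ⟨η, hη0, hη1, hη⟩ := exists_continuous_zero_one_of_isClosed hV.isClosed_compl hC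
    (by rw [Set.disjoint_left]; exact fun y hy hy' => hy (hCV hy'))
  have hηU : ∀ y ∈ U, η y = 0 := fun y hy => hη0 (fun hyV => Set.disjoint_left.1 hUV hy hyV)
  have key : ∀ y, F (0, y) = h y := by intro y; simp [hF]
  have hUsub : ∀ y ∈ K, h y = 0 → y ∈ U := by
    intro y hy h0
    exact hBU ⟨(0, y), ⟨⟨⟨le_rfl, zero_le_one⟩, hy⟩, by simpa [key] using h0⟩, rfl⟩
  refine ⟨fun z => F (z.1 * η z.2, z.2), by fun_prop, ?_, ?_, ⟨U, hU, hUsub, ?_⟩, ?_⟩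
  · intro y; simp [key]
  · intro t ht y hy
    simp [hη1 hy, hF, hG0 y hy]
  · intro y hy t; simp [hηU y hy, key]
  · intro t ht y hy h0
    have hyB : y ∈ B := by
      refine ⟨(t * η y, y), ⟨⟨⟨mul_nonneg ht.1 (hη y).1, mul_le_one₀ ht.2 (hη y).1 (hη y).2⟩, hy⟩,
        h0⟩, rfl⟩
    have := hηU y (hBU hyB)
    simpa [this, key] using h0

end hom
end RPD
end

section
open Metric Set Filter Topology
set_option linter.unusedSectionVars false

namespace RPD
section lin
open Matrix

variable {ι : Type*} [Fintype ι] [DecidableEq ι]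

/-- path of invertible matrices from the identity -/
def PathM (M : Matrix ι ι ℝ) : Prop :=
  ∃ γ : ℝ → Matrix ι ι ℝ, Continuous γ ∧ γ 0 = 1 ∧ γ 1 = M ∧ ∀ t ∈ Icc (0:ℝ) 1, (γ t).det ≠ 0

theorem PathM.mul {M M' : Matrix ι ι ℝ} (h : PathM M) (h' : PathM M') : PathM (M * M') := by
  obtain ⟨γ, hc, h0, h1, hd⟩ := h
  obtain ⟨γ', hc', h0', h1', hd'⟩ := h'
  refine ⟨fun t => γ t * γ' t, by fun_prop, by simp [h0, h0'], by simp [h1, h1'], ?_⟩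
  intro t ht
  rw [det_mul]
  exact mul_ne_zero (hd t ht) (hd' t ht)

theorem PathM.transv {i j : ι} (hij : i ≠ j) (c : ℝ) : PathM (Matrix.transvection i j c) := by
  refine ⟨fun t => Matrix.transvection i j (t * c), ?_, by simp, by simp, ?_⟩
  · apply continuous_matrix
    intro a b
    simp only [Matrix.transvection, Matrix.add_apply, Matrix.single_apply]
    split_ifs <;> fun_prop
  · intro t _
    rw [Matrix.det_transvection_of_ne _ _ hij]; exact one_ne_zero

theorem diag2_eq {i j : ι} (hij : i ≠ j) (a : ℝ) (ha : a ≠ 0) :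
    1 + Matrix.single i i (a - 1) + Matrix.single j j (a⁻¹ - 1) =
      Matrix.transvection i j a * Matrix.transvection j i (-a⁻¹) * Matrix.transvection i j a *
      Matrix.transvection i j (-1) * Matrix.transvection j i 1 * Matrix.transvection i j (-1) := by
  simp only [Matrix.transvection, mul_add, add_mul, one_mul, mul_one,
    Matrix.single_mul_single_same, Matrix.single_mul_single_of_ne _ _ _ _ hij,
    Matrix.single_mul_single_of_ne _ _ _ _ hij.symm]
  simp [ha]
  ext k l
  simp only [Matrix.add_apply, Matrix.single_apply]
  split_ifs <;> simp_all <;> grind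

theorem PathM.of_SL [Nontrivial ι] (M : SpecialLinearGroup ι ℝ) : PathM M.1 := by
  refine SpecialLinearGroup.diagonal_transvection_induction' (fun M => PathM M.1) M ?_ ?_ ?_
  · intro i j hij c hc
    have : (SpecialLinearGroup.diag2n hij c hc).1 =
        1 + Matrix.single i i (c - 1) + Matrix.single j j (c⁻¹ - 1) := by
      rw [SpecialLinearGroup.diag2n_coe]
      ext k l
      simp only [Matrix.add_apply, Matrix.single_apply, Matrix.diagonal_apply, Matrix.one_apply]
      grind
    rw [this, diag2_eq hij c hc]
    exact (((((PathM.transv hij c).mul (PathM.transv hij.symm _)).mul (PathM.transv hij c)).mul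
      (PathM.transv hij _)).mul (PathM.transv hij.symm _)).mul (PathM.transv hij _)
  · intro i j hij a
    exact PathM.transv hij a
  · intro A B hA hB
    exact hA.mul hB

theorem PathM.of_det_pos [Nontrivial ι] (M : Matrix ι ι ℝ) (hM : 0 < M.det) : PathM M := by
  obtain ⟨i₀, _⟩ := exists_pair_ne ι
  set d := M.det
  let D : ℝ → Matrix ι ι ℝ := fun c => Matrix.diagonal (fun k => if k = i₀ then c else 1)
  have hD : ∀ c, (D c).det = c := by
    intro c; simp [D, Matrix.det_diagonal]
  have hS : (D d⁻¹ * M).det = 1 := by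
    rw [det_mul, hD]; exact inv_mul_cancel₀ hM.ne'
  have e : M = D d * (D d⁻¹ * M) := by
    rw [← mul_assoc]
    have : D d * D d⁻¹ = 1 := by
      simp only [D, Matrix.diagonal_mul_diagonal]
      ext k l
      simp only [Matrix.diagonal_apply, Matrix.one_apply]
      split_ifs <;> simp [hM.ne']
    rw [this, one_mul]
  rw [e]
  refine PathM.mul ⟨fun t => D (1 + t * (d - 1)), ?_, ?_, by simp, ?_⟩ (PathM.of_SL ⟨_, hS⟩)
  · apply continuous_matrix
    intro a b
    simp only [D, Matrix.diagonal_apply]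
    split_ifs <;> fun_prop
  · ext k l
    simp [D, Matrix.diagonal_apply, Matrix.one_apply]
  · intro t ht
    simp only [hD]
    have : 0 < (1 - t) * 1 + t * d := by
      rcases ht.1.eq_or_lt with h | h
      · rw [← h]; norm_num
      · have := mul_pos h hM
        linarith [ht.2]
    intro h
    linarith

end lin

section lin2
variable {E : Type*} [NormedAddCommGroup E] [NormedSpace ℝ E] [FiniteDimensional ℝ E]

theorem lin_aux (hE : 2 ≤ Module.finrank ℝ E) (L : E →L[ℝ] E) (hL : 0 < L.det) :
    Hom ({0}ᶜ : Set E) (fun x => x) L := by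
  let b := Module.finBasis ℝ E
  have : Nontrivial (Fin (Module.finrank ℝ E)) := Fin.nontrivial_iff_two_le.2 hE
  have hd : 0 < (LinearMap.toMatrix b b (L : E →ₗ[ℝ] E)).det := by
    rw [LinearMap.det_toMatrix]; exact hL
  obtain ⟨γ, hc, h0, h1, hdet⟩ := PathM.of_det_pos _ hd
  have hb : Continuous b.equivFun := b.equivFun.toLinearMap.continuous_of_finiteDimensional
  have hb' : Continuous b.equivFun.symm :=
    b.equivFun.symm.toLinearMap.continuous_of_finiteDimensional
  refine ⟨fun z => b.equivFun.symm ((γ z.1).mulVec (b.equivFun z.2)), ?_, ?_, ?_, ?_⟩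
  · apply hb'.comp
    exact Continuous.matrix_mulVec (hc.comp continuous_fst) (hb.comp continuous_snd)
  · intro x _
    simp [h0]
  · intro x _
    simp only [h1]
    have := LinearMap.toMatrix_mulVec_repr b b (L : E →ₗ[ℝ] E) x
    rw [LinearEquiv.symm_apply_eq]
    exact this
  · intro t ht x hx h
    have h2 : (γ t).mulVec (b.equivFun x) = 0 :=
      (LinearEquiv.map_eq_zero_iff _).1 h
    have h3 := Matrix.eq_zero_of_mulVec_eq_zero (hdet t ht) h2
    exact hx ((LinearEquiv.map_eq_zero_iff _).1 h3)

theorem lin_hom (hE : 2 ≤ Module.finrank ℝ E) (L L' : E →L[ℝ] E) (hL : 0 < L.det * L'.det) :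
    Hom ({0}ᶜ : Set E) L L' := by
  have h0 : L.det ≠ 0 := by rintro h; simp [h] at hL
  let e := LinearEquiv.ofIsUnitDet (f := (L : E →ₗ[ℝ] E)) (v := Module.finBasis ℝ E)
    (v' := Module.finBasis ℝ E) (by
      rw [LinearMap.det_toMatrix]; exact isUnit_iff_ne_zero.2 h0)
  have he : ∀ x, e x = L x := fun x => rfl
  let Q : E →L[ℝ] E := L'.comp (e.symm.toLinearMap.toContinuousLinearMap)
  have hq : ∀ x, Q (L x) = L' x := by
    intro x; simp [Q, ← he]
  have hQL : Q.comp L = L' := by ext x; exact hq x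
  have hdet : Q.det * L.det = L'.det := by
    rw [← hQL]
    simp [ContinuousLinearMap.det, LinearMap.det_comp]
  have hQ : 0 < Q.det := by
    rw [← hdet] at hL
    have : 0 < L.det ^ 2 := by positivity
    nlinarith
  have := (lin_aux hE Q hQ).comp (φ := L) (C' := ({0}ᶜ : Set E)) L.continuous (by
    intro x hx h
    apply hx
    have : e x = 0 := by rw [he]; exact h
    simpa using this)
  exact this.congr (fun _ _ => rfl) (fun x _ => hq x)

end lin2
end RPD
end

section
open Metric Set Filter Topology
set_option linter.unusedSectionVars false

namespace RPD
section gen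
variable {E : Type*} [NormedAddCommGroup E] [NormedSpace ℝ E] [FiniteDimensional ℝ E]

theorem hasFDerivAt_of_det_ne (hE : 2 ≤ Module.finrank ℝ E) {h : E → E} {x : E}
    (hd : (fderiv ℝ h x).det ≠ 0) : HasFDerivAt h (fderiv ℝ h x) x := by
  by_cases hh : DifferentiableAt ℝ h x
  · exact hh.hasFDerivAt
  · exfalso
    apply hd
    rw [fderiv_zero_of_not_differentiableAt hh]
    simp only [ContinuousLinearMap.det, ContinuousLinearMap.toLinearMap_zero]
    have : Nonempty (Fin (Module.finrank ℝ E)) := ⟨⟨0, by omega⟩⟩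
    exact LinearMap.det_zero' (Module.finBasis ℝ E)

theorem antilip_of_det_ne {L : E →L[ℝ] E} (hd : L.det ≠ 0) : ∃ C, AntilipschitzWith C L :=
  ⟨_, (L.toContinuousLinearEquivOfDetNeZero hd).antilipschitz⟩

/-- regular maps -/
structure Reg (U K : Set E) (h : E → E) : Prop where
  cont : Continuous h
  fin : {x | x ∈ K ∧ h x = 0}.Finite
  mem : ∀ x ∈ K, h x = 0 → x ∈ U
  det : ∀ x ∈ K, h x = 0 → (fderiv ℝ h x).det ≠ 0

/-- sign of a zero -/
noncomputable def sgn (h : E → E) (x : E) : ℤ := (SignType.sign (fderiv ℝ h x).det : ℤ)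

/-- algebraic count of zeros -/
noncomputable def cnt (K : Set E) (h : E → E) : ℤ := ∑ᶠ x ∈ {x | x ∈ K ∧ h x = 0}, sgn h x

theorem finite_zeros (hE : 2 ≤ Module.finrank ℝ E) {K : Set E} (hK : IsCompact K) {h : E → E}
    (hc : Continuous h) (hd : ∀ x ∈ K, h x = 0 → (fderiv ℝ h x).det ≠ 0) :
    {x | x ∈ K ∧ h x = 0}.Finite := by
  by_contra hinf
  have hZ : IsCompact {x | x ∈ K ∧ h x = 0} :=
    hK.inter_right (isClosed_singleton.preimage hc)
  obtain ⟨x, hx, hacc⟩ := Set.Infinite.exists_accPt_of_subset_isCompact hinf hZ le_rfl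
  have h1 := (hasFDerivAt_of_det_ne hE (hd x hx.1 hx.2)).eventually_ne (c := (0:E))
    (antilip_of_det_ne (hd x hx.1 hx.2))
  rw [accPt_iff_frequently_nhdsNE] at hacc
  obtain ⟨y, hy1, hy2⟩ := (hacc.and_eventually h1).exists
  exact hy2 hy1.2

theorem exists_lower (K : Set E) (hK : IsCompact K) {h : E → E} (hc : Continuous h)
    (h0 : ∀ x ∈ K, h x ≠ 0) : ∃ m > 0, ∀ x ∈ K, m ≤ ‖h x‖ := by
  rcases K.eq_empty_or_nonempty with rfl | hne
  · exact ⟨1, one_pos, by simp⟩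
  · obtain ⟨x, hx, hmin⟩ := hK.exists_isMinOn hne hc.norm.continuousOn
    exact ⟨‖h x‖, norm_pos_iff.2 (h0 x hx), fun y hy => hmin hy⟩

theorem blend {h : E → E} (hc : Continuous h) {m : ℝ} (hm : 0 < m) :
    ∃ p : E → E, ContDiff ℝ 1 p ∧ ∀ c : E, ‖c‖ < m / 8 → ∃ q : E → E, Continuous q ∧
      (∀ x, m ≤ ‖h x‖ → q x = h x) ∧ ∀ x, q x = 0 → q =ᶠ[𝓝 x] fun y => p y - c := by
  obtain ⟨p, hp, hd, -⟩ := hc.exists_contDiff_approx (F := E) 1 (ε := fun _ => m / 8) (by fun_prop)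
    (fun _ => by positivity)
  refine ⟨p, hp, fun c hcm => ?_⟩
  have hpc : Continuous p := hp.continuous
  set η : E → ℝ := fun x => clamp ((‖h x‖ - m / 2) / (m / 2)) with hη
  have hηc : Continuous η := by fun_prop
  refine ⟨fun x => (p x - c) + η x • (h x - (p x - c)), by fun_prop, ?_, ?_⟩
  · intro x hx
    have : η x = 1 := clamp_of_ge (by rw [le_div_iff₀ (by positivity)]; linarith)
    simp [this]
  · intro x hx
    have hlt : ‖h x‖ < m / 2 := by
      by_contra hge
      push Not at hge
      have h1 : h x = (1 - η x) • (h x - (p x - c)) := by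
        have : h x = ((p x - c) + η x • (h x - (p x - c))) + (1 - η x) • (h x - (p x - c)) := by
          rw [sub_smul, one_smul]; abel
        simp only at hx
        rw [hx, zero_add] at this
        exact this
      have h2 : ‖h x - (p x - c)‖ < m / 4 := by
        have e : h x - (p x - c) = (h x - p x) + c := by abel
        rw [e]
        have := hd x
        rw [dist_comm, dist_eq_norm] at this
        linarith [norm_add_le (h x - p x) c]
      have h3 : ‖h x‖ ≤ 1 * ‖h x - (p x - c)‖ := by
        conv_lhs => rw [h1, norm_smul]
        gcongr
        have : η x ∈ Icc (0:ℝ) 1 := clamp_mem ((‖h x‖ - m / 2) / (m / 2))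
        rw [Real.norm_of_nonneg (by linarith [this.2])]
        linarith [this.1]
      linarith
    have hopen : IsOpen {y | ‖h y‖ < m / 2} := isOpen_lt hc.norm continuous_const
    filter_upwards [hopen.mem_nhds hlt] with y hy
    have : η y = 0 := clamp_of_le (by
      apply div_nonpos_of_nonpos_of_nonneg _ (by positivity)
      have hy' : ‖h y‖ < m / 2 := hy
      linarith)
    simp [this]

theorem exists_small_notMem {f : E → E} {s : Set E}
    {f' : E → E →L[ℝ] E} (hf' : ∀ x ∈ s, HasFDerivAt f (f' x) x) (hd : ∀ x ∈ s, (f' x).det = 0)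
    {r : ℝ} (hr : 0 < r) : ∃ c, ‖c‖ < r ∧ c ∉ f '' s := by
  borelize E
  have h0 := MeasureTheory.addHaar_image_eq_zero_of_det_fderivWithin_eq_zero
    (MeasureTheory.Measure.addHaar) (fun x hx => (hf' x hx).hasFDerivWithinAt) hd
  by_contra hcon
  push Not at hcon
  have hsub : ball (0:E) r ⊆ f '' s := fun c hc => hcon c (by simpa using hc)
  have h1 := MeasureTheory.measure_mono_null hsub h0
  exact (Metric.measure_ball_pos MeasureTheory.Measure.addHaar (0:E) hr).ne' h1

theorem GEN (hE : 2 ≤ Module.finrank ℝ E) {U K : Set E} (hU : IsOpen U) (hK : IsCompact K)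
    {h : E → E} (hc : Continuous h) (h0 : ∀ x ∈ K \ U, h x ≠ 0) :
    ∃ h', Reg U K h' ∧ ∀ x ∈ K \ U, h' x = h x := by
  obtain ⟨m, hm, hle⟩ := exists_lower (K \ U) (hK.diff hU) hc h0
  obtain ⟨p, hp, hq⟩ := blend hc hm
  obtain ⟨c, hcm, hcn⟩ := exists_small_notMem (f := p) (s := {x | (fderiv ℝ p x).det = 0})
    (f' := fderiv ℝ p) (fun x _ => (hp.differentiable one_ne_zero x).hasFDerivAt) (fun x hx => hx)
    (r := m / 8) (by positivity)
  obtain ⟨q, hqc, hqe, hqz⟩ := hq c hcm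
  have hdet : ∀ x ∈ K, q x = 0 → (fderiv ℝ q x).det ≠ 0 := by
    intro x _ hx
    have := hqz x hx
    rw [this.fderiv_eq, fderiv_sub_const]
    intro hd
    apply hcn
    refine ⟨x, hd, ?_⟩
    have e := this.self_of_nhds
    rw [hx] at e
    exact (sub_eq_zero.1 e.symm)
  refine ⟨q, ⟨hqc, finite_zeros hE hK hqc hdet, ?_, hdet⟩, fun x hx => hqe x (hle x hx)⟩
  intro x hx hx0
  by_contra hxU
  apply h0 x ⟨hx, hxU⟩
  rw [← hqe x (hle x ⟨hx, hxU⟩), hx0]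

theorem EXT {V : Submodule ℝ E} (hV : V ≠ ⊤) {K C : Set E}
    (hKV : K ⊆ V) (hC : IsCompact C) {h : E → E}
    (hc : Continuous h) (h0 : ∀ x ∈ C, h x ≠ 0) :
    ∃ h' : E → E, Continuous h' ∧ (∀ x ∈ C, h' x = h x) ∧ ∀ x ∈ K, h' x ≠ 0 := by
  obtain ⟨m, hm, hle⟩ := exists_lower C hC hc h0
  obtain ⟨p, hp, hq⟩ := blend hc hm
  obtain ⟨g, hg⟩ := LinearMap.exists_leftInverse_of_injective V.subtype (by simp)
  let π : E →L[ℝ] E := (V.subtype.comp g).toContinuousLinearMap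
  have hπ : ∀ x ∈ V, π x = x := by
    intro x hx
    have := LinearMap.congr_fun hg ⟨x, hx⟩
    simp only [LinearMap.coe_comp, Function.comp_apply, Submodule.subtype_apply,
      LinearMap.id_coe, id_eq] at this
    simp [π, this]
  have hπd : π.det = 0 := by
    by_contra hne
    apply hV
    rw [eq_top_iff]
    intro x _
    let e := π.toContinuousLinearEquivOfDetNeZero hne
    have : π (e.symm x) = x := e.apply_symm_apply x
    rw [← this]
    simp [π]
  obtain ⟨c, hcm, hcn⟩ := exists_small_notMem (f := p ∘ π) (s := univ)
    (f' := fun x => (fderiv ℝ p (π x)).comp π)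
    (fun x _ => ((hp.differentiable one_ne_zero (π x)).hasFDerivAt).comp x π.hasFDerivAt)
    (fun x hx => by
      have : ((fderiv ℝ p (π x)).comp π).det = (fderiv ℝ p (π x)).det * π.det := by
        simp [ContinuousLinearMap.det, LinearMap.det_comp]
      rw [this, hπd, mul_zero])
    (r := m / 8) (by positivity)
  obtain ⟨q, hqc, hqe, hqz⟩ := hq c hcm
  refine ⟨q, hqc, fun x hx => hqe x (hle x hx), ?_⟩
  intro x hx hx0
  apply hcn
  refine ⟨x, trivial, ?_⟩
  have e := (hqz x hx0).self_of_nhds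
  rw [hx0] at e
  simp only [Function.comp_apply, hπ x (hKV hx)]
  exact (sub_eq_zero.1 e.symm)

end gen
end RPD
end

section
open Metric Set Filter Topology
set_option linter.unusedSectionVars false

namespace RPD
section pf
variable {E : Type*} [NormedAddCommGroup E] [NormedSpace ℝ E] [FiniteDimensional ℝ E]

/-- the unit square -/
def Sq : Set (ℝ × ℝ) := Icc (0:ℝ) 1 ×ˢ Icc (0:ℝ) 1

/-- the boundary of the unit square -/
def bSq : Set (ℝ × ℝ) := Sq ∩ {z | z.1 = 0 ∨ z.1 = 1 ∨ z.2 = 0 ∨ z.2 = 1}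

theorem isCompact_Sq : IsCompact Sq := isCompact_Icc.prod isCompact_Icc

theorem isCompact_bSq : IsCompact bSq := by
  apply isCompact_Sq.inter_right
  have h1 : IsClosed {z : ℝ × ℝ | z.1 = 0} := isClosed_eq continuous_fst continuous_const
  have h2 : IsClosed {z : ℝ × ℝ | z.1 = 1} := isClosed_eq continuous_fst continuous_const
  have h3 : IsClosed {z : ℝ × ℝ | z.2 = 0} := isClosed_eq continuous_snd continuous_const
  have h4 : IsClosed {z : ℝ × ℝ | z.2 = 1} := isClosed_eq continuous_snd continuous_const
  exact h1.union (h2.union (h3.union h4))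

/-- filling a square in dimension at least 3 -/
theorem square_fill (hE : 3 ≤ Module.finrank ℝ E) {φ : ℝ × ℝ → E} (hφ : Continuous φ)
    (hn : ∀ z ∈ bSq, φ z ≠ 0) :
    ∃ Q : ℝ × ℝ → E, Continuous Q ∧ (∀ z ∈ bSq, Q z = φ z) ∧ ∀ z ∈ Sq, Q z ≠ 0 := by
  obtain ⟨j, hj⟩ : ∃ j : (ℝ × ℝ) →ₗ[ℝ] E, Function.Injective j := by
    refine finrank_le_iff_exists_linearMap.1 ?_
    simp
    omega
  obtain ⟨r, hr⟩ := LinearMap.exists_leftInverse_of_injective j (LinearMap.ker_eq_bot.2 hj)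
  have hrj : ∀ z, r (j z) = z := fun z => LinearMap.congr_fun hr z
  have hV : LinearMap.range j ≠ ⊤ := by
    intro h
    have := LinearMap.finrank_range_of_inj hj
    rw [h] at this
    simp at this
    omega
  have hjc : Continuous j := j.continuous_of_finiteDimensional
  have hrc : Continuous r := r.continuous_of_finiteDimensional
  obtain ⟨g, hgc, hge, hgn⟩ := EXT hV (K := j '' Sq) (C := j '' bSq) (h := φ ∘ r)
    (by rintro _ ⟨z, _, rfl⟩; exact ⟨z, rfl⟩) (isCompact_bSq.image hjc) (hφ.comp hrc)
    (by rintro _ ⟨z, hz, rfl⟩; simpa [hrj] using hn z hz)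
  refine ⟨g ∘ j, hgc.comp hjc, ?_, ?_⟩
  · intro z hz
    simpa [hrj] using hge (j z) ⟨z, hz, rfl⟩
  · intro z hz
    exact hgn (j z) ⟨z, hz, rfl⟩

theorem fix_point (hE : 2 ≤ Module.finrank ℝ E) {X : Set E} {d : E} (hd : d ∈ X) {u0 u1 : E → E}
    (hh : Hom X u0 u1) (e : u0 d = u1 d) :
    ∃ (H : ℝ × E → E) (Q : ℝ × ℝ → E), Continuous H ∧ Continuous Q ∧
      (∀ y ∈ X, H (0, y) = u0 y) ∧ (∀ y ∈ X, H (1, y) = u1 y) ∧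
      (∀ t ∈ Icc (0:ℝ) 1, ∀ y ∈ X, H (t, y) ≠ 0) ∧
      (∀ z ∈ bSq, Q z = H (z.1, d) + z.2 • (u0 d - H (z.1, d))) ∧ (∀ z ∈ Sq, Q z ≠ 0) := by
  obtain ⟨H, hc, h0, h1, hn⟩ := hh
  rcases hE.lt_or_eq with h3 | h2
  · obtain ⟨Q, hQ, hQe, hQn⟩ := square_fill (E := E) h3
      (φ := fun z => H (z.1, d) + z.2 • (u0 d - H (z.1, d))) (by fun_prop) (by
        rintro ⟨t, s⟩ ⟨⟨ht, hs⟩, hz⟩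
        simp only at ht hs hz
        have hud : u0 d ≠ 0 := by rw [← h0 d hd]; exact hn 0 (by simp) d hd
        rcases hz with rfl | rfl | rfl | rfl
        · simpa [h0 d hd] using hud
        · simpa [h1 d hd, ← e] using hud
        · simpa using hn t ht d hd
        · simpa using hud)
    exact ⟨H, Q, hc, hQ, h0, h1, hn, hQe, hQn⟩
  · let ψ : E ≃ₗ[ℝ] ℂ := LinearEquiv.ofFinrankEq E ℂ (by simp [← h2])
    have hψ : Continuous ψ := ψ.toLinearMap.continuous_of_finiteDimensional
    have hψ' : Continuous ψ.symm := ψ.symm.toLinearMap.continuous_of_finiteDimensional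
    have hud : u0 d ≠ 0 := by rw [← h0 d hd]; exact hn 0 (by simp) d hd
    have hne : ∀ t, ψ (H (clamp t, d)) ≠ 0 := fun t => by
      simpa using hn _ (clamp_mem t) d hd
    have c0 : clamp 0 = 0 := clamp_of_le le_rfl
    have c1 : clamp 1 = 1 := clamp_of_ge le_rfl
    have hud' : ψ (u0 d) ≠ 0 := by simpa using hud
    set H' : ℝ × E → E := fun z => ψ.symm (ψ (H z) * (ψ (u0 d) / ψ (H (clamp z.1, d)))) with hH'
    have hd' : ∀ t ∈ Icc (0:ℝ) 1, H' (t, d) = u0 d := by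
      intro t ht
      have := hne t
      rw [clamp_of_mem ht] at this
      simp only [hH', clamp_of_mem ht]
      rw [mul_div_cancel₀ _ this]
      simp
    refine ⟨H', fun _ => u0 d, ?_, by fun_prop, ?_, ?_, ?_, ?_, fun _ _ => hud⟩
    · apply hψ'.comp
      apply (hψ.comp hc).mul
      apply continuous_const.div
      · exact hψ.comp (hc.comp (by fun_prop))
      · intro z; exact hne z.1
    · intro y hy
      simp [hH', c0, h0 y hy, h0 d hd, hud']
    · intro y hy
      simp only [hH', c1, h1 y hy, h1 d hd, ← e, div_self hud']
      simp
    · intro t ht y hy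
      simp only [hH', ne_eq, LinearEquiv.map_eq_zero_iff, mul_eq_zero, div_eq_zero_iff, not_or]
      exact ⟨hn t ht y hy, hud, by simpa using hne t⟩
    · rintro ⟨t, s⟩ ⟨⟨ht, hs⟩, hz⟩
      simp [hd' t ht]

theorem hom_rel (hE : 2 ≤ Module.finrank ℝ E) {X D : Set E} (hX : IsCompact X) (hD : IsCompact D)
    (hDX : D ⊆ X) (hconv : Convex ℝ D) (hne : D.Nonempty) {u0 u1 : E → E} (hu0 : Continuous u0)
    (hh : Hom X u0 u1) (e : ∀ x ∈ D, u0 x = u1 x) :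
    ∃ H : ℝ × E → E, Continuous H ∧ (∀ y ∈ X, H (0, y) = u0 y) ∧ (∀ y ∈ X, H (1, y) = u1 y) ∧
      (∀ t ∈ Icc (0:ℝ) 1, ∀ y ∈ X, H (t, y) ≠ 0) ∧
      (∀ t ∈ Icc (0:ℝ) 1, ∀ y ∈ D, H (t, y) = u0 y) := by
  obtain ⟨d, hd⟩ := hne
  obtain ⟨H, Q, hc, hQ, h0, h1, hn, hQe, hQn⟩ := fix_point hE (hDX hd) hh (e d hd)
  have hu0n : ∀ y ∈ D, u0 y ≠ 0 := fun y hy => by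
    rw [← h0 y (hDX hy)]; exact hn 0 (by simp) y (hDX hy)
  -- step B
  set φ : E × (ℝ × ℝ) → E := fun w => H (w.2.1, w.1) + w.2.2 • (u0 w.1 - H (w.2.1, w.1)) +
    (Q w.2 - (H (w.2.1, d) + w.2.2 • (u0 d - H (w.2.1, d)))) with hφ
  have hφc : Continuous φ := by fun_prop
  have hφb : ∀ y, ∀ z ∈ bSq, φ (y, z) = H (z.1, y) + z.2 • (u0 y - H (z.1, y)) := by
    intro y z hz
    simp only [hφ, hQe z hz, sub_self, add_zero]
  have hφd : ∀ z, φ (d, z) = Q z := by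
    intro z; simp only [hφ]; abel
  have hφn : ∀ y ∈ D, ∀ z ∈ bSq, φ (y, z) ≠ 0 := by
    rintro y hy ⟨t, s⟩ hz
    rw [hφb y _ hz]
    obtain ⟨⟨ht, hs⟩, hz⟩ := hz
    simp only at ht hs hz ⊢
    rcases hz with rfl | rfl | rfl | rfl
    · simpa [h0 y (hDX hy)] using hu0n y hy
    · simpa [h1 y (hDX hy), ← e y hy] using hu0n y hy
    · simpa using hn t ht y (hDX hy)
    · simpa using hu0n y hy
  obtain ⟨FH, hFc, hF0, hFG, -, hFz⟩ := HEP (Y := E × (ℝ × ℝ)) (K := D ×ˢ Sq)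
    (C := (D ×ˢ bSq) ∪ ({d} ×ˢ Sq)) (hD.prod isCompact_Sq)
    ((hD.prod isCompact_bSq).isClosed.union (isCompact_singleton.prod isCompact_Sq).isClosed)
    (h := fun w => Q w.2) (by fun_prop) (G := fun z => φ (d + z.1 • (z.2.1 - d), z.2.2))
    (by fun_prop) (by intro w _; simp [hφd])
    (by
      rintro r hr ⟨y, z⟩ (⟨hy, hz⟩ | ⟨hy, hz⟩)
      · apply hφn _ _ _ hz
        exact hconv.add_smul_sub_mem hd hy hr
      · simp only [mem_singleton_iff] at hy
        subst hy
        simp only [sub_self, smul_zero, add_zero, hφd]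
        exact hQn z hz)
  have h11 : (1:ℝ) ∈ Icc (0:ℝ) 1 := by simp
  set F : E → ℝ → ℝ → E := fun y t s => FH (1, (y, (t, s))) with hF
  have hFb : ∀ y ∈ D, ∀ t s, (t, s) ∈ bSq → F y t s = H (t, y) + s • (u0 y - H (t, y)) := by
    intro y hy t s hz
    have := hFG 1 h11 (y, (t, s)) (Or.inl ⟨hy, hz⟩)
    simp only [one_smul, add_sub_cancel] at this
    rw [hF]
    simp only [this, hφb y _ hz]
  have hFn : ∀ y ∈ D, ∀ t s, (t, s) ∈ Sq → F y t s ≠ 0 := by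
    intro y hy t s hz h
    exact hQn _ hz (hFz 1 h11 (y, (t, s)) ⟨hy, hz⟩ h)
  have hFt0 : ∀ y ∈ D, ∀ s ∈ Icc (0:ℝ) 1, F y 0 s = u0 y := by
    intro y hy s hs
    rw [hFb y hy 0 s ⟨⟨by simp, hs⟩, by simp⟩, h0 y (hDX hy)]; simp
  have hFt1 : ∀ y ∈ D, ∀ s ∈ Icc (0:ℝ) 1, F y 1 s = u0 y := by
    intro y hy s hs
    rw [hFb y hy 1 s ⟨⟨by simp, hs⟩, by simp⟩, h1 y (hDX hy), ← e y hy]; simp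
  have hFs0 : ∀ y ∈ D, ∀ t ∈ Icc (0:ℝ) 1, F y t 0 = H (t, y) := by
    intro y hy t ht
    rw [hFb y hy t 0 ⟨⟨ht, by simp⟩, by simp⟩]; simp
  have hFs1 : ∀ y ∈ D, ∀ t ∈ Icc (0:ℝ) 1, F y t 1 = u0 y := by
    intro y hy t ht
    rw [hFb y hy t 1 ⟨⟨ht, by simp⟩, by simp⟩]; simp
  have h01 : (0:ℝ) ∈ Icc (0:ℝ) 1 := by simp
  -- step C
  set G : ℝ × (ℝ × E) → E := fun z => H z.2 + (F z.2.2 z.2.1 z.1 - F z.2.2 z.2.1 0)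
    - (1 - z.2.1) • (F z.2.2 0 z.1 - F z.2.2 0 0) - z.2.1 • (F z.2.2 1 z.1 - F z.2.2 1 0) with hG
  have hGc : Continuous G := by
    simp only [hG, hF]; fun_prop
  have hGD : ∀ s ∈ Icc (0:ℝ) 1, ∀ t ∈ Icc (0:ℝ) 1, ∀ y ∈ D, G (s, (t, y)) = F y t s := by
    intro s hs t ht y hy
    simp only [hG, hFt0 y hy s hs, hFt0 y hy 0 h01, hFt1 y hy s hs, hFt1 y hy 0 h01,
      hFs0 y hy t ht]
    simp
  have hG0 : ∀ s y, G (s, (0, y)) = H (0, y) := by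
    intro s y; simp [hG]
  have hG1 : ∀ s y, G (s, (1, y)) = H (1, y) := by
    intro s y; simp [hG]
  have hcl : IsClosed ((({0, 1} : Set ℝ) ×ˢ X) ∪ (Icc (0:ℝ) 1 ×ˢ D)) :=
    ((Set.toFinite _).isClosed.prod hX.isClosed).union (isClosed_Icc.prod hD.isClosed)
  obtain ⟨KH, hKc, -, hKG, -, hKz⟩ := HEP (Y := ℝ × E) (K := Icc (0:ℝ) 1 ×ˢ X)
    (C := (({0, 1} : Set ℝ) ×ˢ X) ∪ (Icc (0:ℝ) 1 ×ˢ D)) (isCompact_Icc.prod hX) hcl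
    (h := H) hc (G := G) hGc (by intro w _; simp [hG])
    (by
      rintro s hs ⟨t, y⟩ (⟨ht, hy⟩ | ⟨ht, hy⟩)
      · simp only [mem_insert_iff, mem_singleton_iff] at ht
        rcases ht with rfl | rfl
        · rw [hG0]; exact hn 0 h01 y hy
        · rw [hG1]; exact hn 1 h11 y hy
      · rw [hGD s hs t ht y hy]; exact hFn y hy t s ⟨ht, hs⟩)
  refine ⟨fun z => KH (1, z), by fun_prop, ?_, ?_, ?_, ?_⟩
  · intro y hy
    change KH (1, (0, y)) = u0 y
    rw [hKG 1 h11 (0, y) (Or.inl ⟨by simp, hy⟩), hG0, h0 y hy]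
  · intro y hy
    change KH (1, (1, y)) = u1 y
    rw [hKG 1 h11 (1, y) (Or.inl ⟨by simp, hy⟩), hG1, h1 y hy]
  · intro t ht y hy h
    exact hn t ht y hy (hKz 1 h11 (t, y) ⟨ht, hy⟩ h)
  · intro t ht y hy
    change KH (1, (t, y)) = u0 y
    rw [hKG 1 h11 (t, y) (Or.inr ⟨ht, hy⟩), hGD 1 h11 t ht y hy, hFs1 y hy t ht]

end pf
end RPD
end

section
open Metric Set Filter Topology
set_option linter.unusedSectionVars false

namespace RPD
section glue
variable {E : Type*} [NormedAddCommGroup E] [NormedSpace ℝ E] [FiniteDimensional ℝ E]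
variable {Y : Type*} [MetricSpace Y]

theorem TZ {K : Set Y} (hK : IsClosed K) {g : Y → E} (hg : ContinuousOn g K) :
    ∃ h : Y → E, Continuous h ∧ ∀ x ∈ K, h x = g x := by
  have : TietzeExtension E := TietzeExtension.of_tvs ℝ
  obtain ⟨f, hf⟩ := ContinuousMap.exists_restrict_eq hK ⟨K.domRestrict g, hg.domRestrict⟩
  refine ⟨f, f.continuous, fun x hx => ?_⟩
  exact DFunLike.congr_fun hf ⟨x, hx⟩

theorem glue {K₁ K₂ : Set Y} (h₁ : IsClosed K₁) (h₂ : IsClosed K₂) {e₁ e₂ : Y → E}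
    (c₁ : ContinuousOn e₁ K₁) (c₂ : ContinuousOn e₂ K₂) (h : ∀ x ∈ K₁, x ∈ K₂ → e₁ x = e₂ x) :
    ∃ e : Y → E, Continuous e ∧ (∀ x ∈ K₁, e x = e₁ x) ∧ ∀ x ∈ K₂, e x = e₂ x := by
  classical
  have hp1 : ∀ x ∈ K₁, K₁.piecewise e₁ e₂ x = e₁ x := fun x hx => by simp [hx]
  have hp2 : ∀ x ∈ K₂, K₁.piecewise e₁ e₂ x = e₂ x := fun x hx => by
    by_cases hx1 : x ∈ K₁
    · simp [hx1, h x hx1 hx]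
    · simp [hx1]
  obtain ⟨e, he, hee⟩ := TZ (h₁.union h₂) (g := K₁.piecewise e₁ e₂)
    (ContinuousOn.union_of_isClosed (c₁.congr hp1) (c₂.congr hp2) h₁ h₂)
  exact ⟨e, he, fun x hx => (hee x (Or.inl hx)).trans (hp1 x hx),
    fun x hx => (hee x (Or.inr hx)).trans (hp2 x hx)⟩

theorem Hom.of_path {Z : Type*} [TopologicalSpace Z] {C : Set Z} {H : ℝ × Z → E}
    (hc : Continuous H) (hn : ∀ t ∈ Icc (0:ℝ) 1, ∀ y ∈ C, H (t, y) ≠ 0) {h h' : Z → E}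
    (h0 : ∀ y ∈ C, H (0, y) = h y) (h1 : ∀ y ∈ C, H (1, y) = h' y) :
    Hom C h h' := ⟨H, hc, h0, h1, hn⟩

theorem linearize {h : E → E} (hc : Continuous h) {p : E} {L : E →L[ℝ] E}
    (hd : HasFDerivAt h L p) (hp : h p = 0) (hL : L.det ≠ 0) {X : Set E} (hX : IsCompact X)
    (hs : ∀ x ∈ X, ∀ s : ℝ, 0 < s → s ≤ 1 → h (p + s • (x - p)) ≠ 0) :
    Hom X h (fun x => L (x - p)) := by
  obtain ⟨C, hC⟩ := antilip_of_det_ne hL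
  have hLn : ∀ v, ‖v‖ ≤ C * ‖L v‖ := fun v => by
    have := hC.le_mul_dist v 0
    simpa using this
  have hv : ∀ x ∈ X, x - p ≠ 0 := by
    intro x hx h0
    apply hs x hx 1 one_pos le_rfl
    simp [h0, hp]
  have ho := hd.isLittleO
  have hCp : 0 < (2 * ((C:ℝ) + 1))⁻¹ := by positivity
  have h1 := ho.def hCp
  rw [Metric.eventually_nhds_iff] at h1
  obtain ⟨ε, hε, h2⟩ := h1
  obtain ⟨R, hR⟩ := (hX.image (f := fun x => x - p) (by fun_prop)).isBounded.exists_norm_le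
  have hR' : ∀ x ∈ X, ‖x - p‖ ≤ |R| := fun x hx =>
    (hR _ ⟨x, hx, rfl⟩).trans (le_abs_self R)
  set δ := min 1 (ε / (2 * (|R| + 1))) with hδ
  have hδ0 : 0 < δ := by positivity
  have hδ1 : δ ≤ 1 := min_le_left _ _
  have hδR : ∀ x ∈ X, ‖δ • (x - p)‖ < ε := by
    intro x hx
    rw [norm_smul, Real.norm_of_nonneg hδ0.le]
    calc δ * ‖x - p‖ ≤ ε / (2 * (|R| + 1)) * |R| := by
          gcongr
          · exact min_le_right _ _
          · exact hR' x hx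
      _ < ε := by
          rw [div_mul_eq_mul_div, div_lt_iff₀ (by positivity)]
          nlinarith [abs_nonneg R]
  have hlin : ∀ x ∈ X, ∀ s : ℝ, 0 < s → L (s • (x - p)) ≠ 0 := by
    intro x hx s hs' h0
    have := hLn (s • (x - p))
    rw [h0, norm_zero, mul_zero] at this
    have h3 := norm_le_zero_iff.1 this
    rw [smul_eq_zero] at h3
    rcases h3 with h3 | h3
    · exact hs'.ne' h3
    · exact hv x hx h3
  have A : Hom X h (fun x => h (p + δ • (x - p))) := by
    refine Hom.of_path (H := fun z => h (p + (1 - z.1 * (1 - δ)) • (z.2 - p))) (by fun_prop) ?_ ?_ ?_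
    · intro t ht y hy
      apply hs y hy
      · nlinarith [ht.1, ht.2]
      · nlinarith [ht.1, ht.2]
    · intro y _; simp
    · intro y _; simp
  have B : Hom X (fun x => L (δ • (x - p))) (fun x => h (p + δ • (x - p))) := by
    apply Hom.line (by fun_prop) (by fun_prop)
    intro x hx
    have h3 := h2 (y := p + δ • (x - p)) (by simpa using hδR x hx)
    simp only [hp, sub_zero, add_sub_cancel_left] at h3
    have h4 := hLn (δ • (x - p))
    have h5 : 0 < ‖L (δ • (x - p))‖ := norm_pos_iff.2 (hlin x hx δ hδ0)
    refine h3.trans_lt ?_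
    calc (2 * ((C:ℝ) + 1))⁻¹ * ‖δ • (x - p)‖ ≤ (2 * ((C:ℝ) + 1))⁻¹ * (C * ‖L (δ • (x - p))‖) := by
          gcongr
      _ < ‖L (δ • (x - p))‖ := by
          rw [inv_mul_lt_iff₀ (by positivity)]
          nlinarith [C.coe_nonneg]
  have D : Hom X (fun x => L (δ • (x - p))) (fun x => L (x - p)) := by
    refine Hom.of_path (H := fun z => L ((δ + z.1 * (1 - δ)) • (z.2 - p))) (by fun_prop) ?_ ?_ ?_
    · intro t ht y hy
      apply hlin y hy
      nlinarith [ht.1, ht.2]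
    · intro y _; simp
    · intro y _; simp
  exact A.trans (B.symm.trans D)

theorem lin_hom_at (hE : 2 ≤ Module.finrank ℝ E) {L L' : E →L[ℝ] E} (hL : 0 < L.det * L'.det)
    {p : E} {X : Set E} (hp : p ∉ X) : Hom X (fun x => L (x - p)) (fun x => L' (x - p)) :=
  (lin_hom hE L L' hL).comp (φ := fun x => x - p) (by fun_prop) (by
    intro x hx h
    simp only [mem_singleton_iff, sub_eq_zero] at h
    exact hp (h ▸ hx))

theorem det_inj {L : E →L[ℝ] E} (hL : L.det ≠ 0) {v : E} (h : L v = 0) : v = 0 := by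
  obtain ⟨C, hC⟩ := antilip_of_det_ne hL
  exact hC.injective (by simpa using h)

theorem hasFDerivAt_lin (L : E →L[ℝ] E) (q x : E) : HasFDerivAt (fun x => L (x - q)) L x := by
  simpa [map_sub] using (L.hasFDerivAt (x := x)).sub_const (L q)

/-- moving a zero within a ball -/
theorem local_move {h : E → E} (hc : Continuous h) {c p q : E} {r : ℝ}
    {L : E →L[ℝ] E} (hd : HasFDerivAt h L p) (hL : L.det ≠ 0)
    (hp : p ∈ ball c r) (hq : q ∈ ball c r) (hz : ∀ x ∈ closedBall c r, h x = 0 ↔ x = p) :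
    ∃ h' : E → E, Continuous h' ∧ (∀ x ∉ ball c r, h' x = h x) ∧
      (∀ x ∈ closedBall c r, h' x = 0 ↔ x = q) ∧ HasFDerivAt h' L q := by
  have hsb : ∀ x ∈ sphere c r, x ∉ ball c r := fun x hx hx' => by
    simp only [mem_sphere, mem_ball] at hx hx'; linarith
  have h1 : Hom (sphere c r) h (fun x => L (x - p)) := by
    apply linearize hc hd ((hz p (ball_subset_closedBall hp)).2 rfl) hL (isCompact_sphere c r)
    intro x hx s hs0 hs1 h0
    have hxc : x ∈ closedBall c r := sphere_subset_closedBall hx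
    have := (hz _ ((convex_closedBall c r).add_smul_sub_mem (ball_subset_closedBall hp) hxc
      ⟨hs0.le, hs1⟩)).1 h0
    simp only [add_eq_left, smul_eq_zero, hs0.ne', false_or, sub_eq_zero] at this
    exact hsb x hx (this ▸ hp)
  have h2 : Hom (sphere c r) (fun x => L (x - p)) (fun x => L (x - q)) := by
    refine Hom.of_path (H := fun z => L (z.2 - (p + z.1 • (q - p)))) (by fun_prop) ?_ ?_ ?_
    · intro t ht y hy h0
      have h3 := det_inj hL h0
      rw [sub_eq_zero] at h3
      apply hsb y hy
      simp only at h3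
      rw [h3]
      exact (convex_ball c r).add_smul_sub_mem hp hq ht
    · intro y _; simp
    · intro y _; simp
  obtain ⟨G, hG, hG0, hG1, hGn⟩ := (h1.trans h2).symm
  obtain ⟨H, hH, -, hHG, ⟨U, hU, hUz, hUe⟩, hHz⟩ := HEP (isCompact_closedBall c r)
    (isClosed_sphere (x := c) (ε := r)) (h := fun x => L (x - q)) (by fun_prop) hG hG0 hGn
  obtain ⟨h', hc', e1, e2⟩ := glue (isClosed_closedBall (x := c) (ε := r))
    (isOpen_ball (x := c) (ε := r)).isClosed_compl (e₁ := fun x => H (1, x)) (e₂ := h)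
    (by fun_prop) (by fun_prop) (by
      intro x hx hx'
      have hxs : x ∈ sphere c r := by
        simp only [mem_closedBall, mem_compl_iff, mem_ball, not_lt] at hx hx'
        exact le_antisymm hx hx'
      show H (1, x) = h x
      rw [hHG 1 (by simp) x hxs, hG1 x hxs])
  have hqU := hUz q (ball_subset_closedBall hq) (by simp)
  have hloc : h' =ᶠ[𝓝 q] fun x => L (x - q) := by
    filter_upwards [hU.mem_nhds hqU, isOpen_ball.mem_nhds hq] with x hx hx'
    rw [e1 x (ball_subset_closedBall hx'), hUe x hx]
  refine ⟨h', hc', fun x hx => e2 x hx, ?_, ?_⟩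
  · intro x hx
    constructor
    · intro h0
      rw [e1 x hx] at h0
      have := hHz 1 (by simp) x hx h0
      exact sub_eq_zero.1 (det_inj hL this)
    · rintro rfl
      rw [hloc.self_of_nhds]; simp
  · apply HasFDerivAt.congr_of_eventuallyEq _ hloc
    exact hasFDerivAt_lin L q q

end glue
end RPD
end

section
open Metric Set Filter Topology
set_option linter.unusedSectionVars false

namespace RPD
section can
variable {E : Type*} [NormedAddCommGroup E] [NormedSpace ℝ E] [FiniteDimensional ℝ E]

theorem hom_const (hE : 2 ≤ Module.finrank ℝ E) {Z : Type*} [TopologicalSpace Z] (D : Set Z)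
    {a b : E} (ha : a ≠ 0) (hb : b ≠ 0) :
    Hom D (fun _ => a) (fun _ => b) := by
  have hr : 1 < Module.rank ℝ E := by
    rw [← Module.finrank_eq_rank]; exact_mod_cast (by omega : 1 < Module.finrank ℝ E)
  obtain ⟨γ, hγ⟩ := (isPathConnected_compl_singleton_of_one_lt_rank hr (0:E)).joinedIn a ha b hb
  refine ⟨fun z => γ.extend z.1, by fun_prop, by simp, by simp, ?_⟩
  intro t ht y _
  have := hγ ⟨t, ht⟩
  simpa [Path.extend_apply _ ht] using this

theorem hom_contract {F : Type*} [NormedAddCommGroup F] [NormedSpace ℝ F] {D : Set F} {d : F}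
    (hstar : ∀ x ∈ D, ∀ t ∈ Icc (0:ℝ) 1, d + t • (x - d) ∈ D)
    {h : F → E} (hc : Continuous h) (h0 : ∀ x ∈ D, h x ≠ 0) :
    Hom D (fun _ => h d) h := by
  refine Hom.of_path (H := fun z => h (d + z.1 • (z.2 - d))) (by fun_prop) ?_ (by simp) (by simp)
  intro t ht y hy
  exact h0 _ (hstar y hy t ht)

theorem hom_star (hE : 2 ≤ Module.finrank ℝ E) {F : Type*} [NormedAddCommGroup F] [NormedSpace ℝ F]
    {D : Set F} {d : F} (hd : d ∈ D)
    (hstar : ∀ x ∈ D, ∀ t ∈ Icc (0:ℝ) 1, d + t • (x - d) ∈ D)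
    {h h' : F → E} (hc : Continuous h) (hc' : Continuous h') (h0 : ∀ x ∈ D, h x ≠ 0)
    (h0' : ∀ x ∈ D, h' x ≠ 0) : Hom D h h' :=
  (hom_contract hstar hc h0).symm.trans ((hom_const hE D (h0 d hd) (h0' d hd)).trans
    (hom_contract hstar hc' h0'))

theorem hom_half (hE : 2 ≤ Module.finrank ℝ E) {h m : E → E} (hc : Continuous h)
    (mc : Continuous m) {p : E} {L L' : E →L[ℝ] E} (hd : HasFDerivAt h L p)
    (md : HasFDerivAt m L' p) (hp : h p = 0) (mp : m p = 0) (hL : 0 < L.det * L'.det)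
    {X : Set E} (hX : IsCompact X)
    (hs : ∀ x ∈ X, ∀ s : ℝ, 0 < s → s ≤ 1 → h (p + s • (x - p)) ≠ 0)
    (ms : ∀ x ∈ X, ∀ s : ℝ, 0 < s → s ≤ 1 → m (p + s • (x - p)) ≠ 0) : Hom X h m := by
  have hpX : p ∉ X := fun h => hs p h 1 one_pos le_rfl (by simpa using hp)
  have h1 : L.det ≠ 0 := fun h => by simp [h] at hL
  have h2 : L'.det ≠ 0 := fun h => by simp [h] at hL
  exact (linearize hc hd hp h1 hX hs).trans ((lin_hom_at hE hL hpX).trans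
    (linearize mc md mp h2 hX ms).symm)

theorem det_transv (f : E →L[ℝ] ℝ) (w : E) (a : ℝ) :
    (ContinuousLinearMap.id ℝ E + a • f.smulRight w).det = 1 + a * f w := by
  have : (ContinuousLinearMap.id ℝ E + a • f.smulRight w : E →L[ℝ] E).toLinearMap =
      LinearMap.transvection (a • f.toLinearMap) w := by
    ext x
    simp [LinearMap.transvection, mul_smul]
  rw [ContinuousLinearMap.det, this, LinearMap.transvection.det]
  simp

theorem det_comp' (A B : E →L[ℝ] E) : (A.comp B).det = A.det * B.det := by
  simp [ContinuousLinearMap.det, LinearMap.det_comp]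

theorem exists_refl (hE : 2 ≤ Module.finrank ℝ E) (d : ℝ) (hd : d ≠ 0) :
    ∃ A : E →L[ℝ] E, A.det * d < 0 := by
  have : Nontrivial E := Module.nontrivial_of_finrank_pos (R := ℝ) (by omega)
  rcases lt_or_gt_of_ne hd with h | h
  · refine ⟨ContinuousLinearMap.id ℝ E, ?_⟩
    simpa [ContinuousLinearMap.det] using h
  · obtain ⟨w, hw⟩ := exists_ne (0:E)
    obtain ⟨f, hf⟩ := SeparatingDual.exists_eq_one (R := ℝ) hw
    refine ⟨ContinuousLinearMap.id ℝ E + (-2:ℝ) • f.smulRight w, ?_⟩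
    rw [det_transv, hf]
    linarith

set_option maxHeartbeats 4000000 in
theorem local_cancel (hE : 2 ≤ Module.finrank ℝ E) {h : E → E} (hc : Continuous h) {c p q : E}
    {r : ℝ} {Lp Lq : E →L[ℝ] E} (hdp : HasFDerivAt h Lp p) (hdq : HasFDerivAt h Lq q)
    (hL : Lp.det * Lq.det < 0) (hp : p ∈ ball c r) (hq : q ∈ ball c r) (hpq : p ≠ q)
    (hz : ∀ x ∈ closedBall c r, h x = 0 ↔ x = p ∨ x = q) :
    ∃ h' : E → E, Continuous h' ∧ (∀ x ∉ ball c r, h' x = h x) ∧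
      (∀ x ∈ closedBall c r, h' x ≠ 0) := by
  have hpc := ball_subset_closedBall hp
  have hqc := ball_subset_closedBall hq
  have hconv := convex_closedBall c r
  have hsb : ∀ x ∈ sphere c r, x ∉ ball c r := fun x hx hx' => by
    simp only [mem_sphere, mem_ball] at hx hx'; linarith
  have hLp : Lp.det ≠ 0 := fun h => by simp [h] at hL
  have hLq : Lq.det ≠ 0 := fun h => by simp [h] at hL
  obtain ⟨A, hA⟩ := exists_refl hE Lp.det hLp
  have hA0 : A.det ≠ 0 := fun h => by simp [h] at hA
  set w := q - p with hw
  have hw0 : w ≠ 0 := sub_ne_zero.2 hpq.symm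
  obtain ⟨f, hf⟩ := SeparatingDual.exists_eq_one (R := ℝ) hw0
  set mid : E := (1/2:ℝ) • (p + q) with hmid
  have hpm : p = mid - (1/2:ℝ) • w := by rw [hmid, hw]; module
  have hqm : q = mid + (1/2:ℝ) • w := by rw [hmid, hw]; module
  set τ : E → ℝ := fun x => f (x - mid) with hτ
  have hτc : Continuous τ := by fun_prop
  have hτp : τ p = -1/2 := by simp only [hτ, hpm, sub_sub_cancel_left, map_neg, map_smul, hf]; norm_num
  have hτq : τ q = 1/2 := by simp only [hτ, hqm, add_sub_cancel_left, map_smul, hf]; norm_num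
  have hτa : ∀ x y : E, ∀ s : ℝ, τ (y + s • (x - y)) = (1 - s) * τ y + s * τ x := by
    intro x y s
    simp only [hτ, map_sub, map_add, map_smul, smul_eq_mul]; ring
  set m0 : ℝ → E → E := fun s x => (4 * τ x ^ 2 - 1 + 2 * s) • w + (x - mid - τ x • w) with hm0
  have hm0c : Continuous fun z : ℝ × E => m0 z.1 z.2 := by simp only [hm0]; fun_prop
  have hm0z : ∀ s x, m0 s x = 0 → 4 * τ x ^ 2 - 1 + 2 * s = 0 ∧ x = mid + τ x • w := by
    intro s x h0
    have h1 := congrArg f h0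
    simp only [hm0, map_add, map_smul, map_sub, hf, smul_eq_mul, map_zero] at h1
    have h2 : τ x = f x - f mid := by simp [hτ]
    have h3 : 4 * τ x ^ 2 - 1 + 2 * s = 0 := by rw [← h2] at h1; linarith
    refine ⟨h3, ?_⟩
    simp only [hm0, h3, zero_smul, zero_add] at h0
    rw [sub_sub, sub_eq_zero] at h0
    exact h0
  have hm00 : ∀ x, m0 0 x = 0 ↔ x = p ∨ x = q := by
    intro x
    constructor
    · intro h0
      obtain ⟨h1, h2⟩ := hm0z 0 x h0
      have h3 : (τ x - 1/2) * (τ x + 1/2) = 0 := by nlinarith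
      rcases mul_eq_zero.1 h3 with h4 | h4
      · right; rw [hqm, h2]; congr 2; linarith
      · left; rw [hpm, h2, sub_eq_add_neg, ← neg_smul]; congr 2; linarith
    · rintro (rfl | rfl)
      · simp only [hm0, hτp]
        rw [hmid, hw]; module
      · simp only [hm0, hτq]
        rw [hmid, hw]; module
  have hm0d : ∀ x, HasFDerivAt (m0 0) (ContinuousLinearMap.id ℝ E + (8 * τ x - 1) • f.smulRight w) x := by
    intro x
    have h1 : HasFDerivAt τ f x := by
      simpa [hτ, map_sub] using (f.hasFDerivAt (x := x)).sub_const (f mid)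
    have h2 := (((((h1.pow 2).const_mul 4).sub_const 1).add_const (2 * 0)).smul_const w).add
      (((hasFDerivAt_id x).sub_const mid).sub (h1.smul_const w))
    refine HasFDerivAt.congr_fderiv (h2.congr_of_eventuallyEq ?_) ?_
    · exact Eventually.of_forall fun y => by simp [hm0]
    · ext v
      simp
      module
  set m : E → E := fun x => A (m0 0 x) with hm
  have hmc : Continuous m := by
    have : Continuous (m0 0) := hm0c.comp (by fun_prop : Continuous fun x : E => ((0:ℝ), x))
    fun_prop
  have hmz : ∀ x, m x = 0 ↔ x = p ∨ x = q := by
    intro x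
    rw [← hm00]
    exact ⟨fun h => det_inj hA0 h, fun h => by simp [hm, h]⟩
  set M : E → E →L[ℝ] E := fun x => A.comp (ContinuousLinearMap.id ℝ E + (8 * τ x - 1) • f.smulRight w)
  have hmd : ∀ x, HasFDerivAt m (M x) x := fun x => A.hasFDerivAt.comp x (hm0d x)
  have hMd : ∀ x, (M x).det = A.det * (8 * τ x) := by
    intro x
    have : (M x).det = A.det * (ContinuousLinearMap.id ℝ E + (8 * τ x - 1) • f.smulRight w).det := by
      exact det_comp' _ _
    rw [this, det_transv, hf]; ring
  set D : Set E := closedBall c r ∩ {x | τ x = 0} with hD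
  have hDc : IsCompact D := (isCompact_closedBall c r).inter_right (isClosed_eq hτc continuous_const)
  have hmidD : mid ∈ D := by
    refine ⟨?_, by simp [hτ]⟩
    have := hconv.add_smul_sub_mem hpc hqc (t := 1/2) ⟨by norm_num, by norm_num⟩
    convert this using 1
    rw [hmid]; module
  have hDconv : Convex ℝ D := by
    apply hconv.inter
    intro x hx y hy a b ha hb hab
    simp only [mem_ofPred_eq] at hx hy ⊢
    have : a • x + b • y = x + b • (y - x) := by
      rw [show a = 1 - b by linarith]; module
    rw [this, hτa, hx, hy]; simp
  have hDp : p ∉ D := fun h => by have := h.2; simp only [mem_ofPred_eq, hτp] at this; norm_num at this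
  have hDq : q ∉ D := fun h => by have := h.2; simp only [mem_ofPred_eq, hτq] at this; norm_num at this
  have hDm : ∀ x ∈ D, m x ≠ 0 := fun x hx h => by
    rcases (hmz x).1 h with rfl | rfl
    · exact hDp hx
    · exact hDq hx
  have hDh : ∀ x ∈ D, h x ≠ 0 := fun x hx h => by
    rcases (hz x hx.1).1 h with rfl | rfl
    · exact hDp hx
    · exact hDq hx
  -- step one
  obtain ⟨G, hG, hG0, hG1, hGn⟩ := hom_star hE hmidD
    (fun x hx t ht => hDconv.add_smul_sub_mem hmidD hx ht) hc hmc hDh hDm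
  obtain ⟨H, hH, hH0, hHG, ⟨U, hU, hUz, hUe⟩, hHz⟩ := HEP (isCompact_closedBall c r)
    hDc.isClosed hc hG hG0 hGn
  set h1 : E → E := fun x => H (1, x) with hh1
  have h1c : Continuous h1 := by fun_prop
  have h1m : ∀ x ∈ D, h1 x = m x := fun x hx => by
    rw [hh1]; simp only [hHG 1 (by simp) x hx, hG1 x hx]
  have h1z : ∀ x ∈ closedBall c r, h1 x = 0 → x = p ∨ x = q := fun x hx h0 =>
    (hz x hx).1 (hHz 1 (by simp) x hx h0)
  have germ : ∀ x ∈ closedBall c r, h x = 0 → h1 =ᶠ[𝓝 x] h := by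
    intro x hx h0
    filter_upwards [hU.mem_nhds (hUz x hx h0)] with y hy
    exact hUe y hy 1
  have hp0 : h p = 0 := (hz p hpc).2 (Or.inl rfl)
  have hq0 : h q = 0 := (hz q hqc).2 (Or.inr rfl)
  have h1dp : HasFDerivAt h1 Lp p := hdp.congr_of_eventuallyEq (germ p hpc hp0)
  have h1dq : HasFDerivAt h1 Lq q := hdq.congr_of_eventuallyEq (germ q hqc hq0)
  have h1p : h1 p = 0 := (germ p hpc hp0).self_of_nhds.trans hp0
  have h1q : h1 q = 0 := (germ q hqc hq0).self_of_nhds.trans hq0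
  have hS1 : Hom (sphere c r) h h1 := by
    refine ⟨H, hH, fun y _ => hH0 y, fun y _ => rfl, ?_⟩
    intro t ht y hy h0
    have hyc := sphere_subset_closedBall hy
    rcases (hz y hyc).1 (hHz t ht y hyc h0) with rfl | rfl
    · exact hsb _ hy hp
    · exact hsb _ hy hq
  -- step two
  set XL : Set E := (sphere c r ∩ {x | τ x ≤ 0}) ∪ D with hXL
  set XR : Set E := (sphere c r ∩ {x | 0 ≤ τ x}) ∪ D with hXR
  have hXLc : IsCompact XL :=
    ((isCompact_sphere c r).inter_right (isClosed_le hτc continuous_const)).union hDc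
  have hXRc : IsCompact XR :=
    ((isCompact_sphere c r).inter_right (isClosed_le continuous_const hτc)).union hDc
  have memL : ∀ x ∈ XL, x ∈ closedBall c r ∧ τ x ≤ 0 ∧ x ≠ p := by
    rintro x (⟨hx, hx'⟩ | hx)
    · exact ⟨sphere_subset_closedBall hx, hx', fun h => hsb x hx (h ▸ hp)⟩
    · exact ⟨hx.1, le_of_eq hx.2, fun h => hDp (h ▸ hx)⟩
  have memR : ∀ x ∈ XR, x ∈ closedBall c r ∧ 0 ≤ τ x ∧ x ≠ q := by
    rintro x (⟨hx, hx'⟩ | hx)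
    · exact ⟨sphere_subset_closedBall hx, hx', fun h => hsb x hx (h ▸ hq)⟩
    · exact ⟨hx.1, le_of_eq hx.2.symm, fun h => hDq (h ▸ hx)⟩
  have starL : ∀ x ∈ XL, ∀ s : ℝ, 0 < s → s ≤ 1 → ∀ g : E → E,
      (∀ x ∈ closedBall c r, g x = 0 → x = p ∨ x = q) → g (p + s • (x - p)) ≠ 0 := by
    intro x hx s hs0 hs1 g hg h0
    obtain ⟨hxc, hxt, hxp⟩ := memL x hx
    rcases hg _ (hconv.add_smul_sub_mem hpc hxc ⟨hs0.le, hs1⟩) h0 with h2 | h2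
    · simp only [add_eq_left, smul_eq_zero, hs0.ne', false_or, sub_eq_zero] at h2
      exact hxp h2
    · have := hτa x p s
      rw [h2, hτp, hτq] at this
      nlinarith
  have starR : ∀ x ∈ XR, ∀ s : ℝ, 0 < s → s ≤ 1 → ∀ g : E → E,
      (∀ x ∈ closedBall c r, g x = 0 → x = p ∨ x = q) → g (q + s • (x - q)) ≠ 0 := by
    intro x hx s hs0 hs1 g hg h0
    obtain ⟨hxc, hxt, hxp⟩ := memR x hx
    rcases hg _ (hconv.add_smul_sub_mem hqc hxc ⟨hs0.le, hs1⟩) h0 with h2 | h2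
    · have := hτa x q s
      rw [h2, hτp, hτq] at this
      nlinarith
    · simp only [add_eq_left, smul_eq_zero, hs0.ne', false_or, sub_eq_zero] at h2
      exact hxp h2
  have homL : Hom XL h1 m := hom_half hE h1c hmc h1dp (hmd p) h1p ((hmz p).2 (Or.inl rfl))
    (by rw [hMd, hτp]; nlinarith) hXLc (fun x hx s h0 h1 => starL x hx s h0 h1 _ h1z)
    (fun x hx s h0 h1 => starL x hx s h0 h1 _ fun x _ => (hmz x).1)
  have hALq : 0 < A.det * Lq.det := by
    have h3 : 0 < (A.det * Lp.det) * (Lp.det * Lq.det) := mul_pos_of_neg_of_neg hA hL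
    have h4 : (A.det * Lp.det) * (Lp.det * Lq.det) = Lp.det ^ 2 * (A.det * Lq.det) := by ring
    rw [h4] at h3
    exact pos_of_mul_pos_right h3 (sq_nonneg _)
  have homR : Hom XR h1 m := hom_half hE h1c hmc h1dq (hmd q) h1q ((hmz q).2 (Or.inr rfl))
    (by rw [hMd, hτq]; nlinarith) hXRc (fun x hx s h0 h1 => starR x hx s h0 h1 _ h1z)
    (fun x hx s h0 h1 => starR x hx s h0 h1 _ fun x _ => (hmz x).1)
  obtain ⟨HL, hLc, hL0, hL1, hLn, hLD⟩ := hom_rel hE hXLc hDc subset_union_right hDconv ⟨mid, hmidD⟩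
    h1c homL h1m
  obtain ⟨HR, hRc, hR0, hR1, hRn, hRD⟩ := hom_rel hE hXRc hDc subset_union_right hDconv ⟨mid, hmidD⟩
    h1c homR h1m
  have hS2 : Hom (sphere c r) h1 m := by
    obtain ⟨e, hec, e1, e2⟩ := glue (isClosed_Icc.prod hXLc.isClosed : IsClosed (Icc (0:ℝ) 1 ×ˢ XL))
      (isClosed_Icc.prod hXRc.isClosed : IsClosed (Icc (0:ℝ) 1 ×ˢ XR)) hLc.continuousOn
      hRc.continuousOn (by
        rintro ⟨t, x⟩ ⟨ht, hx⟩ ⟨-, hx'⟩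
        simp only at ht hx hx'
        have hxD : x ∈ D := ⟨(memL x hx).1, le_antisymm (memL x hx).2.1 (memR x hx').2.1⟩
        rw [hLD t ht x hxD, hRD t ht x hxD])
    have cov : ∀ x ∈ sphere c r, x ∈ XL ∨ x ∈ XR := by
      intro x hx
      rcases le_total (τ x) 0 with h | h
      · exact Or.inl (Or.inl ⟨hx, h⟩)
      · exact Or.inr (Or.inl ⟨hx, h⟩)
    have key : ∀ t ∈ Icc (0:ℝ) 1, ∀ x ∈ sphere c r,
        (x ∈ XL ∧ e (t, x) = HL (t, x)) ∨ (x ∈ XR ∧ e (t, x) = HR (t, x)) := by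
      intro t ht x hx
      rcases cov x hx with h | h
      · exact Or.inl ⟨h, e1 _ ⟨ht, h⟩⟩
      · exact Or.inr ⟨h, e2 _ ⟨ht, h⟩⟩
    refine ⟨e, hec, ?_, ?_, ?_⟩
    · intro x hx
      rcases key 0 (by simp) x hx with ⟨h, h'⟩ | ⟨h, h'⟩
      · rw [h', hL0 x h]
      · rw [h', hR0 x h]
    · intro x hx
      rcases key 1 (by simp) x hx with ⟨h, h'⟩ | ⟨h, h'⟩
      · rw [h', hL1 x h]
      · rw [h', hR1 x h]
    · intro t ht x hx
      rcases key t ht x hx with ⟨h, h'⟩ | ⟨h, h'⟩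
      · rw [h']; exact hLn t ht x h
      · rw [h']; exact hRn t ht x h
  -- step three
  have hS3 : Hom (sphere c r) m (fun x => A (m0 1 x)) := by
    refine Hom.of_path (H := fun z => A (m0 z.1 z.2)) (by fun_prop) ?_ (by simp [hm]) (by simp)
    intro t ht x hx h0
    obtain ⟨h2, h3⟩ := hm0z t x (det_inj hA0 h0)
    apply hsb x hx
    have h4 : (τ x) ^ 2 ≤ (1/2) ^ 2 := by nlinarith [ht.1]
    have h5 := abs_le_of_sq_le_sq' h4 (by norm_num)
    have h6 := (convex_ball c r).add_smul_sub_mem hp hq (t := τ x + 1/2)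
      ⟨by linarith [h5.1], by linarith [h5.2]⟩
    rw [h3]
    convert h6 using 1
    rw [hmid, hw]; module
  obtain ⟨G2, hG2, hG20, hG21, hG2n⟩ := (hS1.trans (hS2.trans hS3)).symm
  obtain ⟨H2, hH2, -, hHG2, -, hHz2⟩ := HEP (isCompact_closedBall c r)
    (isClosed_sphere (x := c) (ε := r)) (h := fun x => A (m0 1 x)) (by fun_prop) hG2 hG20 hG2n
  obtain ⟨h', hc', e1, e2⟩ := glue (isClosed_closedBall (x := c) (ε := r))
    (isOpen_ball (x := c) (ε := r)).isClosed_compl (e₁ := fun x => H2 (1, x)) (e₂ := h)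
    (by fun_prop) (by fun_prop) (by
      intro x hx hx'
      have hxs : x ∈ sphere c r := by
        simp only [mem_closedBall, mem_compl_iff, mem_ball, not_lt] at hx hx'
        exact le_antisymm hx hx'
      show H2 (1, x) = h x
      rw [hHG2 1 (by simp) x hxs, hG21 x hxs])
  refine ⟨h', hc', fun x hx => e2 x hx, ?_⟩
  intro x hx h0
  rw [e1 x hx] at h0
  have := (hm0z 1 x (det_inj hA0 (hHz2 1 (by simp) x hx h0))).1
  nlinarith [sq_nonneg (τ x)]

end can
end RPD
end

section
open Metric Set Filter Topology
set_option linter.unusedSectionVars false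

namespace RPD
section canw
variable {E : Type*} [NormedAddCommGroup E] [NormedSpace ℝ E] [FiniteDimensional ℝ E]

theorem one_lt_rank (hE : 2 ≤ Module.finrank ℝ E) : 1 < Module.rank ℝ E := by
  rw [← Module.finrank_eq_rank]; exact_mod_cast (by omega : 1 < Module.finrank ℝ E)

theorem punctured (hE : 2 ≤ Module.finrank ℝ E) (a : E) (r : ℝ) :
    IsPreconnected (ball a r \ {a}) := by
  have h1 : IsPreconnected (sphere (0:E) 1 ×ˢ Ioo (0:ℝ) r) :=
    (isPreconnected_sphere (one_lt_rank hE) 0 1).prod isPreconnected_Ioo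
  have h2 := h1.image (fun z => a + z.2 • z.1) (by fun_prop)
  convert h2 using 1
  ext x
  constructor
  · rintro ⟨hx, hxa⟩
    have hxa' : x - a ≠ 0 := sub_ne_zero.2 hxa
    have hn : 0 < ‖x - a‖ := norm_pos_iff.2 hxa'
    refine ⟨(‖x - a‖⁻¹ • (x - a), ‖x - a‖), ⟨?_, hn, ?_⟩, ?_⟩
    · simp [norm_smul, hn.ne']
    · simpa [dist_eq_norm] using hx
    · simp [smul_smul, hn.ne']
  · rintro ⟨⟨u, t⟩, ⟨hu, ht⟩, rfl⟩
    simp only [mem_sphere_iff_norm, sub_zero] at hu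
    simp only at ht
    refine ⟨?_, ?_⟩
    · simp [norm_smul, hu, abs_of_pos ht.1, ht.2]
    · simp only [mem_singleton_iff, add_eq_left, smul_eq_zero, ht.1.ne', false_or]
      rintro rfl
      simp at hu

theorem diff_singleton_aux {Ω u v : Set E} (hΩc : IsPreconnected Ω) {a : E} {r : ℝ}
    (hr : 0 < r) (hu : IsOpen u) (hv : IsOpen v) (hcov : Ω \ {a} ⊆ u ∪ v)
    (hB : ball a r \ {a} ⊆ u) (huN : ((Ω \ {a}) ∩ u).Nonempty)
    (hvN : ((Ω \ {a}) ∩ v).Nonempty) : ((Ω \ {a}) ∩ (u ∩ v)).Nonempty := by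
  obtain ⟨y, hyΩ, hy1, hy2, hya⟩ := hΩc (u ∪ ball a r) (v \ {a}) (hu.union isOpen_ball)
    (hv.sdiff isClosed_singleton) (by
      intro x hx
      by_cases hxa : x = a
      · left; right; rw [hxa]; exact mem_ball_self hr
      · rcases hcov ⟨hx, hxa⟩ with h | h
        · exact Or.inl (Or.inl h)
        · exact Or.inr ⟨h, hxa⟩)
    (by obtain ⟨x, hx, hx'⟩ := huN; exact ⟨x, hx.1, Or.inl hx'⟩)
    (by obtain ⟨x, hx, hx'⟩ := hvN; exact ⟨x, hx.1, hx', hx.2⟩)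
  rcases hy1 with h | h
  · exact ⟨y, ⟨hyΩ, hya⟩, h, hy2⟩
  · exact ⟨y, ⟨hyΩ, hya⟩, hB ⟨h, hya⟩, hy2⟩

theorem diff_singleton (hE : 2 ≤ Module.finrank ℝ E) {Ω : Set E} (hΩ : IsOpen Ω)
    (hΩc : IsPreconnected Ω) (a : E) : IsPreconnected (Ω \ {a}) := by
  by_cases ha : a ∈ Ω
  swap
  · rwa [sdiff_singleton_eq_self ha]
  obtain ⟨r, hr, hrΩ⟩ := Metric.isOpen_iff.1 hΩ a ha
  intro u v hu hv hcov huN hvN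
  by_contra hne
  rw [not_nonempty_iff_eq_empty] at hne
  have hsub : ball a r \ {a} ⊆ Ω \ {a} := sdiff_subset_sdiff_left hrΩ
  rcases isPreconnected_iff_subset_of_disjoint.1 (punctured hE a r) u v hu hv (hsub.trans hcov)
    (by rw [← subset_empty_iff, ← hne]; exact inter_subset_inter_left _ hsub) with h | h
  · have := diff_singleton_aux hΩc hr hu hv hcov h huN hvN
    rw [hne] at this
    exact not_nonempty_empty this
  · have := diff_singleton_aux hΩc hr hv hu (by rwa [union_comm]) h hvN huN
    rw [inter_comm v u, hne] at this
    exact not_nonempty_empty this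

theorem diff_finite (hE : 2 ≤ Module.finrank ℝ E) {Ω : Set E} (hΩ : IsOpen Ω)
    (hΩc : IsPreconnected Ω) {F : Set E} (hF : F.Finite) : IsPreconnected (Ω \ F) := by
  induction F, hF using Set.Finite.induction_on with
  | empty => simpa
  | @insert a F _ hF ih =>
    have : Ω \ insert a F = (Ω \ F) \ {a} := by
      ext x; simp only [Set.mem_sdiff, mem_insert_iff, mem_singleton_iff]; tauto
    rw [this]
    exact diff_singleton hE (hΩ.sdiff hF.isClosed) ih a

theorem germ_compl {h h' : E → E} {c : E} {r : ℝ} (e : ∀ x ∉ ball c r, h' x = h x) {y : E}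
    (hy : y ∉ closedBall c r) : h' =ᶠ[𝓝 y] h := by
  filter_upwards [isClosed_closedBall.isOpen_compl.mem_nhds hy] with x hx
  exact e x fun hx' => hx (ball_subset_closedBall hx')

def Mv (U K F : Set E) (h : E → E) (L : E →L[ℝ] E) (x : E) : Prop :=
  ∃ h' : E → E, Continuous h' ∧ (∀ y ∈ K \ U, h' y = h y) ∧
    (∀ y ∈ K, h' y = 0 ↔ y ∈ F ∨ y = x) ∧ HasFDerivAt h' L x ∧ ∀ y ∈ F, h' =ᶠ[𝓝 y] h

theorem Mv.local {U K F : Set E} {h : E → E} {L : E →L[ℝ] E} (hUK : U ⊆ K) (hL : L.det ≠ 0)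
    {c : E} {r : ℝ} (hb : closedBall c r ⊆ U \ F) {x y : E} (hx : x ∈ ball c r)
    (hy : y ∈ ball c r) (hM : Mv U K F h L x) : Mv U K F h L y := by
  obtain ⟨h', hc, h1, h2, h3, h4⟩ := hM
  have hbK : ∀ z ∈ closedBall c r, z ∈ K := fun z hz => hUK (hb hz).1
  obtain ⟨g, gc, g1, g2, g3⟩ := local_move hc h3 hL hx hy (by
    intro z hz
    rw [h2 z (hbK z hz)]
    exact ⟨fun h => h.resolve_left (hb hz).2, Or.inr⟩)
  refine ⟨g, gc, ?_, ?_, g3, ?_⟩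
  · intro z hz
    rw [g1 z fun hz' => hz.2 (hb (ball_subset_closedBall hz')).1, h1 z hz]
  · intro z hz
    by_cases hzb : z ∈ closedBall c r
    · rw [g2 z hzb]
      exact ⟨Or.inr, fun h => h.resolve_left (hb hzb).2⟩
    · rw [g1 z fun hz' => hzb (ball_subset_closedBall hz'), h2 z hz]
      have n1 : z ≠ x := fun h => hzb (h ▸ ball_subset_closedBall hx)
      have n2 : z ≠ y := fun h => hzb (h ▸ ball_subset_closedBall hy)
      simp [n1, n2]
  · intro z hz
    exact (germ_compl g1 fun hz' => (hb hz').2 hz).trans (h4 z hz)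

theorem Mv.all (hE : 2 ≤ Module.finrank ℝ E) {U K F : Set E} {h : E → E} {L : E →L[ℝ] E}
    (hU : IsOpen U) (hUc : IsPreconnected U) (hF : F.Finite) (hUK : U ⊆ K) (hL : L.det ≠ 0)
    {p x : E} (hp : p ∈ U \ F) (hM : Mv U K F h L p) (hx : x ∈ U \ F) : Mv U K F h L x := by
  have hV : IsOpen (U \ F) := hU.sdiff hF.isClosed
  have hVc := diff_finite hE hU hUc hF
  have loc : ∀ c ∈ U \ F, ∃ r > 0, ball c r ⊆ U \ F ∧ ∀ y ∈ ball c r, Mv U K F h L c ↔ Mv U K F h L y := by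
    intro c hc
    obtain ⟨r, hr, hb⟩ := Metric.nhds_basis_closedBall.mem_iff.1 (hV.mem_nhds hc)
    refine ⟨r, hr, ball_subset_closedBall.trans hb, fun y hy => ⟨?_, ?_⟩⟩
    · exact Mv.local hUK hL hb (mem_ball_self hr) hy
    · exact Mv.local hUK hL hb hy (mem_ball_self hr)
  have o1 : IsOpen {y | y ∈ U \ F ∧ Mv U K F h L y} := by
    rw [Metric.isOpen_iff]
    rintro c ⟨hc, hM⟩
    obtain ⟨r, hr, hb, hi⟩ := loc c hc
    exact ⟨r, hr, fun y hy => ⟨hb hy, (hi y hy).1 hM⟩⟩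
  have o2 : IsOpen {y | y ∈ U \ F ∧ ¬ Mv U K F h L y} := by
    rw [Metric.isOpen_iff]
    rintro c ⟨hc, hM⟩
    obtain ⟨r, hr, hb, hi⟩ := loc c hc
    exact ⟨r, hr, fun y hy => ⟨hb hy, fun h => hM ((hi y hy).2 h)⟩⟩
  rcases isPreconnected_iff_subset_of_disjoint.1 hVc _ _ o1 o2
    (by intro y hy; by_cases h : Mv U K F h L y
        · exact Or.inl ⟨hy, h⟩
        · exact Or.inr ⟨hy, h⟩)
    (by ext y; simp only [mem_inter_iff, mem_ofPred_eq, mem_empty_iff_false, iff_false]; tauto) with h | h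
  · exact (h hx).2
  · exact absurd hM (h hp).2

theorem cancel (hE : 2 ≤ Module.finrank ℝ E) {U K : Set E} {h : E → E}
    (hU : IsOpen U) (hUc : IsPreconnected U) (hUK : U ⊆ K) (hh : Reg U K h) {p q : E}
    (hp : p ∈ K) (hq : q ∈ K) (hp0 : h p = 0) (hq0 : h q = 0)
    (hdet : (fderiv ℝ h p).det * (fderiv ℝ h q).det < 0) :
    ∃ h' : E → E, Continuous h' ∧ (∀ y ∈ K \ U, h' y = h y) ∧
      (∀ y ∈ K, h' y = 0 ↔ h y = 0 ∧ y ≠ p ∧ y ≠ q) ∧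
      ∀ y ∈ K, h' y = 0 → h' =ᶠ[𝓝 y] h := by
  have hpq : p ≠ q := by
    rintro rfl
    nlinarith [mul_self_nonneg (fderiv ℝ h p).det]
  set F : Set E := {x | x ∈ K ∧ h x = 0} \ {p} with hF
  have hFf : F.Finite := hh.fin.subset sdiff_subset
  have hpU := hh.mem p hp hp0
  have hqU := hh.mem q hq hq0
  have hpd := hh.det p hp hp0
  have hqd := hh.det q hq hq0
  have hqF : q ∈ F := ⟨⟨hq, hq0⟩, hpq.symm⟩
  have hMp : Mv U K F h (fderiv ℝ h p) p := by
    refine ⟨h, hh.cont, fun _ _ => rfl, ?_, hasFDerivAt_of_det_ne hE hpd, fun _ _ => EventuallyEq.rfl⟩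
    intro y hy
    by_cases hyp : y = p
    · simp [hyp, hp0]
    · simp [hF, hy, hyp]
  have hop : IsOpen (U \ (F \ {q})) := hU.sdiff (hFf.subset sdiff_subset).isClosed
  obtain ⟨r, hr, hb⟩ := Metric.nhds_basis_closedBall.mem_iff.1
    (hop.mem_nhds ⟨hqU, fun h => h.2 rfl⟩)
  have : Nontrivial E := Module.nontrivial_of_finrank_pos (R := ℝ) (by omega)
  obtain ⟨x, hx, hxq⟩ : ∃ x ∈ ball q r, x ≠ q := by
    obtain ⟨v, hv⟩ := exists_ne (0:E)
    have hv' := norm_pos_iff.2 hv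
    refine ⟨q + (r / 2 / ‖v‖) • v, ?_, ?_⟩
    · simp only [mem_ball, dist_self_add_left, norm_smul, norm_div, Real.norm_eq_abs,
        abs_of_pos hr, abs_norm]
      rw [div_mul_cancel₀ _ hv'.ne']
      simp; linarith
    · simp [hv, hr.ne']
  have hxV : x ∈ U \ F := by
    have := hb (ball_subset_closedBall hx)
    exact ⟨this.1, fun h => this.2 ⟨h, hxq⟩⟩
  obtain ⟨h1, h1c, h1e, h1z, h1d, h1g⟩ := Mv.all hE hU hUc hFf hUK hpd ⟨hpU, fun h => h.2 rfl⟩ hMp hxV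
  have hbz : ∀ z ∈ closedBall q r, z ∈ F ↔ z = q := by
    intro z hz
    refine ⟨fun h => ?_, fun h => h ▸ hqF⟩
    by_contra hne
    exact (hb hz).2 ⟨h, hne⟩
  obtain ⟨g, gc, ge, gz⟩ := local_cancel hE h1c h1d
    ((hasFDerivAt_of_det_ne hE hqd).congr_of_eventuallyEq (h1g q hqF)) hdet hx (mem_ball_self hr) hxq
    (by
      intro z hz
      rw [h1z z (hUK (hb hz).1), hbz z hz, or_comm])
  have hne : ∀ y, y ∉ closedBall q r → g y = h1 y := fun y hy =>
    ge y fun h => hy (ball_subset_closedBall h)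
  have hgz : ∀ y ∈ K, g y = 0 ↔ h y = 0 ∧ y ≠ p ∧ y ≠ q := by
    intro y hy
    by_cases hyb : y ∈ closedBall q r
    · simp only [gz y hyb, false_iff]
      rintro ⟨a1, a2, a3⟩
      exact a3 ((hbz y hyb).1 ⟨⟨hy, a1⟩, a2⟩)
    · rw [hne y hyb, h1z y hy]
      have n1 : y ≠ x := fun h => hyb (h ▸ ball_subset_closedBall hx)
      have n2 : y ≠ q := fun h => hyb (h ▸ mem_closedBall_self hr.le)
      simp [n1, n2, hF, hy]
  refine ⟨g, gc, ?_, hgz, ?_⟩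
  · intro y hy
    rw [ge y fun h => hy.2 (hb (ball_subset_closedBall h)).1, h1e y hy]
  · intro y hy h0
    have hyb : y ∉ closedBall q r := fun h => gz y h h0
    have h2 := (hgz y hy).1 h0
    exact (germ_compl ge hyb).trans (h1g y ⟨⟨hy, h2.1⟩, h2.2.1⟩)

theorem sgn_cases {h : E → E} {x : E} (hd : (fderiv ℝ h x).det ≠ 0) :
    (sgn h x = 1 ∧ 0 < (fderiv ℝ h x).det) ∨ (sgn h x = -1 ∧ (fderiv ℝ h x).det < 0) := by
  rcases lt_or_gt_of_ne hd with h1 | h1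
  · right; exact ⟨by simp [sgn, sign_neg h1], h1⟩
  · left; exact ⟨by simp [sgn, sign_pos h1], h1⟩

theorem sgn_congr {h h' : E → E} {x : E} (e : h' =ᶠ[𝓝 x] h) : sgn h' x = sgn h x := by
  rw [sgn, sgn, e.fderiv_eq]

theorem Reg.cnt_eq {U K : Set E} {h : E → E} (hh : Reg U K h) :
    cnt K h = ∑ x ∈ hh.fin.toFinset, sgn h x := finsum_mem_eq_finite_toFinset_sum _ _

theorem CANW (hE : 2 ≤ Module.finrank ℝ E) {U K : Set E} 
    (hU : IsOpen U) (hUc : IsPreconnected U) (hUK : U ⊆ K) :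
    ∀ (n : ℕ) (h : E → E) (hh : Reg U K h), hh.fin.toFinset.card ≤ n → cnt K h = 0 →
    ∃ g : E → E, Continuous g ∧ (∀ y ∈ K \ U, g y = h y) ∧ ∀ y ∈ K, g y ≠ 0 := by
  classical
  intro n
  induction n with
  | zero =>
    intro h hh hn _
    refine ⟨h, hh.cont, fun _ _ => rfl, fun y hy h0 => ?_⟩
    have : hh.fin.toFinset = ∅ := by simpa using hn
    have hm : y ∈ hh.fin.toFinset := by simp [hy, h0]
    rw [this] at hm
    simp at hm
  | succ n ih =>
    intro h hh hn hcnt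
    by_cases hem : hh.fin.toFinset = ∅
    · refine ⟨h, hh.cont, fun _ _ => rfl, fun y hy h0 => ?_⟩
      have hm : y ∈ hh.fin.toFinset := by simp [hy, h0]
      rw [hem] at hm
      simp at hm
    · have hne : hh.fin.toFinset.Nonempty := Finset.nonempty_iff_ne_empty.2 hem
      rw [hh.cnt_eq] at hcnt
      have hsg : ∀ x ∈ hh.fin.toFinset, (sgn h x = 1 ∧ 0 < (fderiv ℝ h x).det) ∨
          (sgn h x = -1 ∧ (fderiv ℝ h x).det < 0) := by
        intro x hx
        simp only [Finite.mem_toFinset, mem_ofPred_eq] at hx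
        exact sgn_cases (hh.det x hx.1 hx.2)
      obtain ⟨p, hp, hps⟩ : ∃ p ∈ hh.fin.toFinset, 0 < sgn h p := by
        by_contra hcon
        push Not at hcon
        have : ∑ x ∈ hh.fin.toFinset, sgn h x < 0 := by
          apply Finset.sum_neg _ hne
          intro x hx
          have h1 := hcon x hx
          rcases hsg x hx with h2 | h2 <;> omega
        omega
      obtain ⟨q, hq, hqs⟩ : ∃ q ∈ hh.fin.toFinset, sgn h q < 0 := by
        by_contra hcon
        push Not at hcon
        have : 0 < ∑ x ∈ hh.fin.toFinset, sgn h x := by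
          apply Finset.sum_pos _ hne
          intro x hx
          have h1 := hcon x hx
          rcases hsg x hx with h2 | h2 <;> omega
        omega
      have hpd : sgn h p = 1 ∧ 0 < (fderiv ℝ h p).det := by
        rcases hsg p hp with h2 | h2
        · exact h2
        · omega
      have hqd : sgn h q = -1 ∧ (fderiv ℝ h q).det < 0 := by
        rcases hsg q hq with h2 | h2
        · omega
        · exact h2
      have hp' := hp
      have hq' := hq
      simp only [Finite.mem_toFinset, mem_ofPred_eq] at hp' hq'
      obtain ⟨g, gc, ge, gz, gg⟩ := cancel hE hU hUc hUK hh hp'.1 hq'.1 hp'.2 hq'.2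
        (mul_neg_of_pos_of_neg hpd.2 hqd.2)
      have hg : Reg U K g := by
        refine ⟨gc, hh.fin.subset fun y hy => ⟨hy.1, ((gz y hy.1).1 hy.2).1⟩, ?_, ?_⟩
        · intro x hx h0
          exact hh.mem x hx ((gz x hx).1 h0).1
        · intro x hx h0
          rw [(gg x hx h0).fderiv_eq]
          exact hh.det x hx ((gz x hx).1 h0).1
      have hset : hg.fin.toFinset = (hh.fin.toFinset.erase p).erase q := by
        ext y
        simp only [Finite.mem_toFinset, mem_ofPred_eq, Finset.mem_erase]
        constructor
        · rintro ⟨h1, h2⟩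
          have := (gz y h1).1 h2
          tauto
        · rintro ⟨h1, h2, h3, h4⟩
          exact ⟨h3, (gz y h3).2 ⟨h4, h2, h1⟩⟩
      have hpq : q ≠ p := by rintro rfl; omega
      have hqe : q ∈ hh.fin.toFinset.erase p := Finset.mem_erase.2 ⟨hpq, hq⟩
      obtain ⟨k, kc, ke, kz⟩ := ih g hg (by
          rw [hset]
          have := Finset.card_erase_lt_of_mem hp
          have := Finset.card_erase_lt_of_mem hqe
          omega) (by
          rw [hg.cnt_eq]
          have e1 : ∑ x ∈ hg.fin.toFinset, sgn g x = ∑ x ∈ hg.fin.toFinset, sgn h x := by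
            apply Finset.sum_congr rfl
            intro x hx
            simp only [Finite.mem_toFinset, mem_ofPred_eq] at hx
            exact sgn_congr (gg x hx.1 hx.2)
          rw [e1, hset]
          have s1 := Finset.add_sum_erase _ (sgn h) hp
          have s2 := Finset.add_sum_erase _ (sgn h) hqe
          omega)
      exact ⟨k, kc, fun y hy => (ke y hy).trans (ge y hy), kz⟩

end canw
end RPD
end

section
open Metric Set Filter Topology
set_option linter.unusedSectionVars false

namespace RPD
section cnt
variable {E : Type*} [NormedAddCommGroup E] [NormedSpace ℝ E] [FiniteDimensional ℝ E]

theorem Reg.of_nonvanishing {U K : Set E} {h : E → E} (hc : Continuous h)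
    (h0 : ∀ x ∈ K, h x ≠ 0) : Reg U K h :=
  ⟨hc, by
    convert Set.finite_empty (α := E)
    ext x; simp only [mem_ofPred_eq, mem_empty_iff_false, iff_false]; exact fun h => h0 x h.1 h.2,
   fun x hx h => absurd h (h0 x hx), fun x hx h => absurd h (h0 x hx)⟩

theorem cnt_of_nonvanishing {K : Set E} {h : E → E} (h0 : ∀ x ∈ K, h x ≠ 0) : cnt K h = 0 := by
  have : {x | x ∈ K ∧ h x = 0} = ∅ := by
    ext x; simp only [mem_ofPred_eq, mem_empty_iff_false, iff_false]; exact fun h => h0 x h.1 h.2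
  rw [cnt, this]; simp

theorem cnt_single {K : Set E} {h : E → E} {p : E} (hz : ∀ x, (x ∈ K ∧ h x = 0) ↔ x = p) :
    cnt K h = sgn h p := by
  have : {x | x ∈ K ∧ h x = 0} = {p} := by
    ext x; simp only [mem_ofPred_eq, mem_singleton_iff]; exact hz x
  rw [cnt, this]; simp

theorem germ_of_eqOn {U K : Set E} (hU : IsOpen U) (hUK : U ⊆ K) {h h' : E → E}
    (e : ∀ x ∈ K, h' x = h x) {x : E} (hx : x ∈ U) : h' =ᶠ[𝓝 x] h := by
  filter_upwards [hU.mem_nhds hx] with y hy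
  exact e y (hUK hy)

theorem stack {U₁ U₂ K₁ K₂ U : Set E} (hU₁ : IsOpen U₁) (hU₂ : IsOpen U₂) (hK₁ : IsClosed K₁)
    (hK₂ : IsClosed K₂) (s₁ : U₁ ⊆ K₁) (s₂ : U₂ ⊆ K₂) (hd : Disjoint U₁ K₂) (su₁ : U₁ ⊆ U)
    (su₂ : U₂ ⊆ U) {h₁ h₂ : E → E} (r₁ : Reg U₁ K₁ h₁) (r₂ : Reg U₂ K₂ h₂)
    (e : ∀ x ∈ K₁, x ∈ K₂ → h₁ x = h₂ x) :
    ∃ h : E → E, Reg U (K₁ ∪ K₂) h ∧ (∀ x ∈ K₁, h x = h₁ x) ∧ (∀ x ∈ K₂, h x = h₂ x) ∧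
      cnt (K₁ ∪ K₂) h = cnt K₁ h₁ + cnt K₂ h₂ := by
  obtain ⟨h, hc, e₁, e₂⟩ := glue hK₁ hK₂ r₁.cont.continuousOn r₂.cont.continuousOn e
  have z₁ : ∀ x ∈ K₁, h x = 0 → x ∈ U₁ := fun x hx h0 => r₁.mem x hx (by rw [← e₁ x hx, h0])
  have z₂ : ∀ x ∈ K₂, h x = 0 → x ∈ U₂ := fun x hx h0 => r₂.mem x hx (by rw [← e₂ x hx, h0])
  have g₁ : ∀ x ∈ K₁, h x = 0 → h =ᶠ[𝓝 x] h₁ := fun x hx h0 => germ_of_eqOn hU₁ s₁ e₁ (z₁ x hx h0)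
  have g₂ : ∀ x ∈ K₂, h x = 0 → h =ᶠ[𝓝 x] h₂ := fun x hx h0 => germ_of_eqOn hU₂ s₂ e₂ (z₂ x hx h0)
  have hset : {x | x ∈ K₁ ∪ K₂ ∧ h x = 0} = {x | x ∈ K₁ ∧ h₁ x = 0} ∪ {x | x ∈ K₂ ∧ h₂ x = 0} := by
    ext x
    simp only [mem_ofPred_eq, mem_union]
    constructor
    · rintro ⟨hx | hx, h0⟩
      · exact Or.inl ⟨hx, by rw [← e₁ x hx, h0]⟩
      · exact Or.inr ⟨hx, by rw [← e₂ x hx, h0]⟩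
    · rintro (⟨hx, h0⟩ | ⟨hx, h0⟩)
      · exact ⟨Or.inl hx, by rw [e₁ x hx, h0]⟩
      · exact ⟨Or.inr hx, by rw [e₂ x hx, h0]⟩
  refine ⟨h, ⟨hc, ?_, ?_, ?_⟩, e₁, e₂, ?_⟩
  · rw [hset]; exact r₁.fin.union r₂.fin
  · rintro x (hx | hx) h0
    · exact su₁ (z₁ x hx h0)
    · exact su₂ (z₂ x hx h0)
  · rintro x (hx | hx) h0
    · rw [(g₁ x hx h0).fderiv_eq]; exact r₁.det x hx (by rw [← e₁ x hx, h0])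
    · rw [(g₂ x hx h0).fderiv_eq]; exact r₂.det x hx (by rw [← e₂ x hx, h0])
  · rw [cnt, hset, finsum_mem_union _ r₁.fin r₂.fin]
    · congr 1
      · apply finsum_mem_congr rfl
        rintro x ⟨hx, h0⟩
        exact sgn_congr (g₁ x hx (by rw [e₁ x hx, h0]))
      · apply finsum_mem_congr rfl
        rintro x ⟨hx, h0⟩
        exact sgn_congr (g₂ x hx (by rw [e₂ x hx, h0]))
    · rw [Set.disjoint_left]
      rintro x ⟨hx, h0⟩ ⟨hx', -⟩
      exact Set.disjoint_left.1 hd (r₁.mem x hx h0) hx'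

theorem fderiv_lin (hE : 2 ≤ Module.finrank ℝ E) (A B : E ≃L[ℝ] E) {h : E → E} {x : E}
    (hd : (fderiv ℝ h (B x)).det ≠ 0) :
    (fderiv ℝ (fun x => A (h (B x))) x).det =
      (A : E →L[ℝ] E).det * ((fderiv ℝ h (B x)).det * (B : E →L[ℝ] E).det) := by
  have h1 := hasFDerivAt_of_det_ne hE hd
  have h2 := (A : E →L[ℝ] E).hasFDerivAt.comp x (h1.comp x (B : E →L[ℝ] E).hasFDerivAt)
  have h3 : HasFDerivAt (fun x => A (h (B x))) _ x := h2
  rw [h3.fderiv, det_comp', det_comp']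

theorem det_equiv_ne (A : E ≃L[ℝ] E) : (A : E →L[ℝ] E).det ≠ 0 := by
  have := A.toLinearEquiv.isUnit_det'
  exact this.ne_zero

theorem Reg.lin (hE : 2 ≤ Module.finrank ℝ E) (A B : E ≃L[ℝ] E) {U K : Set E} {h : E → E}
    (hh : Reg U K h) :
    Reg (B ⁻¹' U) (B ⁻¹' K) (fun x => A (h (B x))) ∧ cnt (B ⁻¹' K) (fun x => A (h (B x))) =
      (SignType.sign (A : E →L[ℝ] E).det : ℤ) * (SignType.sign (B : E →L[ℝ] E).det : ℤ) * cnt K h := by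
  have hc : Continuous h := hh.cont
  have hset : {x | x ∈ B ⁻¹' K ∧ A (h (B x)) = 0} = B ⁻¹' {x | x ∈ K ∧ h x = 0} := by
    ext x; simp
  refine ⟨⟨by fun_prop, ?_, ?_, ?_⟩, ?_⟩
  · rw [hset]; exact hh.fin.preimage B.injective.injOn
  · intro x hx h0
    exact hh.mem _ hx (by simpa using h0)
  · intro x hx h0
    have h1 := hh.det _ hx (by simpa using h0)
    rw [fderiv_lin hE A B h1]
    exact mul_ne_zero (det_equiv_ne A) (mul_ne_zero h1 (det_equiv_ne B))
  · rw [cnt, hset, cnt, mul_finsum_mem' _ _ hh.fin]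
    rw [← Set.image_preimage_eq {x | x ∈ K ∧ h x = 0} B.surjective]
    rw [finsum_mem_image B.injective.injOn, Set.image_preimage_eq _ B.surjective]
    apply finsum_mem_congr rfl
    rintro x ⟨hx, h0⟩
    have h1 := hh.det _ hx h0
    rw [sgn, fderiv_lin hE A B h1, sgn]
    simp only [sign_mul, SignType.coe_mul]
    ring

end cnt
end RPD
end

section
open Metric Set Filter Topology
set_option linter.unusedSectionVars false

namespace RPD
section link
variable {E : Type*} [NormedAddCommGroup E] [NormedSpace ℝ E] [FiniteDimensional ℝ E]

def cA (E : Type*) [NormedAddCommGroup E] (r R : ℝ) : Set E := {x | r ≤ ‖x‖ ∧ ‖x‖ ≤ R}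
def oA (E : Type*) [NormedAddCommGroup E] (r R : ℝ) : Set E := {x | r < ‖x‖ ∧ ‖x‖ < R}

theorem oA_open (r R : ℝ) : IsOpen (oA E r R) :=
  (isOpen_lt continuous_const continuous_norm).inter (isOpen_lt continuous_norm continuous_const)

theorem cA_closed (r R : ℝ) : IsClosed (cA E r R) :=
  (isClosed_le continuous_const continuous_norm).inter (isClosed_le continuous_norm continuous_const)

theorem cA_compact (r R : ℝ) : IsCompact (cA E r R) :=
  (isCompact_closedBall (0 : E) R).of_isClosed_subset (cA_closed r R) (fun x hx => by
    simpa using hx.2)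

theorem oA_sub (r R : ℝ) : oA E r R ⊆ cA E r R := fun _ hx => ⟨hx.1.le, hx.2.le⟩

theorem bd_A {r R : ℝ} {x : E} (hx : x ∈ cA E r R) (hx' : x ∉ oA E r R) : ‖x‖ = r ∨ ‖x‖ = R := by
  by_contra h
  push Not at h
  exact hx' ⟨lt_of_le_of_ne hx.1 (Ne.symm h.1), lt_of_le_of_ne hx.2 h.2⟩

theorem exists_unit {r : ℝ} {x : E} (hr : 0 < r) (hx : ‖x‖ = r) : ∃ y ∈ sphere (0:E) 1, x = r • y := by
  refine ⟨r⁻¹ • x, ?_, ?_⟩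
  · rw [mem_sphere_zero_iff_norm, norm_smul, hx, norm_inv, Real.norm_of_nonneg hr.le, inv_mul_cancel₀ hr.ne']
  · rw [smul_smul, mul_inv_cancel₀ hr.ne', one_smul]

theorem norm_smul_unit {r : ℝ} {y : E} (hr : 0 < r) (hy : y ∈ sphere (0:E) 1) : ‖r • y‖ = r := by
  rw [norm_smul, mem_sphere_zero_iff_norm.1 hy, Real.norm_of_nonneg hr.le, mul_one]

theorem oA_preconn (hE : 2 ≤ Module.finrank ℝ E) {r : ℝ} (R : ℝ) (hr : 0 < r) :
    IsPreconnected (oA E r R) := by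
  have h1 : IsPreconnected ((fun p : ℝ × E => p.1 • p.2) '' (Ioo r R ×ˢ sphere (0:E) 1)) :=
    ((isPreconnected_Ioo).prod (isPreconnected_sphere (one_lt_rank hE) 0 1)).image _
      (by fun_prop)
  convert h1
  ext x
  constructor
  · intro hx
    obtain ⟨y, hy, e⟩ := exists_unit (hr.trans hx.1) (rfl : ‖x‖ = ‖x‖)
    exact ⟨(‖x‖, y), ⟨hx, hy⟩, e.symm⟩
  · rintro ⟨⟨s, y⟩, ⟨hs, hy⟩, rfl⟩
    have := norm_smul_unit (hr.trans hs.1) hy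
    exact ⟨by simpa [this] using hs.1, by simpa [this] using hs.2⟩

def LinkAt (r R : ℝ) (f g : E → E) (a : ℤ) : Prop :=
  ∃ h, Reg (oA E r R) (cA E r R) h ∧ (∀ x ∈ sphere (0:E) 1, h (r • x) = f x) ∧
    (∀ x ∈ sphere (0:E) 1, h (R • x) = g x) ∧ cnt (cA E r R) h = a

def Link (f g : E → E) (a : ℤ) : Prop := ∃ r R, 0 < r ∧ r < R ∧ LinkAt r R f g a

/-- nonvanishing continuous maps on the sphere -/
def NV (f : E → E) : Prop := Continuous f ∧ ∀ x ∈ sphere (0:E) 1, f x ≠ 0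

theorem Link.exists (hE : 2 ≤ Module.finrank ℝ E) {f g : E → E} (hf : NV f) (hg : NV g) :
    ∃ a, Link f g a := by
  have hfc := hf.1
  have hgc := hg.1
  let u : E → E := fun x => (2 - ‖x‖) • f x + (‖x‖ - 1) • g ((2⁻¹ : ℝ) • x)
  have u1 : ∀ x : E, ‖x‖ = 1 → u x = f x := by
    intro x hx; simp only [u, hx]; norm_num
  have u2 : ∀ x ∈ sphere (0:E) 1, u ((2:ℝ) • x) = g x := by
    intro x hx; simp only [u, norm_smul_unit two_pos hx, smul_smul]; norm_num
  obtain ⟨h, hr, he⟩ := GEN hE (oA_open (E := E) 1 2) (cA_compact 1 2) (h := u) (by fun_prop) (by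
    rintro x ⟨hx, hx'⟩
    rcases bd_A hx hx' with h | h
    · rw [u1 x h]; exact hf.2 x (by simpa using h)
    · obtain ⟨y, hy, rfl⟩ := exists_unit two_pos h
      rw [u2 y hy]; exact hg.2 y hy)
  refine ⟨_, 1, 2, one_pos, one_lt_two, h, hr, ?_, ?_, rfl⟩
  · intro x hx
    have : ‖x‖ = 1 := by simpa using hx
    rw [one_smul, he x ⟨⟨this.ge, by rw [this]; norm_num⟩, fun h => by simpa [this] using h.1⟩, u1 x this]
  · intro x hx
    have : ‖(2:ℝ) • x‖ = 2 := norm_smul_unit two_pos hx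
    rw [he _ ⟨⟨by rw [this]; norm_num, this.le⟩, fun h => by simpa [this] using h.2⟩, u2 x hx]

theorem Link.hom (hE : 2 ≤ Module.finrank ℝ E) {f g : E → E} (hl : Link f g 0) :
    Hom (sphere (0:E) 1) f g := by
  obtain ⟨r, R, hr, hR, h, hreg, hf, hg, hc⟩ := hl
  obtain ⟨k, kc, ke, k0⟩ := CANW hE (oA_open r R) (oA_preconn hE R hr) (oA_sub r R) _ h hreg le_rfl hc
  have hm : ∀ t ∈ Icc (0:ℝ) 1, 0 < r + t * (R - r) := fun t ht =>
    add_pos_of_pos_of_nonneg hr (mul_nonneg ht.1 (by linarith))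
  refine ⟨fun p => k ((r + p.1 * (R - r)) • p.2), by fun_prop, ?_, ?_, ?_⟩
  · intro x hx
    have := norm_smul_unit hr hx
    simp only [zero_mul, add_zero]
    rw [ke _ ⟨⟨this.ge, this.trans_le hR.le⟩, fun h => h.1.ne' this⟩, hf x hx]
  · intro x hx
    have := norm_smul_unit (hr.trans hR) hx
    simp only [one_mul, add_sub_cancel]
    rw [ke _ ⟨⟨hR.le.trans this.ge, this.le⟩, fun h => h.2.ne this⟩, hg x hx]
  · intro t ht x hx
    apply k0
    have := norm_smul_unit (hm t ht) hx
    constructor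
    · rw [this]; nlinarith [ht.1]
    · rw [this]; nlinarith [ht.2]

theorem Hom.link {f g : E → E} (hh : Hom (sphere (0:E) 1) f g) : Link f g 0 := by
  obtain ⟨H, Hc, H0, H1, Hn⟩ := hh
  obtain ⟨k, kc, ke⟩ := TZ (cA_closed (E := E) 1 2) (g := fun x : E => H (‖x‖ - 1, ‖x‖⁻¹ • x)) (by
    apply Hc.comp_continuousOn
    apply ContinuousOn.prodMk (by fun_prop)
    apply ContinuousOn.smul _ continuousOn_id
    apply ContinuousOn.inv₀ (by fun_prop)
    intro x hx
    have := hx.1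
    positivity)
  have k0 : ∀ x ∈ cA E 1 2, k x ≠ 0 := by
    intro x hx
    rw [ke x hx]
    have := hx.1
    have h2 := hx.2
    apply Hn
    · constructor <;> linarith
    · rw [mem_sphere_zero_iff_norm, norm_smul, norm_inv, norm_norm, inv_mul_cancel₀ (by positivity)]
  refine ⟨1, 2, one_pos, one_lt_two, k, Reg.of_nonvanishing kc k0, ?_, ?_, cnt_of_nonvanishing k0⟩
  · intro x hx
    have := norm_smul_unit one_pos hx
    rw [ke _ ⟨this.ge, by rw [this]; norm_num⟩, this, ← H0 x hx]
    simp
  · intro x hx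
    have := norm_smul_unit two_pos hx
    rw [ke _ ⟨by rw [this]; norm_num, this.le⟩, this, ← H1 x hx]
    simp only [smul_smul]; norm_num

theorem LinkAt.scale (hE : 2 ≤ Module.finrank ℝ E) {r R c : ℝ} (hc : 0 < c) {f g : E → E} {a : ℤ}
    (hl : LinkAt r R f g a) : LinkAt (c * r) (c * R) f g a := by
  obtain ⟨h, hreg, hf, hg, ha⟩ := hl
  let B : E ≃L[ℝ] E := ContinuousLinearEquiv.smulLeft (Units.mk0 c⁻¹ (inv_ne_zero hc.ne'))
  have hB : ∀ x, B x = c⁻¹ • x := fun x => rfl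
  have hBn : ∀ x, ‖B x‖ = c⁻¹ * ‖x‖ := fun x => by
    rw [hB, norm_smul, Real.norm_of_nonneg (by positivity)]
  have hdet : 0 < (B : E →L[ℝ] E).det := by
    have : (B : E →L[ℝ] E) = c⁻¹ • ContinuousLinearMap.id ℝ E := by ext x; exact hB x
    rw [this, ContinuousLinearMap.det]
    have e : ((c⁻¹ • ContinuousLinearMap.id ℝ E : E →L[ℝ] E) : E →ₗ[ℝ] E) = c⁻¹ • LinearMap.id := rfl
    rw [e, LinearMap.det_smul, LinearMap.det_id, mul_one]; positivity
  have h1 := Reg.lin hE (ContinuousLinearEquiv.refl ℝ E) B hreg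
  have hBc : B ⁻¹' cA E r R = cA E (c * r) (c * R) := by
    ext x
    simp only [cA, mem_preimage, mem_ofPred_eq, hBn]
    rw [inv_mul_le_iff₀ hc, ← div_eq_inv_mul, le_div_iff₀ hc, mul_comm r]
  have hBo : B ⁻¹' oA E r R = oA E (c * r) (c * R) := by
    ext x
    simp only [oA, mem_preimage, mem_ofPred_eq, hBn]
    rw [inv_mul_lt_iff₀ hc, ← div_eq_inv_mul, lt_div_iff₀ hc, mul_comm r]
  rw [hBc, hBo] at h1
  refine ⟨_, h1.1, ?_, ?_, ?_⟩
  · intro x hx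
    simp only [ContinuousLinearEquiv.refl_apply, hB, smul_smul]
    rw [inv_mul_cancel_left₀ hc.ne', hf x hx]
  · intro x hx
    simp only [ContinuousLinearEquiv.refl_apply, hB, smul_smul]
    rw [inv_mul_cancel_left₀ hc.ne', hg x hx]
  · rw [h1.2, sign_pos hdet, ha]
    have : ((ContinuousLinearEquiv.refl ℝ E : E ≃L[ℝ] E) : E →L[ℝ] E).det = 1 := by
      simp [ContinuousLinearMap.det]
    rw [this]; simp

theorem Link.trans (hE : 2 ≤ Module.finrank ℝ E) {f g k : E → E} {a b : ℤ}
    (h₁ : Link f g a) (h₂ : Link g k b) : Link f k (a + b) := by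
  obtain ⟨r, R, hr, hR, h, hreg, hf, hg, ha⟩ := h₁
  obtain ⟨r', R', hr', hR', h₂⟩ := h₂
  have hRp := hr.trans hR
  have h3 := h₂.scale hE (c := R / r') (by positivity)
  rw [div_mul_cancel₀ _ hr'.ne'] at h3
  set S := R / r' * R'
  have hS : R < S := by
    change R < R / r' * R'
    rw [div_mul_eq_mul_div, lt_div_iff₀ hr']
    exact mul_lt_mul_of_pos_left hR' hRp
  obtain ⟨l, lreg, lg, lk, lb⟩ := h3
  obtain ⟨m, mreg, m1, m2, mc⟩ := stack (U := oA E r S) (oA_open r R) (oA_open R S) (cA_closed r R)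
    (cA_closed R S) (oA_sub _ _) (oA_sub _ _)
    (Set.disjoint_left.2 fun x hx hx' => not_le.2 hx.2 hx'.1)
    (fun x hx => ⟨hx.1, hx.2.trans hS⟩) (fun x hx => ⟨hR.trans hx.1, hx.2⟩) hreg lreg (by
      intro x hx hx'
      obtain ⟨y, hy, rfl⟩ := exists_unit hRp (le_antisymm hx.2 hx'.1)
      rw [hg y hy, lg y hy])
  have hu : cA E r R ∪ cA E R S = cA E r S := by
    ext x
    simp only [cA, mem_union, mem_ofPred_eq]
    constructor
    · rintro (h | h)
      · exact ⟨h.1, h.2.trans hS.le⟩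
      · exact ⟨hR.le.trans h.1, h.2⟩
    · rintro ⟨h, h'⟩
      rcases le_total ‖x‖ R with h2 | h2
      · exact Or.inl ⟨h, h2⟩
      · exact Or.inr ⟨h2, h'⟩
  rw [hu] at mreg mc
  refine ⟨r, S, hr, hR.trans hS, m, mreg, ?_, ?_, by rw [mc, ha, lb]⟩
  · intro x hx
    have := norm_smul_unit hr hx
    rw [m1 _ ⟨this.ge, this.trans_le hR.le⟩, hf x hx]
  · intro x hx
    have := norm_smul_unit (hRp.trans hS) hx
    rw [m2 _ ⟨hS.le.trans this.ge, this.le⟩, lk x hx]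

theorem Link.congr {f g f' g' : E → E} {a : ℤ} (h : Link f g a)
    (e : ∀ x ∈ sphere (0:E) 1, f x = f' x) (e' : ∀ x ∈ sphere (0:E) 1, g x = g' x) : Link f' g' a := by
  obtain ⟨r, R, hr, hR, h, hreg, hf, hg, ha⟩ := h
  exact ⟨r, R, hr, hR, h, hreg, fun x hx => by rw [hf x hx, e x hx],
    fun x hx => by rw [hg x hx, e' x hx], ha⟩

theorem Link.lin (hE : 2 ≤ Module.finrank ℝ E) {f g : E → E} {a : ℤ} (h : Link f g a)
    (A : E ≃L[ℝ] E) (ρ : E ≃ₗᵢ[ℝ] E) : Link (fun x => A (f (ρ x))) (fun x => A (g (ρ x)))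
      ((SignType.sign (A : E →L[ℝ] E).det : ℤ) *
        (SignType.sign (ρ.toContinuousLinearEquiv : E →L[ℝ] E).det : ℤ) * a) := by
  obtain ⟨r, R, hr, hR, h, hreg, hf, hg, ha⟩ := h
  have h1 := Reg.lin hE A ρ.toContinuousLinearEquiv hreg
  have hBc : ρ.toContinuousLinearEquiv ⁻¹' cA E r R = cA E r R := by
    ext x; simp [cA]
  have hBo : ρ.toContinuousLinearEquiv ⁻¹' oA E r R = oA E r R := by
    ext x; simp [oA]
  rw [hBc, hBo] at h1
  refine ⟨r, R, hr, hR, _, h1.1, ?_, ?_, by rw [h1.2, ha]⟩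
  · intro x hx
    have : ρ x ∈ sphere (0:E) 1 := by simpa using hx
    simp only [LinearIsometryEquiv.coe_toContinuousLinearEquiv, map_smul, hf _ this]
  · intro x hx
    have : ρ x ∈ sphere (0:E) 1 := by simpa using hx
    simp only [LinearIsometryEquiv.coe_toContinuousLinearEquiv, map_smul, hg _ this]

end link
end RPD
end

section
open Metric Set Filter Topology
set_option linter.unusedSectionVars false

namespace RPD
section key
variable {E : Type*} [NormedAddCommGroup E] [NormedSpace ℝ E] [FiniteDimensional ℝ E]

theorem NV.refl {f : E → E} (hf : NV f) : Link f f 0 := Hom.link (Hom.refl hf.1 hf.2)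

theorem Link.mul (hE : 2 ≤ Module.finrank ℝ E) {f : E → E} (hf : NV f) {a : ℤ} (h : Link f f a)
    (k : ℕ) : Link f f (k * a) := by
  induction k with
  | zero => simpa using hf.refl
  | succ k ih => have := ih.trans hE h; push_cast; rwa [add_mul, one_mul]

theorem key (hE : 2 ≤ Module.finrank ℝ E) (ρ : E ≃ₗᵢ[ℝ] E)
    (hρ : (ρ.toContinuousLinearEquiv : E →L[ℝ] E).det < 0) (g : ℕ → E → E) (hg : ∀ i, NV (g i))
    (hn : ∀ i j, i ≠ j → ¬ Hom (sphere (0:E) 1) (g i) (g j)) {f : E → E} (hf : NV f) {a : ℤ}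
    (h : Link f f a) : a = 0 := by
  by_contra ha
  have hfρ : NV (fun x => f (ρ x)) := by
    have := hf.1
    have h2 := ρ.continuous
    exact ⟨by fun_prop, fun x hx => hf.2 _ (by simpa using hx)⟩
  have h1 : Link (fun x => f (ρ x)) (fun x => f (ρ x)) (-a) := by
    have := h.lin hE (ContinuousLinearEquiv.refl ℝ E) ρ
    have e : ((ContinuousLinearEquiv.refl ℝ E : E ≃L[ℝ] E) : E →L[ℝ] E).det = 1 := by
      simp [ContinuousLinearMap.det]
    rw [e, sign_neg hρ] at this
    simpa using this
  obtain ⟨b, hb⟩ := Link.exists hE hf hfρ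
  obtain ⟨c, hc⟩ := Link.exists hE hfρ hf
  set k := (b + c).natAbs + 1 with hk
  set t := b + k * (-a) + c with ht
  have hPt : Link f f t := (hb.trans hE (h1.mul hE hfρ k)).trans hE hc
  have hat : a * t < 0 := by
    have e1 : a * (b + c) ≤ a * a * |b + c| := by
      have : |a| * |b + c| ≤ a * a * |b + c| := by
        apply mul_le_mul_of_nonneg_right _ (abs_nonneg _)
        rw [← abs_mul_abs_self a]
        have : 1 ≤ |a| := Int.one_le_abs ha
        nlinarith
      exact (le_abs_self _).trans (by rw [abs_mul]; exact this)
    have e2 : 0 < a * a := mul_self_pos.2 ha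
    have e3 : (k : ℤ) = |b + c| + 1 := by rw [hk]; push_cast; rfl
    rw [ht, e3]
    nlinarith
  set M := a.natAbs * t.natAbs with hM
  have hM0 : M ≠ 0 := by
    rw [hM]; apply mul_ne_zero <;> rw [Int.natAbs_ne_zero]
    · exact ha
    · rintro h; rw [h] at hat; simp at hat
  have p1 := hPt.mul hE hf a.natAbs
  have p2 := h.mul hE hf t.natAbs
  have hP : Link f f M ∧ Link f f (-M) := by
    rcases lt_or_gt_of_ne ha with h0 | h0
    · have ht0 : 0 < t := by nlinarith
      have e1 : (a.natAbs : ℤ) = -a := by omega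
      have e2 : (t.natAbs : ℤ) = t := by omega
      rw [hM]; push_cast; rw [e1] at p1; rw [e2] at p2
      rw [← Int.natCast_natAbs a, ← Int.natCast_natAbs t, e1, e2]
      exact ⟨p1, by convert p2 using 1; ring⟩
    · have ht0 : t < 0 := by nlinarith
      have e1 : (a.natAbs : ℤ) = a := by omega
      have e2 : (t.natAbs : ℤ) = -t := by omega
      rw [hM]; push_cast; rw [e1] at p1; rw [e2] at p2
      rw [← Int.natCast_natAbs a, ← Int.natCast_natAbs t, e1, e2]
      exact ⟨by convert p2 using 1; ring, by convert p1 using 1; ring⟩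
  have hPk : ∀ z : ℤ, Link f f (z * M) := by
    intro z
    rcases Int.eq_nat_or_neg z with ⟨k, rfl | rfl⟩
    · exact hP.1.mul hE hf k
    · convert hP.2.mul hE hf k using 1; ring
  choose b hb using fun i => Link.exists hE hf (hg i)
  choose c hc using fun i => Link.exists hE (hg i) hf
  have : NeZero M := ⟨hM0⟩
  obtain ⟨i, j, hij, e⟩ := Finite.exists_ne_map_eq_of_infinite (fun i => ((b i : ℤ) : ZMod M))
  rw [ZMod.intCast_eq_intCast_iff_dvd_sub] at e
  obtain ⟨q, hq⟩ := e
  have l1 := ((hb i).trans hE (hc i)).mul hE hf (M - 1)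
  have l2 := (((hc i).trans hE l1).trans hE (hPk (-(b i + c i + q)))).trans hE (hb j)
  apply hn i j hij
  apply Link.hom hE
  convert l2 using 1
  have : ((M - 1 : ℕ) : ℤ) = M - 1 := by omega
  rw [this]
  linear_combination -hq

/-- the uniqueness hypothesis -/
def Uniq (E : Type*) [NormedAddCommGroup E] [NormedSpace ℝ E] [FiniteDimensional ℝ E] : Prop :=
  ∀ (f : E → E), NV f → ∀ a, Link f f a → a = 0

theorem Uniq.symm (hE : 2 ≤ Module.finrank ℝ E) (hu : Uniq E) {f g : E → E} (hf : NV f) (hg : NV g)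
    {a : ℤ} (h : Link f g a) : Link g f (-a) := by
  obtain ⟨b, hb⟩ := Link.exists hE hg hf
  have := hu f hf _ (h.trans hE hb)
  have e : b = -a := by omega
  rwa [e] at hb

theorem Uniq.eq (hE : 2 ≤ Module.finrank ℝ E) (hu : Uniq E) {f g : E → E} (hf : NV f) (hg : NV g)
    {a b : ℤ} (h : Link f g a) (h' : Link f g b) : a = b := by
  have := hu g hg _ ((hu.symm hE hf hg h).trans hE h')
  omega

end key
end RPD
end

section
open Metric Set Filter Topology
set_option linter.unusedSectionVars false

namespace RPD

abbrev EE (N : ℕ) := EuclideanSpace ℝ (Fin (N + 1))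

section eqv
variable {N : ℕ}

noncomputable def e0 (N : ℕ) : EE N := EuclideanSpace.single 0 1

/-- the last coordinate -/
def tau (x : EE N) : ℝ := x (Fin.last N)

@[fun_prop]
theorem continuous_tau : Continuous (tau (N := N)) := by unfold tau; fun_prop

theorem tau_neg (x : EE N) : tau (-x) = - tau x := rfl
theorem tau_smul (c : ℝ) (x : EE N) : tau (c • x) = c * tau x := rfl
theorem tau_add (x y : EE N) : tau (x + y) = tau x + tau y := rfl

structure Sg (σ : EE N ≃L[ℝ] EE N) : Prop where
  inv : ∀ x, σ (σ x) = x
  det : 0 < (σ : EE N →L[ℝ] EE N).det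

structure EqM (σ : EE N ≃L[ℝ] EE N) (f : EE N → EE N) : Prop where
  cont : Continuous f
  neg : ∀ x, f (-x) = σ (f x)
  hom : ∀ (c : ℝ) x, 0 ≤ c → f (c • x) = c • f x
  nz : ∀ x, x ≠ 0 → f x ≠ 0
  pt : f (e0 N) = e0 N

theorem ne_zero_of_unit {x : EE N} (hx : x ∈ sphere (0 : EE N) 1) : x ≠ 0 := by
  rintro rfl; simp at hx

theorem EqM.nv {σ : EE N ≃L[ℝ] EE N} {f : EE N → EE N} (hf : EqM σ f) : NV f :=
  ⟨hf.cont, fun x hx => hf.nz x (ne_zero_of_unit hx)⟩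

def cW (N : ℕ) : Set (EE N) := {x | x ∈ cA (EE N) 1 2 ∧ 0 ≤ tau x}
def oW (N : ℕ) : Set (EE N) := {x | x ∈ oA (EE N) 1 2 ∧ 0 < tau x}

theorem cW_closed : IsClosed (cW N) :=
  (cA_closed 1 2).inter (isClosed_le continuous_const continuous_tau)
theorem cW_compact : IsCompact (cW N) :=
  (cA_compact 1 2).of_isClosed_subset cW_closed fun _ h => h.1
theorem oW_open : IsOpen (oW N) :=
  (oA_open 1 2).inter (isOpen_lt continuous_const continuous_tau)
theorem oW_sub : oW N ⊆ cW N := fun _ h => ⟨oA_sub _ _ h.1, h.2.le⟩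

theorem oW_preconn : IsPreconnected (oW N) := by
  have hcv : Convex ℝ {x : EE N | 0 < tau x} := by
    intro x hx y hy a b ha hb hab
    simp only [mem_ofPred_eq, tau_add, tau_smul] at *
    rcases ha.eq_or_lt with h | h
    · subst h; simp only [zero_add] at hab; subst hab; simpa using hy
    · have := mul_pos h hx; have := mul_nonneg hb hy.le; linarith
  have hne : ∀ x : EE N, 0 < tau x → 0 < ‖x‖ := by
    intro x hx; rw [norm_pos_iff]; rintro rfl; simp [tau] at hx
  have h1 : IsPreconnected ((fun p : ℝ × EE N => (p.1 * ‖p.2‖⁻¹) • p.2) ''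
      (Ioo 1 2 ×ˢ {x : EE N | 0 < tau x})) := by
    apply ((isPreconnected_Ioo).prod hcv.isPreconnected).image
    have hi : ContinuousOn (fun p : ℝ × EE N => ‖p.2‖⁻¹) (Ioo 1 2 ×ˢ {x : EE N | 0 < tau x}) := by
      apply ContinuousOn.inv₀ (by fun_prop)
      rintro ⟨s, x⟩ ⟨_, hx⟩
      exact (hne x hx).ne'
    exact (continuous_fst.continuousOn.mul hi).smul continuous_snd.continuousOn
  convert h1
  ext x
  constructor
  · rintro ⟨hx, hx'⟩
    refine ⟨(‖x‖, x), ⟨hx, hx'⟩, ?_⟩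
    simp [mul_inv_cancel₀ (hne x hx').ne']
  · rintro ⟨⟨s, y⟩, ⟨hs, hy⟩, rfl⟩
    have hp := hne y hy
    have hs0 : 0 < s := one_pos.trans hs.1
    have : ‖(s * ‖y‖⁻¹) • y‖ = s := by
      rw [norm_smul, Real.norm_of_nonneg (by positivity), mul_assoc, inv_mul_cancel₀ hp.ne', mul_one]
    refine ⟨⟨?_, ?_⟩, ?_⟩
    · rw [this]; exact hs.1
    · rw [this]; exact hs.2
    · rw [tau_smul]
      have : 0 < tau y := hy
      positivity

theorem det_neg_pos (hev : Even (N + 1)) :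
    0 < ((ContinuousLinearEquiv.neg ℝ : EE N ≃L[ℝ] EE N) : EE N →L[ℝ] EE N).det := by
  have : (((ContinuousLinearEquiv.neg ℝ : EE N ≃L[ℝ] EE N) : EE N →L[ℝ] EE N) : EE N →ₗ[ℝ] EE N)
      = (-1 : ℝ) • LinearMap.id := by ext x; simp
  rw [ContinuousLinearMap.det, this, LinearMap.det_smul, LinearMap.det_id, finrank_euclideanSpace,
    Fintype.card_fin, hev.neg_one_pow]
  norm_num

theorem hEE (hN : 1 ≤ N) : 2 ≤ Module.finrank ℝ (EE N) := by
  rw [finrank_euclideanSpace, Fintype.card_fin]; omega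

theorem cA_neg {r R : ℝ} {x : EE N} (hx : x ∈ cA (EE N) r R) : -x ∈ cA (EE N) r R := by
  simpa [cA] using hx

theorem dbl (hN : 1 ≤ N) (hev : Even (N + 1)) {σ : EE N ≃L[ℝ] EE N} (hσ : Sg σ) {h : EE N → EE N}
    (hr : Reg (oW N) (cW N) h) (he : ∀ x ∈ cW N, tau x = 0 → h (-x) = σ (h x)) :
    ∃ H, Reg (oA (EE N) 1 2) (cA (EE N) 1 2) H ∧ (∀ x ∈ cW N, H x = h x) ∧
      (∀ x ∈ cA (EE N) 1 2, H (-x) = σ (H x)) ∧ cnt (cA (EE N) 1 2) H = 2 * cnt (cW N) h := by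
  have h1 := Reg.lin (hEE hN) σ (ContinuousLinearEquiv.neg ℝ) hr
  rw [sign_pos hσ.det, sign_pos (det_neg_pos hev)] at h1
  obtain ⟨r2, c2⟩ := h1
  simp only [ContinuousLinearEquiv.neg_apply] at r2 c2
  have hu : cW N ∪ (ContinuousLinearEquiv.neg ℝ : EE N ≃L[ℝ] EE N) ⁻¹' cW N = cA (EE N) 1 2 := by
    ext x
    simp only [cW, mem_union, mem_preimage, ContinuousLinearEquiv.neg_apply, mem_ofPred_eq, tau_neg]
    constructor
    · rintro (h | h)
      · exact h.1
      · simpa using cA_neg h.1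
    · intro h
      rcases le_total 0 (tau x) with h' | h'
      · exact Or.inl ⟨h, h'⟩
      · exact Or.inr ⟨cA_neg h, by linarith⟩
  obtain ⟨H, Hr, H1, H2, Hc⟩ := stack (U := oA (EE N) 1 2) oW_open
    (oW_open.preimage (ContinuousLinearEquiv.neg ℝ : EE N ≃L[ℝ] EE N).continuous) cW_closed
    (cW_closed.preimage (ContinuousLinearEquiv.neg ℝ : EE N ≃L[ℝ] EE N).continuous) oW_sub
    (preimage_mono oW_sub) (by
      rw [Set.disjoint_left]
      rintro x hx hx'
      have := hx.2
      have h2 := hx'.2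
      simp only [ContinuousLinearEquiv.neg_apply, tau_neg] at h2
      linarith) (fun x hx => hx.1)
    (fun x hx => by simpa [oA] using hx.1) hr r2 (by
      intro x hx hx'
      have h2 := hx'.2
      simp only [ContinuousLinearEquiv.neg_apply, tau_neg] at h2
      have h3 := hx.2
      rw [he x hx (by linarith), hσ.inv])
  rw [hu] at Hr Hc
  refine ⟨H, Hr, H1, ?_, ?_⟩
  · intro x hx
    rw [← hu] at hx
    rcases hx with hx | hx
    · rw [H1 x hx, H2 (-x) (by simpa using hx), neg_neg]
    · rw [H2 x hx, H1 (-x) (by simpa using hx), hσ.inv]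
  · rw [Hc, c2]; simp; ring

/-- the sub-annuli -/
def Ak (N k : ℕ) : Set (EE N) := {x | x ∈ cA (EE N) 1 2 ∧ ∀ i : Fin (N+1), k ≤ i.val → x i = 0}

theorem Ak_closed (k : ℕ) : IsClosed (Ak N k) := by
  apply (cA_closed 1 2).inter
  have : {x : EE N | ∀ i : Fin (N+1), k ≤ i.val → x i = 0} =
      ⋂ i : Fin (N+1), ⋂ (_ : k ≤ i.val), {x : EE N | x i = 0} := by ext x; simp
  show IsClosed {x : EE N | ∀ i : Fin (N+1), k ≤ i.val → x i = 0}
  rw [this]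
  exact isClosed_iInter fun i => isClosed_iInter fun _ => isClosed_eq (by fun_prop) (by fun_prop)

theorem Ak_neg {k : ℕ} {x : EE N} (hx : x ∈ Ak N k) : -x ∈ Ak N k :=
  ⟨cA_neg hx.1, fun i hi => by simp [hx.2 i hi]⟩

theorem Ak_mono {k l : ℕ} (h : k ≤ l) : Ak N k ⊆ Ak N l := fun _ hx =>
  ⟨hx.1, fun i hi => hx.2 i (h.trans hi)⟩

/-- the boundary -/
def bdA (N : ℕ) : Set (EE N) := {x | ‖x‖ = 1 ∨ ‖x‖ = 2}
theorem bdA_closed : IsClosed (bdA N) :=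
  (isClosed_eq continuous_norm continuous_const).union (isClosed_eq continuous_norm continuous_const)
theorem bdA_neg {x : EE N} (hx : x ∈ bdA N) : -x ∈ bdA N := by simpa [bdA] using hx

theorem eq_ext {σ : EE N ≃L[ℝ] EE N} (hσ : Sg σ) {u : EE N → EE N} (uc : Continuous u)
    (un : ∀ x, u (-x) = σ (u x)) (ub : ∀ x ∈ bdA N, u x ≠ 0) (u1 : ∀ x ∈ Ak N 1, u x ≠ 0) (k : ℕ) :
    1 ≤ k → k ≤ N → ∃ v : EE N → EE N, Continuous v ∧ (∀ x ∈ Ak N k, v (-x) = σ (v x)) ∧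
      (∀ x ∈ Ak N k, v x ≠ 0) ∧ (∀ x ∈ Ak N k, (x ∈ bdA N ∨ x ∈ Ak N 1) → v x = u x) := by
  intro hk
  induction k, hk using Nat.le_induction with
  | base => exact fun _ => ⟨u, uc, fun x _ => un x, u1, fun _ _ _ => rfl⟩
  | succ k hk ih =>
    intro hkN
    obtain ⟨v, vc, vn, v0, vb⟩ := ih (by omega)
    obtain ⟨w, wc, w1, w2⟩ := glue (Ak_closed k) bdA_closed vc.continuousOn uc.continuousOn
      (fun x hx hx' => vb x hx (Or.inl hx'))
    let j : Fin (N+1) := ⟨k, by omega⟩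
    let K : Set (EE N) := {x | x ∈ Ak N (k+1) ∧ 0 ≤ x j}
    have hKc : IsClosed K := (Ak_closed _).inter
      (isClosed_le (f := fun _ : EE N => (0:ℝ)) (g := fun x : EE N => x j) (by fun_prop) (by fun_prop))
    have hkk : ∀ x ∈ Ak N (k+1), x j = 0 → x ∈ Ak N k := by
      intro x hx hj
      refine ⟨hx.1, fun i hi => ?_⟩
      rcases hi.eq_or_lt with h | h
      · have : i = j := Fin.ext h.symm
        rw [this, hj]
      · exact hx.2 i h
    have hjk : ∀ x ∈ Ak N k, x j = 0 := fun x hx => hx.2 j le_rfl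
    let V : Submodule ℝ (EE N) :=
      LinearMap.ker (EuclideanSpace.proj (𝕜 := ℝ) (Fin.last N) : EE N →L[ℝ] ℝ).toLinearMap
    have hV : V ≠ ⊤ := by
      intro h
      have : EuclideanSpace.single (Fin.last N) (1:ℝ) ∈ V := by rw [h]; trivial
      simp [V] at this
    have hKV : K ⊆ V := by
      intro x hx
      simpa [V] using hx.1.2 (Fin.last N) (by simpa using hkN)
    obtain ⟨p, pc, pe, p0⟩ := EXT hV hKV (C := Ak N k ∪ (K ∩ bdA N))
      (((cA_compact 1 2).of_isClosed_subset (Ak_closed k) fun _ h => h.1).union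
        ((cA_compact 1 2).of_isClosed_subset (hKc.inter bdA_closed) fun _ h => h.1.1.1)) wc (by
        rintro x (hx | hx)
        · rw [w1 x hx]; exact v0 x hx
        · rw [w2 x hx.2]; exact ub x hx.2)
    obtain ⟨q, qc, q1, q2⟩ := glue hKc (hKc.preimage continuous_neg) pc.continuousOn
      (e₂ := fun x => σ (p (-x))) (by
        have := σ.continuous
        exact Continuous.continuousOn (by fun_prop)) (by
        intro x hx hx'
        have h2 := hx'.2
        have h3 := hx.2
        simp only [PiLp.neg_apply] at h2
        have hxk := hkk x hx.1 (by linarith)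
        rw [pe x (Or.inl hxk), pe (-x) (Or.inl (Ak_neg hxk)), w1 x hxk, w1 _ (Ak_neg hxk), vn x hxk,
          hσ.inv])
    have hcase : ∀ x ∈ Ak N (k+1), x ∈ K ∨ -x ∈ K := by
      intro x hx
      rcases le_total 0 (x j) with h | h
      · exact Or.inl ⟨hx, h⟩
      · exact Or.inr ⟨Ak_neg hx, by simpa using h⟩
    have q2' : ∀ x, -x ∈ K → q x = σ (p (-x)) := fun x hx => q2 x hx
    have hpu : ∀ x ∈ K, (x ∈ bdA N ∨ x ∈ Ak N 1) → p x = u x := by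
      rintro x hx (h | h)
      · rw [pe x (Or.inr ⟨hx, h⟩), w2 x h]
      · have := Ak_mono hk h
        rw [pe x (Or.inl this), w1 x this, vb x this (Or.inr h)]
    refine ⟨q, qc, ?_, ?_, ?_⟩
    · intro x hx
      rcases hcase x hx with h | h
      · rw [q1 x h, q2' (-x) (by simpa using h), neg_neg]
      · rw [q1 (-x) h, q2' x h, hσ.inv]
    · intro x hx
      rcases hcase x hx with h | h
      · rw [q1 x h]; exact p0 x h
      · rw [q2' x h]; simpa using p0 _ h
    · intro x hx hb
      rcases hcase x hx with h | h
      · rw [q1 x h, hpu x h hb]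
      · rw [q2' x h, hpu _ h (hb.imp bdA_neg Ak_neg), un, hσ.inv]

end eqv
end RPD
end

section
open Metric Set Filter Topology
set_option linter.unusedSectionVars false

namespace RPD
section eqv
variable {N : ℕ}

noncomputable def uu (f g : EE N → EE N) (x : EE N) : EE N :=
  (2 - ‖x‖) • f x + (‖x‖ - 1) • g ((2⁻¹ : ℝ) • x)

theorem uu_one {f g : EE N → EE N} {x : EE N} (hx : ‖x‖ = 1) : uu f g x = f x := by
  simp only [uu, hx]; norm_num

theorem uu_two {f g : EE N → EE N} {x : EE N} (hx : x ∈ sphere (0:EE N) 1) :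
    uu f g ((2:ℝ) • x) = g x := by
  simp only [uu, norm_smul_unit two_pos hx, smul_smul]; norm_num

theorem uu_neg {σ : EE N ≃L[ℝ] EE N} {f g : EE N → EE N} (hf : EqM σ f) (hg : EqM σ g) (x : EE N) :
    uu f g (-x) = σ (uu f g x) := by
  simp only [uu, norm_neg, smul_neg, hf.neg, hg.neg, map_add, map_smul]

theorem uu_ray {σ : EE N ≃L[ℝ] EE N} {f g : EE N → EE N} (hf : EqM σ f) (hg : EqM σ g) {s : ℝ}
    (hs : s ∈ Icc (1:ℝ) 2) : ∃ c : ℝ, 0 < c ∧ uu f g (s • e0 N) = c • e0 N := by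
  have h0 : 0 ≤ s := by linarith [hs.1]
  have hn : ‖s • e0 N‖ = s := by
    rw [norm_smul, Real.norm_of_nonneg h0, e0]; simp
  refine ⟨(2 - s) * s + (s - 1) * (2⁻¹ * s), ?_, ?_⟩
  · nlinarith [hs.1, hs.2]
  · rw [uu, hn, hf.hom _ _ h0, smul_smul, hg.hom _ _ (by positivity), hg.hom _ _ h0, hf.pt, hg.pt,
      smul_smul, smul_smul, add_smul, mul_assoc (s - 1)]

theorem e0_ne : e0 N ≠ 0 := by
  intro h; have := congrArg (fun x => x 0) h; simp [e0] at this

theorem mem_Ak_one {x : EE N} (hx : x ∈ Ak N 1) : ∃ s ∈ Icc (1:ℝ) 2, x = s • e0 N ∨ x = -(s • e0 N) := by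
  have e : x = x 0 • e0 N := by
    ext i
    by_cases hi : i = 0
    · subst hi; simp [e0]
    · have := hx.2 i (Nat.one_le_iff_ne_zero.2 (fun h => hi (Fin.ext h)))
      simp [e0, this, hi]
  have hn : ‖x‖ = |x 0| := by
    conv_lhs => rw [e]
    rw [norm_smul, e0]; simp
  refine ⟨|x 0|, by rw [← hn]; exact hx.1, ?_⟩
  rcases abs_cases (x 0) with h | h
  · rw [h.1]; exact Or.inl e
  · rw [h.1]; right; rw [neg_smul, neg_neg]; exact e

theorem uu_cont {f g : EE N → EE N} (hf : Continuous f) (hg : Continuous g) : Continuous (uu f g) := by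
  unfold uu; fun_prop

theorem bdA_cases {x : EE N} (hx : x ∈ bdA N) : x ∈ sphere (0:EE N) 1 ∨ ∃ y ∈ sphere (0:EE N) 1, x = (2:ℝ) • y := by
  rcases hx with h | h
  · left; simpa using h
  · right; exact exists_unit two_pos h

theorem bd_W {x : EE N} (hx : x ∈ cW N) (hx' : x ∉ oW N) : x ∈ bdA N ∨ tau x = 0 := by
  by_cases h : x ∈ oA (EE N) 1 2
  · right
    by_contra h0
    exact hx' ⟨h, lt_of_le_of_ne hx.2 (Ne.symm h0)⟩
  · exact Or.inl (bd_A hx.1 h)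

theorem AN_iff {x : EE N} : x ∈ Ak N N ↔ x ∈ cA (EE N) 1 2 ∧ tau x = 0 := by
  constructor
  · intro h; exact ⟨h.1, h.2 (Fin.last N) (by simp)⟩
  · rintro ⟨h, h'⟩
    refine ⟨h, fun i hi => ?_⟩
    have : i = Fin.last N := Fin.ext (by simp; omega)
    rw [this]; exact h'

theorem eq_reg (hN : 1 ≤ N) {σ : EE N ≃L[ℝ] EE N} (hσ : Sg σ)
    {f g : EE N → EE N} (hf : EqM σ f) (hg : EqM σ g) :
    ∃ h, Reg (oW N) (cW N) h ∧ (∀ x ∈ cW N, tau x = 0 → h (-x) = σ (h x)) ∧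
      (∀ x ∈ cW N, x ∈ bdA N ∨ x ∈ Ak N 1 → h x = uu f g x) := by
  have hb : ∀ x ∈ bdA N, uu f g x ≠ 0 := by
    intro x hx
    rcases bdA_cases hx with h | ⟨y, hy, rfl⟩
    · rw [uu_one (by simpa using h)]; exact hf.nv.2 x h
    · rw [uu_two hy]; exact hg.nv.2 y hy
  have h1 : ∀ x ∈ Ak N 1, uu f g x ≠ 0 := by
    intro x hx
    obtain ⟨s, hs, rfl | rfl⟩ := mem_Ak_one hx
    all_goals obtain ⟨c, hc, e⟩ := uu_ray hf hg hs
    · rw [e]; exact smul_ne_zero hc.ne' e0_ne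
    · rw [uu_neg hf hg, e]; simpa using ⟨hc.ne', e0_ne⟩
  obtain ⟨v, vc, vn, v0, vb⟩ := eq_ext hσ (uu_cont hf.cont hg.cont) (uu_neg hf hg) hb h1 N hN le_rfl
  obtain ⟨w, wc, w1, w2⟩ := glue (Ak_closed N) bdA_closed vc.continuousOn
    (uu_cont hf.cont hg.cont).continuousOn (fun x hx hx' => vb x hx (Or.inl hx'))
  obtain ⟨h, hr, he⟩ := GEN (hEE hN) oW_open cW_compact wc (by
    rintro x ⟨hx, hx'⟩
    rcases bd_W hx hx' with h | h
    · rw [w2 x h]; exact hb x h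
    · have := AN_iff.2 ⟨hx.1, h⟩
      rw [w1 x this]; exact v0 x this)
  refine ⟨h, hr, ?_, ?_⟩
  · intro x hx ht
    have hA := AN_iff.2 ⟨hx.1, ht⟩
    have hnx : -x ∈ cW N := ⟨cA_neg hx.1, by rw [tau_neg, ht]; simp⟩
    rw [he x ⟨hx, fun h => h.2.ne' ht⟩, he (-x) ⟨hnx, fun h => h.2.ne' (by rw [tau_neg, ht]; simp)⟩,
      w1 x hA, w1 _ (Ak_neg hA), vn x hA]
  · rintro x hx (h | h)
    · rw [he x ⟨hx, fun h' => ?_⟩, w2 x h]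
      rcases h with h | h
      · exact h'.1.1.ne' h
      · exact h'.1.2.ne h
    · have hA := Ak_mono hN h
      rw [he x ⟨hx, fun h => h.2.ne' (AN_iff.1 hA).2⟩, w1 x hA, vb x hA (Or.inr h)]

theorem dbl_bd {σ : EE N ≃L[ℝ] EE N} (hσ : Sg σ) {h H u : EE N → EE N}
    (un : ∀ x, u (-x) = σ (u x)) (hh : ∀ x ∈ cW N, x ∈ bdA N ∨ x ∈ Ak N 1 → h x = u x)
    (e : ∀ x ∈ cW N, H x = h x) (hn : ∀ x ∈ cA (EE N) 1 2, H (-x) = σ (H x)) :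
    ∀ x ∈ cA (EE N) 1 2, x ∈ bdA N ∨ x ∈ Ak N 1 → H x = u x := by
  intro x hx hb
  rcases le_total 0 (tau x) with h0 | h0
  · rw [e x ⟨hx, h0⟩, hh x ⟨hx, h0⟩ hb]
  · have hm : -x ∈ cW N := ⟨cA_neg hx, by rw [tau_neg]; linarith⟩
    have := hn (-x) (cA_neg hx)
    rw [neg_neg] at this
    rw [this, e _ hm, hh _ hm (hb.imp bdA_neg Ak_neg), un, hσ.inv]

theorem mem_cA_one {x : EE N} (hx : x ∈ sphere (0:EE N) 1) : x ∈ cA (EE N) 1 2 ∧ x ∈ bdA N := by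
  have : ‖x‖ = 1 := by simpa using hx
  exact ⟨⟨this.ge, by rw [this]; norm_num⟩, Or.inl this⟩

theorem mem_cA_two {x : EE N} (hx : x ∈ sphere (0:EE N) 1) :
    (2:ℝ) • x ∈ cA (EE N) 1 2 ∧ (2:ℝ) • x ∈ bdA N := by
  have : ‖(2:ℝ) • x‖ = 2 := norm_smul_unit two_pos hx
  exact ⟨⟨by rw [this]; norm_num, this.le⟩, Or.inr this⟩

theorem eq_link (hN : 1 ≤ N) (hev : Even (N + 1)) {σ : EE N ≃L[ℝ] EE N} (hσ : Sg σ)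
    {f g : EE N → EE N} (hf : EqM σ f) (hg : EqM σ g) :
    ∃ h, Reg (oW N) (cW N) h ∧ (∀ x ∈ cW N, tau x = 0 → h (-x) = σ (h x)) ∧
      (∀ x ∈ cW N, x ∈ bdA N ∨ x ∈ Ak N 1 → h x = uu f g x) ∧ Link f g (2 * cnt (cW N) h) := by
  obtain ⟨h, hr, hn, hb⟩ := eq_reg hN hσ hf hg
  obtain ⟨H, Hr, H1, Hn, Hc⟩ := dbl hN hev hσ hr hn
  have hbd := dbl_bd hσ (uu_neg hf hg) hb H1 Hn
  refine ⟨h, hr, hn, hb, 1, 2, one_pos, one_lt_two, H, Hr, ?_, ?_, Hc⟩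
  · intro x hx
    have := mem_cA_one hx
    rw [one_smul, hbd x this.1 (Or.inl this.2), uu_one (by simpa using hx)]
  · intro x hx
    have := mem_cA_two hx
    rw [hbd _ this.1 (Or.inl this.2), uu_two hx]

theorem e0_mem : e0 N ∈ sphere (0:EE N) 1 := by simp [e0]

theorem eq_hom (hN : 1 ≤ N) (hev : Even (N + 1)) (hu : Uniq (EE N)) {σ : EE N ≃L[ℝ] EE N} (hσ : Sg σ)
    {f g : EE N → EE N} (hf : EqM σ f) (hg : EqM σ g) (hh : Hom (sphere (0:EE N) 1) f g) :
    ∃ H : ℝ × EE N → EE N, Continuous H ∧ (∀ x ∈ sphere (0:EE N) 1, H (0, x) = f x) ∧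
      (∀ x ∈ sphere (0:EE N) 1, H (1, x) = g x) ∧
      (∀ t ∈ Icc (0:ℝ) 1, ∀ x ∈ sphere (0:EE N) 1, H (t, x) ≠ 0) ∧
      (∀ t ∈ Icc (0:ℝ) 1, ∀ x ∈ sphere (0:EE N) 1, H (t, -x) = σ (H (t, x))) ∧
      ∀ t ∈ Icc (0:ℝ) 1, ∃ c : ℝ, 0 < c ∧ H (t, e0 N) = c • e0 N := by
  obtain ⟨h, hr, hn, hb, hl⟩ := eq_link hN hev hσ hf hg
  have hc : cnt (cW N) h = 0 := by
    have := hu.eq (hEE hN) hf.nv hg.nv hl (Hom.link hh)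
    omega
  obtain ⟨k, kc, ke, k0⟩ := CANW (hEE hN) oW_open oW_preconn oW_sub _ h hr le_rfl hc
  have kn : ∀ x ∈ cW N, tau x = 0 → k (-x) = σ (k x) := by
    intro x hx ht
    have hnx : -x ∈ cW N := ⟨cA_neg hx.1, by rw [tau_neg, ht]; simp⟩
    rw [ke x ⟨hx, fun h => h.2.ne' ht⟩, ke (-x) ⟨hnx, fun h => h.2.ne' (by rw [tau_neg, ht]; simp)⟩,
      hn x hx ht]
  have kb : ∀ x ∈ cW N, x ∈ bdA N ∨ x ∈ Ak N 1 → k x = uu f g x := by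
    intro x hx h
    rw [ke x ⟨hx, fun h' => ?_⟩, hb x hx h]
    rcases h with h | h
    · rcases h with h | h
      · exact h'.1.1.ne' h
      · exact h'.1.2.ne h
    · exact h'.2.ne' (AN_iff.1 (Ak_mono hN h)).2
  obtain ⟨H, Hr, H1, Hn, -⟩ := dbl hN hev hσ (Reg.of_nonvanishing kc k0) kn
  have hbd := dbl_bd hσ (uu_neg hf hg) kb H1 Hn
  have Hc := Hr.cont
  have hm : ∀ t ∈ Icc (0:ℝ) 1, ∀ x ∈ sphere (0:EE N) 1, (1 + t) • x ∈ cA (EE N) 1 2 := by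
    intro t ht x hx
    have := norm_smul_unit (r := 1 + t) (by linarith [ht.1]) hx
    exact ⟨by rw [this]; linarith [ht.1], by rw [this]; linarith [ht.2]⟩
  have H0 : ∀ x ∈ cA (EE N) 1 2, H x ≠ 0 := by
    intro x hx
    rcases le_total 0 (tau x) with h0 | h0
    · rw [H1 x ⟨hx, h0⟩]; exact k0 x ⟨hx, h0⟩
    · have hm : -x ∈ cW N := ⟨cA_neg hx, by rw [tau_neg]; linarith⟩
      have := Hn (-x) (cA_neg hx)
      rw [neg_neg] at this
      rw [this, H1 _ hm]
      simpa using k0 _ hm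
  refine ⟨fun p => H ((1 + p.1) • p.2), by fun_prop, ?_, ?_, ?_, ?_, ?_⟩
  · intro x hx
    have := mem_cA_one hx
    simp only [add_zero, one_smul]
    rw [hbd x this.1 (Or.inl this.2), uu_one (by simpa using hx)]
  · intro x hx
    have := mem_cA_two hx
    simp only [one_add_one_eq_two]
    rw [hbd _ this.1 (Or.inl this.2), uu_two hx]
  · intro t ht x hx
    exact H0 _ (hm t ht x hx)
  · intro t ht x hx
    simp only [smul_neg]
    exact Hn _ (hm t ht x hx)
  · intro t ht
    obtain ⟨c, hc, e⟩ := uu_ray hf hg (s := 1 + t) ⟨by linarith [ht.1], by linarith [ht.2]⟩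
    refine ⟨c, hc, ?_⟩
    simp only
    rw [hbd _ (hm t ht _ e0_mem) (Or.inr ⟨hm t ht _ e0_mem, ?_⟩), e]
    intro i hi
    have : i ≠ 0 := by rintro rfl; simp at hi
    simp [e0, this]

end eqv
end RPD
end

section
open Metric Set Filter Topology
set_option linter.unusedSectionVars false

namespace RPD
section ins
variable {N : ℕ}

/-- homogeneous extension -/
noncomputable def hmg (k : EE N → EE N) (x : EE N) : EE N := ‖x‖ • k (‖x‖⁻¹ • x)

theorem unit_mem {x : EE N} (hx : x ≠ 0) : ‖x‖⁻¹ • x ∈ sphere (0:EE N) 1 := by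
  rw [mem_sphere_zero_iff_norm, norm_smul, norm_inv, norm_norm, inv_mul_cancel₀ (norm_ne_zero_iff.2 hx)]

theorem hmg_cont {k : EE N → EE N} (hk : Continuous k) : Continuous (hmg k) := by
  rw [continuous_iff_continuousAt]
  intro x
  by_cases hx : x = 0
  · subst hx
    obtain ⟨M, hM⟩ := ((isCompact_closedBall (0:EE N) 1).image hk).isBounded.exists_norm_le
    have h0 : hmg k 0 = 0 := by simp [hmg]
    rw [ContinuousAt, h0]
    apply squeeze_zero_norm (a := fun x => ‖x‖ * M)
    · intro y
      rw [hmg, norm_smul, norm_norm]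
      apply mul_le_mul_of_nonneg_left _ (norm_nonneg _)
      apply hM
      refine ⟨_, ?_, rfl⟩
      by_cases hy : y = 0
      · simp [hy]
      · have := unit_mem hy
        rw [mem_sphere_zero_iff_norm] at this
        simp [this]
    · have : Tendsto (fun x : EE N => ‖x‖ * M) (𝓝 0) (𝓝 (‖(0:EE N)‖ * M)) :=
        Continuous.tendsto (by fun_prop) 0
      simpa using this
  · have h1 : ContinuousAt (fun x : EE N => ‖x‖⁻¹ • x) x :=
      (continuous_norm.continuousAt.inv₀ (norm_ne_zero_iff.2 hx)).smul continuousAt_id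
    exact continuous_norm.continuousAt.smul (hk.continuousAt.comp h1)

theorem hmg_hom (k : EE N → EE N) (c : ℝ) (x : EE N) (hc : 0 ≤ c) : hmg k (c • x) = c • hmg k x := by
  rcases hc.eq_or_lt with h | h
  · subst h; simp [hmg]
  · simp only [hmg, norm_smul, Real.norm_of_nonneg hc, smul_smul]
    congr 3
    field_simp

theorem hmg_unit {k : EE N → EE N} {x : EE N} (hx : x ∈ sphere (0:EE N) 1) : hmg k x = k x := by
  have : ‖x‖ = 1 := by simpa using hx
  simp [hmg, this]

theorem hmg_eqM {σ : EE N ≃L[ℝ] EE N} {k : EE N → EE N} (hc : Continuous k)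
    (hn : ∀ x ∈ sphere (0:EE N) 1, k (-x) = σ (k x)) (h0 : ∀ x ∈ sphere (0:EE N) 1, k x ≠ 0)
    (hp : k (e0 N) = e0 N) : EqM σ (hmg k) := by
  refine ⟨hmg_cont hc, ?_, hmg_hom k, ?_, ?_⟩
  · intro x
    by_cases hx : x = 0
    · subst hx; simp [hmg]
    · simp only [hmg, norm_neg, smul_neg, hn _ (unit_mem hx), map_smul]
  · intro x hx
    exact smul_ne_zero (norm_ne_zero_iff.2 hx) (h0 _ (unit_mem hx))
  · rw [hmg_unit e0_mem, hp]

noncomputable def eN (N : ℕ) : EE N := EuclideanSpace.single (Fin.last N) 1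

theorem eN_norm : ‖eN N‖ = 1 := by simp [eN]
theorem eN_tau : tau (eN N) = 1 := by simp [eN, tau]

theorem tau_e0 (hN : 1 ≤ N) : tau (e0 N) = 0 := by
  have : (0 : Fin (N+1)) ≠ Fin.last N := by
    intro h; have := congrArg Fin.val h; simp at this; omega
  simp [tau, e0, this]

def Cc (N : ℕ) : Set (EE N) := {x | x ∈ cW N ∧ (‖x‖ = 1 ∨ tau x = 0)}

theorem Cc_closed : IsClosed (Cc N) :=
  cW_closed.inter ((isClosed_eq continuous_norm continuous_const).union
    (isClosed_eq continuous_tau continuous_const))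

theorem ins_hom (hN : 1 ≤ N) {f : EE N → EE N} (hc : Continuous f) (h0 : ∀ x, x ≠ 0 → f x ≠ 0)
    {L : EE N →L[ℝ] EE N} (hL : L.det ≠ 0) :
    Hom (Cc N) (fun x => L (x - (3/2 : ℝ) • eN N)) f := by
  have h1 : Hom (Cc N) (fun x => L (x - (3/2 : ℝ) • eN N)) (fun x => L (x - (3 : ℝ) • eN N)) := by
    apply Hom.of_path (H := fun z : ℝ × EE N => L (z.2 - (3/2 * (1 + z.1)) • eN N))
    · fun_prop
    · intro t ht x hx h
      have h := sub_eq_zero.1 (det_inj hL h)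
      simp only at h
      have ht0 : 0 ≤ t := ht.1
      rcases hx.2 with h' | h'
      · rw [h, norm_smul, eN_norm, Real.norm_of_nonneg (by positivity)] at h'
        linarith
      · rw [h, tau_smul, eN_tau] at h'
        linarith
    · intro x _; norm_num
    · intro x _; norm_num
  let D : Set (EE N) := {x | 0 ≤ tau x ∧ x ≠ 0 ∧ ‖x‖ ≤ 2}
  have hne : ∀ x : EE N, 0 < tau x → x ≠ 0 := by rintro x hx rfl; simp [tau] at hx
  have h2 : Hom D (fun x => L (x - (3 : ℝ) • eN N)) f := by
    apply hom_star (hEE hN) (d := eN N)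
    · exact ⟨by rw [eN_tau]; norm_num, hne _ (by rw [eN_tau]; norm_num), by rw [eN_norm]; norm_num⟩
    · rintro x ⟨hx1, hx2, hx3⟩ t ht
      have e : eN N + t • (x - eN N) = (1 - t) • eN N + t • x := by module
      rw [e]
      have ht0 : 0 ≤ t := ht.1
      have ht1 : 0 ≤ 1 - t := by linarith [ht.2]
      have htau : tau ((1 - t) • eN N + t • x) = (1 - t) + t * tau x := by
        rw [tau_add, tau_smul, tau_smul, eN_tau, mul_one]
      refine ⟨by rw [htau]; positivity, ?_, ?_⟩
      · rcases ht1.eq_or_lt with h | h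
        · have : t = 1 := by linarith
          subst this; simpa using hx2
        · apply hne; rw [htau]; positivity
      · calc ‖(1 - t) • eN N + t • x‖ ≤ ‖(1 - t) • eN N‖ + ‖t • x‖ := norm_add_le _ _
          _ = (1 - t) + t * ‖x‖ := by
            rw [norm_smul, norm_smul, eN_norm, Real.norm_of_nonneg ht0, Real.norm_of_nonneg ht1, mul_one]
          _ ≤ 2 := by nlinarith
    · fun_prop
    · exact hc
    · rintro x ⟨hx1, hx2, hx3⟩ h
      have h := sub_eq_zero.1 (det_inj hL h)
      rw [h, norm_smul, eN_norm] at hx3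
      norm_num at hx3
    · rintro x ⟨hx1, hx2, hx3⟩
      exact h0 x hx2
  refine h1.trans (h2.mono ?_)
  intro x hx
  refine ⟨hx.1.2, ?_, hx.1.1.2⟩
  rintro rfl
  have := hx.1.1.1
  simp at this
  linarith

theorem ins_one (hN : 1 ≤ N) (hev : Even (N + 1)) {σ : EE N ≃L[ℝ] EE N} (hσ : Sg σ)
    {f : EE N → EE N} (hf : EqM σ f) {L : EE N →L[ℝ] EE N} (hL : L.det ≠ 0) :
    ∃ g, EqM σ g ∧ Link f g (2 * (SignType.sign L.det : ℤ)) := by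
  obtain ⟨G, Gc, G0, G1, Gn⟩ := ins_hom hN hf.cont hf.nz hL
  set p : EE N := (3/2 : ℝ) • eN N with hp
  have hpn : ‖p‖ = 3/2 := by rw [hp, norm_smul, eN_norm]; norm_num
  have hpt : tau p = 3/2 := by rw [hp, tau_smul, eN_tau]; norm_num
  have hpo : p ∈ oW N := ⟨⟨by rw [hpn]; norm_num, by rw [hpn]; norm_num⟩, by rw [hpt]; norm_num⟩
  obtain ⟨K, Kc, K0, KG, ⟨U, hU, hzU, hKU⟩, hz⟩ := HEP (cW_compact (N := N)) Cc_closed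
    (h := fun x => L (x - p)) (by fun_prop) Gc G0 Gn
  set h : EE N → EE N := fun x => K (1, x) with hh
  have hpU : p ∈ U := hzU p (oW_sub hpo) (by simp)
  have hz' : ∀ x, (x ∈ cW N ∧ h x = 0) ↔ x = p := by
    intro x
    constructor
    · rintro ⟨hx, h0⟩
      exact sub_eq_zero.1 (det_inj hL (hz 1 (by simp) x hx h0))
    · rintro rfl
      exact ⟨oW_sub hpo, by rw [hh]; simp [hKU _ hpU]⟩
  have hg : h =ᶠ[𝓝 p] fun x => L (x - p) := by
    filter_upwards [hU.mem_nhds hpU] with y hy using hKU y hy 1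
  have hd : fderiv ℝ h p = L := by rw [hg.fderiv_eq, (hasFDerivAt_lin L p p).fderiv]
  have hr : Reg (oW N) (cW N) h := by
    refine ⟨by fun_prop, ?_, ?_, ?_⟩
    · have : {x | x ∈ cW N ∧ h x = 0} = {p} := by
        ext x; simp only [mem_ofPred_eq, mem_singleton_iff]; exact hz' x
      rw [this]; exact finite_singleton _
    · intro x hx h0
      rw [(hz' x).1 ⟨hx, h0⟩]; exact hpo
    · intro x hx h0
      rw [(hz' x).1 ⟨hx, h0⟩, hd]; exact hL
  have hC : ∀ x ∈ Cc N, h x = f x := fun x hx => by rw [hh]; simp only; rw [KG 1 (by simp) x hx, G1 x hx]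
  obtain ⟨H, Hr, H1, Hn, Hc⟩ := dbl hN hev hσ hr (by
    intro x hx ht
    have hnx : -x ∈ cW N := ⟨cA_neg hx.1, by rw [tau_neg, ht]; simp⟩
    rw [hC x ⟨hx, Or.inr ht⟩, hC (-x) ⟨hnx, Or.inr (by rw [tau_neg, ht]; simp)⟩, hf.neg])
  rw [cnt_single hz', sgn, hd] at Hc
  have Hcont := Hr.cont
  have H0 : ∀ x ∈ bdA N, x ∈ cA (EE N) 1 2 → H x ≠ 0 := by
    intro x hb hx h0
    have := Hr.mem x hx h0
    rcases hb with h | h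
    · exact this.1.ne' h
    · exact this.2.ne h
  have hge : EqM σ (hmg fun x => (2⁻¹ : ℝ) • H ((2:ℝ) • x)) := by
    apply hmg_eqM
    · fun_prop
    · intro x hx
      rw [smul_neg, Hn _ (mem_cA_two hx).1, map_smul]
    · intro x hx
      exact smul_ne_zero (by norm_num) (H0 _ (mem_cA_two hx).2 (mem_cA_two hx).1)
    · have ht : tau ((2:ℝ) • e0 N) = 0 := by rw [tau_smul, tau_e0 hN]; simp
      have hm : (2:ℝ) • e0 N ∈ cW N := ⟨(mem_cA_two e0_mem).1, ht.ge⟩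
      rw [H1 _ hm, hC _ ⟨hm, Or.inr ht⟩, hf.hom _ _ (by norm_num), hf.pt, smul_smul]
      norm_num
  refine ⟨_, hge, ?_⟩
  have l1 : Link f (fun x => H ((2:ℝ) • x)) (2 * (SignType.sign L.det : ℤ)) := by
    refine ⟨1, 2, one_pos, one_lt_two, H, Hr, ?_, fun _ _ => rfl, Hc⟩
    intro x hx
    have hx1 : ‖x‖ = 1 := by simpa using hx
    rw [one_smul]
    rcases le_total 0 (tau x) with h0 | h0
    · have hm : x ∈ cW N := ⟨(mem_cA_one hx).1, h0⟩
      rw [H1 x hm, hC x ⟨hm, Or.inl hx1⟩]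
    · have hm : -x ∈ cW N := ⟨cA_neg (mem_cA_one hx).1, by rw [tau_neg]; linarith⟩
      have := Hn (-x) hm.1
      rw [neg_neg] at this
      rw [this, H1 _ hm, hC _ ⟨hm, Or.inl (by rw [norm_neg, hx1])⟩, hf.neg, hσ.inv]
  have l2 : Hom (sphere (0:EE N) 1) (fun x => H ((2:ℝ) • x))
      (hmg fun x => (2⁻¹ : ℝ) • H ((2:ℝ) • x)) := by
    apply Hom.of_path (H := fun z : ℝ × EE N => (1 - 2⁻¹ * z.1) • H ((2:ℝ) • z.2))
    · fun_prop
    · intro t ht x hx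
      have := ht.2
      exact smul_ne_zero (by simp only; intro h; linarith) (H0 _ (mem_cA_two hx).2 (mem_cA_two hx).1)
    · intro x _; simp
    · intro x hx; rw [hmg_unit hx]; norm_num
  simpa using l1.trans (hEE hN) (Hom.link l2)

theorem ins (hN : 1 ≤ N) (hev : Even (N + 1)) {σ : EE N ≃L[ℝ] EE N} (hσ : Sg σ)
    {f : EE N → EE N} (hf : EqM σ f) (a : ℤ) : ∃ g, EqM σ g ∧ Link f g (2 * a) := by
  have hp : ∀ f : EE N → EE N, EqM σ f → ∃ g, EqM σ g ∧ Link f g 2 := by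
    intro f hf
    have := ins_one hN hev hσ hf (L := ContinuousLinearMap.id ℝ (EE N)) (by simp [ContinuousLinearMap.det])
    simpa [ContinuousLinearMap.det] using this
  have hm : ∀ f : EE N → EE N, EqM σ f → ∃ g, EqM σ g ∧ Link f g (-2) := by
    intro f hf
    obtain ⟨A, hA⟩ := exists_refl (hEE hN) 1 one_ne_zero
    have := ins_one hN hev hσ hf (L := A) (by intro h; simp [h] at hA)
    rw [sign_neg (by simpa using hA)] at this
    simpa using this
  have hnat : ∀ k : ℕ, ∃ g, EqM σ g ∧ Link f g (2 * k) := by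
    intro k
    induction k with
    | zero => exact ⟨f, hf, by simpa using hf.nv.refl⟩
    | succ k ih =>
      obtain ⟨g, hg, l⟩ := ih
      obtain ⟨g', hg', l'⟩ := hp g hg
      exact ⟨g', hg', by convert l.trans (hEE hN) l' using 1; push_cast; ring⟩
  have hnat' : ∀ k : ℕ, ∃ g, EqM σ g ∧ Link f g (2 * (-k)) := by
    intro k
    induction k with
    | zero => exact ⟨f, hf, by simpa using hf.nv.refl⟩
    | succ k ih =>
      obtain ⟨g, hg, l⟩ := ih
      obtain ⟨g', hg', l'⟩ := hm g hg
      exact ⟨g', hg', by convert l.trans (hEE hN) l' using 1; push_cast; ring⟩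
  rcases Int.eq_nat_or_neg a with ⟨k, rfl | rfl⟩
  · exact hnat k
  · exact hnat' k

end ins
end RPD
end

section
open Metric Set Filter Topology
set_option linter.unusedSectionVars false

namespace RPD
section base
variable {N : ℕ}

noncomputable def sp (N : ℕ) : EE N ≃L[ℝ] EE N := ContinuousLinearEquiv.refl ℝ (EE N)
noncomputable def sm (N : ℕ) : EE N ≃L[ℝ] EE N := ContinuousLinearEquiv.neg ℝ

theorem sp_apply (x : EE N) : sp N x = x := rfl
theorem sm_apply (x : EE N) : sm N x = -x := rfl

theorem Sg_sp : Sg (sp N) := ⟨fun _ => rfl, by simp [sp, ContinuousLinearMap.det]⟩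
theorem Sg_sm (hev : Even (N + 1)) : Sg (sm N) := ⟨fun x => neg_neg x, det_neg_pos hev⟩

noncomputable def cst (N : ℕ) (x : EE N) : EE N := ‖x‖ • e0 N

theorem cst_eqM : EqM (sp N) (cst N) := by
  refine ⟨by unfold cst; fun_prop, ?_, ?_, ?_, ?_⟩
  · intro x; simp [cst, sp_apply]
  · intro c x hc; simp [cst, norm_smul, abs_of_nonneg hc, smul_smul]
  · intro x hx; exact smul_ne_zero (norm_ne_zero_iff.2 hx) e0_ne
  · simp [cst, e0]

theorem id_eqM : EqM (sm N) (fun x => x) :=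
  ⟨by fun_prop, fun x => rfl, fun _ _ _ => rfl, fun _ h => h, rfl⟩

theorem link_base (hN : 1 ≤ N) : Link (cst N) (fun x => x) 1 := by
  set p : EE N := (3/2 : ℝ) • eN N with hp
  have hpn : ‖p‖ = 3/2 := by rw [hp, norm_smul, eN_norm]; norm_num
  have hpo : p ∈ oA (EE N) 1 2 := ⟨by rw [hpn]; norm_num, by rw [hpn]; norm_num⟩
  have hz : ∀ x, (x ∈ cA (EE N) 1 2 ∧ x - p = 0) ↔ x = p := by
    intro x
    constructor
    · rintro ⟨_, h⟩; exact sub_eq_zero.1 h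
    · rintro rfl; exact ⟨oA_sub _ _ hpo, sub_self _⟩
  have hd : ∀ x, fderiv ℝ (fun x : EE N => x - p) x = ContinuousLinearMap.id ℝ (EE N) := fun x =>
    (hasFDerivAt_lin (ContinuousLinearMap.id ℝ (EE N)) p x).fderiv
  have hdet : (ContinuousLinearMap.id ℝ (EE N)).det = 1 := by simp [ContinuousLinearMap.det]
  have l1 : Link (fun x : EE N => x - p) (fun x => (2:ℝ) • x - p) 1 := by
    refine ⟨1, 2, one_pos, one_lt_two, fun x => x - p, ⟨by fun_prop, ?_, ?_, ?_⟩, ?_, fun _ _ => rfl, ?_⟩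
    · have : {x | x ∈ cA (EE N) 1 2 ∧ x - p = 0} = {p} := by
        ext x; simp only [mem_ofPred_eq, mem_singleton_iff]; exact hz x
      rw [this]; exact finite_singleton _
    · intro x hx h0
      rw [(hz x).1 ⟨hx, h0⟩]; exact hpo
    · intro x hx h0
      rw [hd, hdet]; norm_num
    · intro x _; simp
    · rw [cnt_single hz, sgn, hd, hdet]; simp
  have h0 : Hom (sphere (0:EE N) 1) (cst N) (fun x => x - p) := by
    have : Hom (closedBall (0:EE N) 1) (fun _ => e0 N) (fun x => x - p) := by
      apply hom_star (hEE hN) (d := 0)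
      · simp
      · intro x hx t ht
        simp only [sub_zero, zero_add]
        rw [mem_closedBall_zero_iff] at hx ⊢
        rw [norm_smul, Real.norm_of_nonneg ht.1]
        nlinarith [ht.1, ht.2, norm_nonneg x]
      · fun_prop
      · fun_prop
      · intro x _; exact e0_ne
      · intro x hx h
        rw [sub_eq_zero.1 h, mem_closedBall_zero_iff, hpn] at hx
        norm_num at hx
    refine (this.mono sphere_subset_closedBall).congr ?_ ?_
    · intro x hx; simp [cst, mem_sphere_zero_iff_norm.1 hx]
    · intro x hx; rfl
  have h2 : Hom (sphere (0:EE N) 1) (fun x => (2:ℝ) • x - p) (fun x => x) := by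
    apply Hom.of_path (H := fun z : ℝ × EE N => (2 - z.1) • z.2 - (1 - z.1) • p)
    · fun_prop
    · intro t ht x hx h
      have h := congrArg norm (sub_eq_zero.1 h)
      have h1 := ht.2
      rw [norm_smul, norm_smul, hpn, mem_sphere_zero_iff_norm.1 hx, Real.norm_of_nonneg (by simp only; linarith),
        Real.norm_of_nonneg (by simp only; linarith)] at h
      have h2 := ht.1
      simp only at h
      linarith
    · intro x _; simp
    · intro x _; simp; module
  simpa using ((Hom.link h0).trans (hEE hN) l1).trans (hEE hN) (Hom.link h2)

theorem odd_even (hN : 1 ≤ N) (hev : Even (N + 1)) (hu : Uniq (EE N)) {f g : EE N → EE N}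
    (hf : EqM (sp N) f) (hg : EqM (sm N) g) : ¬ Hom (sphere (0:EE N) 1) f g := by
  intro hh
  obtain ⟨h, _, _, _, l1⟩ := eq_link hN hev Sg_sp cst_eqM hf
  obtain ⟨h', _, _, _, l2⟩ := eq_link hN hev (Sg_sm hev) id_eqM hg
  have := hu.eq (hEE hN) cst_eqM.nv hg.nv (l1.trans (hEE hN) (Hom.link hh))
    ((link_base hN).trans (hEE hN) l2)
  omega

theorem surj (hN : 1 ≤ N) (hev : Even (N + 1)) (hu : Uniq (EE N)) {φ : EE N → EE N} (hφ : NV φ) :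
    ∃ (σ : EE N ≃L[ℝ] EE N) (g : EE N → EE N), (σ = sp N ∨ σ = sm N) ∧ EqM σ g ∧
      Hom (sphere (0:EE N) 1) g φ := by
  obtain ⟨a, ha⟩ := Link.exists (hEE hN) cst_eqM.nv hφ
  rcases Int.even_or_odd' a with ⟨k, rfl | rfl⟩
  · obtain ⟨g, hg, l⟩ := ins hN hev Sg_sp (cst_eqM (N := N)) k
    refine ⟨_, g, Or.inl rfl, hg, Link.hom (hEE hN) ?_⟩
    have := (hu.symm (hEE hN) cst_eqM.nv hg.nv l).trans (hEE hN) ha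
    simpa using this
  · obtain ⟨g, hg, l⟩ := ins hN hev (Sg_sm hev) (id_eqM (N := N)) k
    refine ⟨_, g, Or.inr rfl, hg, Link.hom (hEE hN) ?_⟩
    have := (hu.symm (hEE hN) cst_eqM.nv hg.nv ((link_base hN).trans (hEE hN) l)).trans (hEE hN) ha
    convert this using 1; ring

end base
end RPD
end

section
open Metric Set Filter Topology
set_option linter.unusedSectionVars false

namespace RPD
section cov
variable {N : ℕ}

theorem ant_val (x : Sph N) : (Sph.antipode N x).1 = -x.1 := rfl
theorem ant_ant (x : Sph N) : Sph.antipode N (Sph.antipode N x) = x := Subtype.ext (neg_neg _)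
theorem ant_ne (x : Sph N) : Sph.antipode N x ≠ x := by
  intro h
  have h1 : -x.1 = x.1 := congrArg Subtype.val h
  have h2 : (2:ℝ) • x.1 = 0 := by
    rw [two_smul]
    nth_rewrite 1 [← h1]
    simp
  exact ne_zero_of_unit x.2 ((smul_eq_zero.1 h2).resolve_left two_ne_zero)
theorem ant_cont : Continuous (Sph.antipode N) :=
  Continuous.subtype_mk (continuous_subtype_val.neg) _

theorem proj_eq {x y : Sph N} : RP.proj N x = RP.proj N y ↔ y = x ∨ y = Sph.antipode N x := by
  constructor
  · intro h
    have h1 : Relation.EqvGen (fun x y : Sph N => y = x ∨ y = Sph.antipode N x) x y := Quot.eqvGen_exact h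
    clear h
    induction h1 with
    | rel x y h => exact h
    | refl x => exact Or.inl rfl
    | symm x y _ ih =>
      rcases ih with rfl | rfl
      · exact Or.inl rfl
      · exact Or.inr (ant_ant x).symm
    | trans x y z _ _ ih ih' =>
      rcases ih with rfl | rfl <;> rcases ih' with rfl | rfl
      · exact Or.inl rfl
      · exact Or.inr rfl
      · exact Or.inr rfl
      · exact Or.inl (ant_ant x)
  · exact fun h => Quot.sound h

theorem proj_ant (x : Sph N) : RP.proj N (Sph.antipode N x) = RP.proj N x :=
  proj_eq.2 (Or.inr (ant_ant x).symm)

theorem proj_quot : IsQuotientMap (RP.proj N) := isQuotientMap_quot_mk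

/-- the sign action -/
@[reducible]
noncomputable def act (N : ℕ) : MulAction ℤˣ (Sph N) where
  smul u x := if u = 1 then x else Sph.antipode N x
  one_smul x := if_pos rfl
  mul_smul u v x := by
    change (if u * v = 1 then x else Sph.antipode N x) =
      if u = 1 then (if v = 1 then x else Sph.antipode N x) else
        Sph.antipode N (if v = 1 then x else Sph.antipode N x)
    rcases Int.units_eq_one_or u with rfl | rfl <;> rcases Int.units_eq_one_or v with rfl | rfl <;>
      simp [ant_ant]

theorem proj_qcov : letI := act N; IsQuotientCoveringMap (RP.proj N) ℤˣ := by
  letI := act N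
  have hs : ∀ (u : ℤˣ) (x : Sph N), u • x = if u = 1 then x else Sph.antipode N x := fun _ _ => rfl
  refine { proj_quot with continuous_const_smul := ?_, apply_eq_iff_mem_orbit := ?_, disjoint := ?_ }
  · intro u
    rcases Int.units_eq_one_or u with rfl | rfl
    · simpa [hs] using continuous_id'
    · simpa [hs] using ant_cont
  · intro x y
    rw [eq_comm, proj_eq, MulAction.mem_orbit_iff]
    constructor
    · rintro (rfl | rfl)
      · exact ⟨1, by simp [hs]⟩
      · exact ⟨-1, by simp [hs]⟩
    · rintro ⟨u, rfl⟩
      rcases Int.units_eq_one_or u with rfl | rfl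
      · left; simp [hs]
      · right; simp [hs]
  · intro x
    refine ⟨ball x 1, ball_mem_nhds x one_pos, ?_⟩
    rintro u ⟨z, ⟨y, hy, rfl⟩, hz⟩
    rcases Int.units_eq_one_or u with rfl | rfl
    · rfl
    · exfalso
      simp only [hs] at hz
      rw [if_neg (by decide)] at hz
      have h1 : dist (Sph.antipode N y) y < 2 := by
        have := dist_triangle_right (Sph.antipode N y) y x
        rw [mem_ball] at hy hz
        linarith
      rw [Subtype.dist_eq, ant_val, dist_eq_norm] at h1
      have e : -y.1 - y.1 = (-2 : ℝ) • y.1 := by module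
      rw [e, norm_smul, mem_sphere_zero_iff_norm.1 y.2] at h1
      norm_num at h1

theorem proj_cov : IsCoveringMap (RP.proj N) := by
  letI := act N
  exact (proj_qcov (N := N)).isCoveringMap
theorem proj_open : IsOpenQuotientMap (RP.proj N) := by
  letI := act N
  exact (proj_qcov (N := N)).isOpenQuotientMap

theorem sph_conn (hN : 1 ≤ N) : PreconnectedSpace (Sph N) :=
  Subtype.preconnectedSpace (isPreconnected_sphere (one_lt_rank (hEE hN)) 0 1)

/-- extension to the whole space -/
theorem ext_exists (φ : C(Sph N, Sph N)) : ∃ F : EE N → EE N, Continuous F ∧ ∀ x : Sph N, F x.1 = (φ x).1 := by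
  obtain ⟨f, hf⟩ := ContinuousMap.exists_restrict_eq (Y := EE N) (s := sphere (0:EE N) 1) isClosed_sphere
    ⟨fun x => (φ x).1, by fun_prop⟩
  exact ⟨f, f.continuous, fun x => DFunLike.congr_fun hf x⟩

noncomputable def ext (φ : C(Sph N, Sph N)) : EE N → EE N := (ext_exists φ).choose
theorem ext_cont (φ : C(Sph N, Sph N)) : Continuous (ext φ) := (ext_exists φ).choose_spec.1
theorem ext_val (φ : C(Sph N, Sph N)) (x : Sph N) : ext φ x.1 = (φ x).1 := (ext_exists φ).choose_spec.2 x
theorem ext_nv (φ : C(Sph N, Sph N)) : NV (ext φ) :=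
  ⟨ext_cont φ, fun x hx => by rw [ext_val φ ⟨x, hx⟩]; exact ne_zero_of_unit (φ _).2⟩

/-- normalization of a family -/
noncomputable def nrm (H : ℝ × EE N → EE N) (hc : Continuous H)
    (h0 : ∀ t ∈ Icc (0:ℝ) 1, ∀ x ∈ sphere (0:EE N) 1, H (t, x) ≠ 0) : C(unitInterval × Sph N, Sph N) where
  toFun p := ⟨‖H (p.1.1, p.2.1)‖⁻¹ • H (p.1.1, p.2.1), unit_mem (h0 _ p.1.2 _ p.2.2)⟩
  continuous_toFun := by
    apply Continuous.subtype_mk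
    have h1 : Continuous fun p : unitInterval × Sph N => H (p.1.1, p.2.1) := by fun_prop
    exact (h1.norm.inv₀ fun p => norm_ne_zero_iff.2 (h0 _ p.1.2 _ p.2.2)).smul h1

theorem nrm_val (H : ℝ × EE N → EE N) (hc : Continuous H)
    (h0 : ∀ t ∈ Icc (0:ℝ) 1, ∀ x ∈ sphere (0:EE N) 1, H (t, x) ≠ 0) (t : unitInterval) (x y : Sph N)
    {c : ℝ} (hp : 0 < c) (h : H (t.1, x.1) = c • y.1) : nrm H hc h0 (t, x) = y := by
  apply Subtype.ext
  change ‖H (t.1, x.1)‖⁻¹ • H (t.1, x.1) = y.1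
  rw [h, norm_smul, mem_sphere_zero_iff_norm.1 y.2, mul_one, Real.norm_of_nonneg hp.le, smul_smul,
    inv_mul_cancel₀ hp.ne', one_smul]

theorem hom_iff (φ ψ : C(Sph N, Sph N)) : Hom (sphere (0:EE N) 1) (ext φ) (ext ψ) ↔ φ.Homotopic ψ := by
  constructor
  · rintro ⟨H, Hc, H0, H1, Hn⟩
    refine ⟨⟨nrm H Hc Hn, ?_, ?_⟩⟩
    · intro x
      exact nrm_val H Hc Hn 0 x _ one_pos (by rw [one_smul, ← ext_val]; exact H0 x.1 x.2)
    · intro x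
      exact nrm_val H Hc Hn 1 x _ one_pos (by rw [one_smul, ← ext_val]; exact H1 x.1 x.2)
  · rintro ⟨F⟩
    let S : Set (ℝ × EE N) := Icc 0 1 ×ˢ sphere 0 1
    have hS : IsClosed S := isClosed_Icc.prod isClosed_sphere
    have hcont : Continuous (fun z : S => (F (⟨z.1.1, z.2.1⟩, ⟨z.1.2, z.2.2⟩)).1) := by fun_prop
    obtain ⟨f, hf⟩ := ContinuousMap.exists_restrict_eq (Y := EE N) hS ⟨_, hcont⟩
    have hf' : ∀ (t : ℝ) (ht : t ∈ Icc (0:ℝ) 1) (x : EE N) (hx : x ∈ sphere (0:EE N) 1),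
        f (t, x) = (F (⟨t, ht⟩, ⟨x, hx⟩)).1 := fun t ht x hx =>
      DFunLike.congr_fun hf ⟨(t, x), ⟨ht, hx⟩⟩
    refine ⟨f, f.continuous, ?_, ?_, ?_⟩
    · intro x hx
      rw [hf' 0 (by simp) x hx, ext_val φ ⟨x, hx⟩]
      exact congrArg Subtype.val (F.apply_zero ⟨x, hx⟩)
    · intro x hx
      rw [hf' 1 (by simp) x hx, ext_val ψ ⟨x, hx⟩]
      exact congrArg Subtype.val (F.apply_one ⟨x, hx⟩)
    · intro t ht x hx
      rw [hf' t ht x hx]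
      exact ne_zero_of_unit (F _).2

theorem uniq_of_degree (hN : 1 ≤ N) (D : SphereDegree N) : Uniq (EE N) := by
  intro f hf a h
  choose φ hφ using fun i : ℕ => D.deg_surjective (i : ℤ)
  refine key (hEE hN) ((ℝ ∙ (e0 N))ᗮ.reflection) ?_ (fun i => ext (φ i)) (fun i => ext_nv _) ?_ hf h
  · have h1 := Submodule.det_reflection (𝕜 := ℝ) ((ℝ ∙ (e0 N))ᗮ)
    rw [Submodule.orthogonal_orthogonal, finrank_span_singleton e0_ne, pow_one] at h1
    change LinearMap.det _ < 0
    refine lt_of_eq_of_lt h1 (by norm_num)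
  · intro i j hij hh
    rw [hom_iff, D.homotopic_iff, hφ, hφ] at hh
    exact hij (by exact_mod_cast hh)

end cov
end RPD
end

section
open Metric Set Filter Topology
set_option linter.unusedSectionVars false

namespace RPD
section lift
variable {N : ℕ}

/-- closed upper hemisphere -/
abbrev HS (N : ℕ) : Type := {x : Sph N // 0 ≤ tau x.1}

theorem contr_ne (t : unitInterval) (y : HS N) : (1 - t.1) • eN N + t.1 • y.1.1 ≠ 0 := by
  intro h
  rcases t.2.2.lt_or_eq with h1 | h1
  · have h2 := congrArg tau h
    rw [tau_add, tau_smul, tau_smul, eN_tau] at h2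
    have h3 : tau (0 : EE N) = 0 := rfl
    have := mul_nonneg t.2.1 y.2
    linarith
  · rw [h1] at h
    simp only [sub_self, zero_smul, one_smul, zero_add] at h
    exact ne_zero_of_unit y.1.2 h

/-- contraction of the hemisphere -/
noncomputable def contr (N : ℕ) : C(unitInterval × HS N, Sph N) where
  toFun p := ⟨‖(1 - p.1.1) • eN N + p.1.1 • p.2.1.1‖⁻¹ • ((1 - p.1.1) • eN N + p.1.1 • p.2.1.1),
    unit_mem (contr_ne p.1 p.2)⟩
  continuous_toFun := by
    apply Continuous.subtype_mk
    have h1 : Continuous fun p : unitInterval × HS N => (1 - p.1.1) • eN N + p.1.1 • p.2.1.1 := by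
      fun_prop
    exact (h1.norm.inv₀ fun p => norm_ne_zero_iff.2 (contr_ne p.1 p.2)).smul h1

theorem contr_one (y : HS N) : contr N (1, y) = y.1 := by
  apply Subtype.ext
  have : (1 - ((1 : unitInterval) : ℝ)) • eN N + ((1 : unitInterval) : ℝ) • y.1.1 = y.1.1 := by simp
  change ‖(1 - ((1 : unitInterval) : ℝ)) • eN N + ((1 : unitInterval) : ℝ) • y.1.1‖⁻¹ •
    ((1 - ((1 : unitInterval) : ℝ)) • eN N + ((1 : unitInterval) : ℝ) • y.1.1) = y.1.1
  rw [this, mem_sphere_zero_iff_norm.1 y.1.2]; simp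

theorem contr_zero (y z : HS N) : contr N (0, y) = contr N (0, z) := by
  apply Subtype.ext
  change ‖(1 - ((0 : unitInterval) : ℝ)) • eN N + ((0 : unitInterval) : ℝ) • y.1.1‖⁻¹ •
    ((1 - ((0 : unitInterval) : ℝ)) • eN N + ((0 : unitInterval) : ℝ) • y.1.1) =
    ‖(1 - ((0 : unitInterval) : ℝ)) • eN N + ((0 : unitInterval) : ℝ) • z.1.1‖⁻¹ •
    ((1 - ((0 : unitInterval) : ℝ)) • eN N + ((0 : unitInterval) : ℝ) • z.1.1)
  simp

theorem proj_surj : Function.Surjective (RP.proj N) := proj_quot.surjective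

theorem pt_tau (hN : 1 ≤ N) : tau (Sph.pt N).1 = 0 := tau_e0 hN

theorem lift_half (hN : 1 ≤ N) (g : C(Sph N, RP N)) : ∃ F : C(HS N, Sph N), ∀ y, RP.proj N (F y) = g y.1 := by
  have y0 : HS N := ⟨Sph.pt N, (pt_tau hN).ge⟩
  obtain ⟨w, hw⟩ := proj_surj (g (contr N (0, y0)))
  have H0 : ∀ a, (g.comp (contr N)) (0, a) = RP.proj N ((ContinuousMap.const (HS N) w) a) := by
    intro a
    rw [ContinuousMap.comp_apply, ContinuousMap.const_apply, hw, contr_zero a y0]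
  refine ⟨((proj_cov (N := N)).liftHomotopy (g.comp (contr N)) (ContinuousMap.const _ w) H0).comp
    ⟨fun y => (1, y), by fun_prop⟩, ?_⟩
  intro y
  have := congrFun ((proj_cov (N := N)).liftHomotopy_lifts (g.comp (contr N)) (ContinuousMap.const _ w) H0) (1, y)
  rw [Function.comp_apply, ContinuousMap.comp_apply, contr_one] at this
  exact this

/-- equator as a sphere -/
noncomputable abbrev KK (N : ℕ) : Submodule ℝ (EE N) := (ℝ ∙ (eN N))ᗮ

theorem mem_KK {x : EE N} : x ∈ KK N ↔ tau x = 0 := by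
  rw [Submodule.mem_orthogonal_singleton_iff_inner_right]
  simp [eN, tau, EuclideanSpace.inner_single_left]

theorem eN_ne : eN N ≠ 0 := by
  intro h; have := eN_norm (N := N); rw [h] at this; simp at this

theorem KK_conn (hN : 2 ≤ N) : PreconnectedSpace (sphere (0 : KK N) 1) := by
  haveI : Fact (Module.finrank ℝ (EE N) = N + 1) := ⟨by simp [EE]⟩
  have h := Submodule.finrank_orthogonal_span_singleton (𝕜 := ℝ) (n := N) (eN_ne (N := N))
  apply Subtype.preconnectedSpace
  apply isPreconnected_sphere
  exact one_lt_rank (by show 1 < Module.finrank ℝ (KK N); rw [h]; omega)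

theorem eq_of_proj {ι : Type*} [TopologicalSpace ι] [PreconnectedSpace ι] {a b : ι → Sph N}
    (ha : Continuous a) (hb : Continuous b) (h : ∀ i, RP.proj N (a i) = RP.proj N (b i)) (i0 : ι) :
    (b i0 = a i0 → ∀ i, b i = a i) ∧ (b i0 = Sph.antipode N (a i0) → ∀ i, b i = Sph.antipode N (a i)) := by
  constructor
  · intro h0 i
    exact congrFun ((proj_cov (N := N)).eq_of_comp_eq hb ha (funext fun j => (h j).symm) i0 h0) i
  · intro h0 i
    exact congrFun ((proj_cov (N := N)).eq_of_comp_eq hb (ant_cont.comp ha)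
      (funext fun j => by simp only [Function.comp]; rw [proj_ant]; exact (h j).symm) i0 h0) i

theorem equator_sign (hN : 1 ≤ N) (F : C(HS N, Sph N))
    (hF : ∀ y : Sph N, ∀ h : tau y.1 = 0, ∀ h' : 0 ≤ tau (Sph.antipode N y).1,
      RP.proj N (F ⟨y, h.ge⟩) = RP.proj N (F ⟨Sph.antipode N y, h'⟩)) :
    ∃ s : Sph N → Sph N, (s = id ∨ s = Sph.antipode N) ∧
      ∀ y : Sph N, ∀ h : tau y.1 = 0, ∀ h' : 0 ≤ tau (Sph.antipode N y).1,
        F ⟨Sph.antipode N y, h'⟩ = s (F ⟨y, h.ge⟩) := by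
  have hz : ∀ y : Sph N, tau y.1 = 0 → 0 ≤ tau (Sph.antipode N y).1 := by
    intro y h; rw [ant_val, tau_neg, h, neg_zero]
  have hp := pt_tau hN
  rcases hN.lt_or_eq with h2 | h2
  · haveI := KK_conn h2
    let i : sphere (0 : KK N) 1 → Sph N := fun k => ⟨k.1.1, by
      rw [mem_sphere_zero_iff_norm]; exact mem_sphere_zero_iff_norm.1 k.2⟩
    have hi : Continuous i := Continuous.subtype_mk (by fun_prop) _
    have ht : ∀ k, tau (i k).1 = 0 := fun k => mem_KK.1 k.1.2
    have hsurj : ∀ y : Sph N, tau y.1 = 0 → ∃ k, i k = y := fun y hy =>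
      ⟨⟨⟨y.1, mem_KK.2 hy⟩, by
        rw [mem_sphere_zero_iff_norm]; exact mem_sphere_zero_iff_norm.1 y.2⟩, rfl⟩
    obtain ⟨k0, hk0⟩ := hsurj _ hp
    have key := eq_of_proj (a := fun k => F ⟨i k, (ht k).ge⟩)
      (b := fun k => F ⟨Sph.antipode N (i k), hz _ (ht k)⟩)
      (F.continuous.comp (hi.subtype_mk _))
      (F.continuous.comp ((ant_cont.comp hi).subtype_mk _)) (fun k => hF _ (ht k) _) k0
    rcases proj_eq.1 (hF _ (ht k0) (hz _ (ht k0))) with h | h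
    · refine ⟨id, Or.inl rfl, ?_⟩
      intro y hy hy'
      obtain ⟨k, rfl⟩ := hsurj y hy
      exact key.1 h k
    · refine ⟨Sph.antipode N, Or.inr rfl, ?_⟩
      intro y hy hy'
      obtain ⟨k, rfl⟩ := hsurj y hy
      exact key.2 h k
  · subst h2
    have hall : ∀ y : Sph 1, tau y.1 = 0 → y = Sph.pt 1 ∨ y = Sph.antipode 1 (Sph.pt 1) := by
      intro y hy
      have h1 := mem_sphere_zero_iff_norm.1 y.2
      have h0 : y.1 1 = 0 := hy
      rw [EuclideanSpace.norm_eq, Real.sqrt_eq_one, Fin.sum_univ_two, h0] at h1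
      simp only [norm_zero, ne_eq, OfNat.ofNat_ne_zero, not_false_eq_true, zero_pow, add_zero,
        Real.norm_eq_abs, sq_abs, sq_eq_one_iff] at h1
      rcases h1 with h1 | h1
      · left; apply Subtype.ext; ext j; fin_cases j <;> simp [Sph.pt, h0, h1]
      · right; apply Subtype.ext; ext j; fin_cases j <;> simp [ant_val, Sph.pt, h0, h1]
    have e2 : ∀ h, (⟨Sph.antipode 1 (Sph.antipode 1 (Sph.pt 1)), h⟩ : HS 1) = ⟨Sph.pt 1, hp.ge⟩ :=
      fun h => Subtype.ext (ant_ant _)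
    rcases proj_eq.1 (hF _ hp (hz _ hp)) with h | h
    · refine ⟨id, Or.inl rfl, ?_⟩
      intro y hy hy'
      rcases hall y hy with rfl | rfl
      · exact h
      · rw [e2]; exact h.symm
    · refine ⟨Sph.antipode 1, Or.inr rfl, ?_⟩
      intro y hy hy'
      rcases hall y hy with rfl | rfl
      · exact h
      · rw [e2, h, ant_ant]

theorem lift_free (hN : 1 ≤ N) (g : C(Sph N, RP N)) (hg : ∀ x, g (Sph.antipode N x) = g x) :
    ∃ ft : C(Sph N, Sph N), ∀ x, RP.proj N (ft x) = g x := by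
  obtain ⟨F, hF⟩ := lift_half hN g
  obtain ⟨s, hs, hsF⟩ := equator_sign hN F (fun y h h' => by rw [hF, hF]; exact (hg y).symm)
  have hsc : Continuous s := by
    rcases hs with rfl | rfl
    · exact continuous_id
    · exact ant_cont
  have hsp : ∀ x, RP.proj N (s x) = RP.proj N x := by
    rcases hs with rfl | rfl
    · exact fun x => rfl
    · exact proj_ant
  have hss : ∀ x, s (s x) = x := by
    rcases hs with rfl | rfl
    · exact fun x => rfl
    · exact ant_ant
  classical
  let G : Sph N → Sph N := fun x => if h : 0 ≤ tau x.1 then F ⟨x, h⟩ else Sph.pt N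
  have hG : ∀ x, ∀ h : 0 ≤ tau x.1, G x = F ⟨x, h⟩ := fun x h => dif_pos h
  have hGc : ContinuousOn G {x | 0 ≤ tau x.1} := by
    rw [continuousOn_iff_continuous_domRestrict]
    have : ({x : Sph N | 0 ≤ tau x.1}).domRestrict G = fun x => F ⟨x.1, x.2⟩ := funext fun x => hG x.1 x.2
    rw [this]
    exact F.continuous.comp (continuous_subtype_val.subtype_mk _)
  have ht : Continuous fun x : Sph N => tau x.1 := continuous_tau.comp continuous_subtype_val
  have hcl : IsClosed {x : Sph N | 0 ≤ tau x.1} := isClosed_le continuous_const ht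
  have hcl2 : closure {x : Sph N | ¬ 0 ≤ tau x.1} ⊆ {x : Sph N | tau x.1 ≤ 0} := by
    apply closure_minimal
    · intro x hx; exact (not_le.1 hx).le
    · exact isClosed_le ht continuous_const
  refine ⟨⟨fun x => if 0 ≤ tau x.1 then G x else s (G (Sph.antipode N x)), ?_⟩, ?_⟩
  · apply continuous_if
    · intro x hx
      have hx0 : tau x.1 = 0 := by
        have h1 := frontier_subset_closure hx
        rw [hcl.closure_eq] at h1
        rw [frontier_eq_closure_inter_closure] at hx
        exact le_antisymm (hcl2 hx.2) h1
      have hx' : 0 ≤ tau (Sph.antipode N x).1 := by rw [ant_val, tau_neg, hx0, neg_zero]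
      rw [hG x hx0.ge, hG _ hx', hsF x hx0 hx', hss]
    · rw [hcl.closure_eq]; exact hGc
    · apply hsc.comp_continuousOn
      apply hGc.comp ant_cont.continuousOn
      intro x hx
      have : tau x.1 ≤ 0 := hcl2 hx
      change 0 ≤ tau (-x.1)
      rw [tau_neg]; linarith
  · intro x
    change RP.proj N (if 0 ≤ tau x.1 then G x else s (G (Sph.antipode N x))) = g x
    split_ifs with h
    · rw [hG x h, hF]
    · have hx' : 0 ≤ tau (Sph.antipode N x).1 := by rw [ant_val, tau_neg]; linarith
      rw [hsp, hG _ hx', hF]; exact hg x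

theorem lift_exists (hN : 1 ≤ N) (f : PtdSelfMap (RP N) (RP.pt N)) :
    ∃ ft : C(Sph N, Sph N), (∀ x, RP.proj N (ft x) = f.1 (RP.proj N x)) ∧ ft (Sph.pt N) = Sph.pt N := by
  obtain ⟨ft, h⟩ := lift_free hN (f.1.comp (RP.proj N)) (fun x => by simp [proj_ant])
  have h0 : RP.proj N (ft (Sph.pt N)) = RP.proj N (Sph.pt N) := (h _).trans f.2
  rcases proj_eq.1 h0 with h1 | h1
  · exact ⟨ft, h, h1.symm⟩
  · exact ⟨(⟨Sph.antipode N, ant_cont⟩ : C(Sph N, Sph N)).comp ft,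
      fun x => (proj_ant _).trans (h x), h1.symm⟩

theorem lift_unique (hN : 1 ≤ N) {g : Sph N → RP N} {a b : C(Sph N, Sph N)} (ha : ∀ x, RP.proj N (a x) = g x)
    (hb : ∀ x, RP.proj N (b x) = g x) (h : b (Sph.pt N) = a (Sph.pt N)) : b = a := by
  haveI := sph_conn hN
  exact ContinuousMap.ext ((eq_of_proj a.continuous b.continuous (fun x => (ha x).trans (hb x).symm) _).1 h)

theorem lift_eqM (hN : 1 ≤ N) {f : RP N → RP N} {a : C(Sph N, Sph N)} (ha : ∀ x, RP.proj N (a x) = f (RP.proj N x))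
    (h : a (Sph.pt N) = Sph.pt N) : ∃ σ, (σ = sp N ∨ σ = sm N) ∧ EqM σ (hmg (ext a)) := by
  haveI := sph_conn hN
  have key := eq_of_proj a.continuous (a.continuous.comp ant_cont) (fun x => by
    simp only [Function.comp]; rw [ha, ha, proj_ant]) (Sph.pt N)
  have hp : ext a (e0 N) = e0 N := (ext_val a (Sph.pt N)).trans (congrArg Subtype.val h)
  have h3 : RP.proj N (a (Sph.pt N)) = RP.proj N (a (Sph.antipode N (Sph.pt N))) := by
    rw [ha, ha, proj_ant]
  rcases proj_eq.1 h3 with h1 | h1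
  · refine ⟨sp N, Or.inl rfl, hmg_eqM (ext_cont a) ?_ (fun x hx => (ext_nv a).2 x hx) hp⟩
    intro x hx
    have e1 := ext_val a (Sph.antipode N ⟨x, hx⟩)
    rw [ant_val] at e1
    rw [e1, sp_apply, ext_val a ⟨x, hx⟩]
    exact congrArg Subtype.val (key.1 h1 ⟨x, hx⟩)
  · refine ⟨sm N, Or.inr rfl, hmg_eqM (ext_cont a) ?_ (fun x hx => (ext_nv a).2 x hx) hp⟩
    intro x hx
    have e1 := ext_val a (Sph.antipode N ⟨x, hx⟩)
    rw [ant_val] at e1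
    rw [e1, sm_apply, ext_val a ⟨x, hx⟩]
    exact congrArg Subtype.val (key.2 h1 ⟨x, hx⟩)

end lift
end RPD
end

section
open Metric Set Filter Topology
set_option linter.unusedSectionVars false

namespace RPD
section fin
variable {N : ℕ}

theorem descend_map (ψ : C(Sph N, Sph N)) (h : ∀ x, RP.proj N (ψ (Sph.antipode N x)) = RP.proj N (ψ x))
    (hp : ψ (Sph.pt N) = Sph.pt N) :
    ∃ f : PtdSelfMap (RP N) (RP.pt N), ∀ x, RP.proj N (ψ x) = f.1 (RP.proj N x) := by
  have hl : ∀ a b, RP.proj N a = RP.proj N b → ((RP.proj N).comp ψ) a = ((RP.proj N).comp ψ) b := by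
    intro a b hab
    rcases proj_eq.1 hab with rfl | rfl
    · rfl
    · exact (h a).symm
  let f : C(RP N, RP N) := (proj_quot (N := N)).lift ((RP.proj N).comp ψ) hl
  have hf : ∀ x, f (RP.proj N x) = RP.proj N (ψ x) := fun x =>
    DFunLike.congr_fun ((proj_quot (N := N)).lift_comp ((RP.proj N).comp ψ) hl) x
  exact ⟨⟨f, by rw [RP.pt, hf, hp]⟩, fun x => (hf x).symm⟩

theorem descend_hom (K : C(unitInterval × Sph N, Sph N))
    (h : ∀ t x, RP.proj N (K (t, Sph.antipode N x)) = RP.proj N (K (t, x)))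
    (hp : ∀ t, K (t, Sph.pt N) = Sph.pt N) {f g : PtdSelfMap (RP N) (RP.pt N)}
    (h0 : ∀ x, RP.proj N (K (0, x)) = f.1 (RP.proj N x))
    (h1 : ∀ x, RP.proj N (K (1, x)) = g.1 (RP.proj N x)) :
    ContinuousMap.HomotopicRel f.1 g.1 {RP.pt N} := by
  let P : C(unitInterval × Sph N, unitInterval × RP N) := ⟨Prod.map id (RP.proj N), by fun_prop⟩
  have hP : IsQuotientMap P := (IsOpenQuotientMap.id.prodMap (proj_open (N := N))).isQuotientMap
  have hl : ∀ a b, P a = P b → ((RP.proj N).comp K) a = ((RP.proj N).comp K) b := by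
    rintro ⟨t, a⟩ ⟨u, b⟩ hab
    obtain ⟨h2, h3⟩ := Prod.mk.inj hab
    change t = u at h2
    subst h2
    rcases proj_eq.1 h3 with rfl | rfl
    · rfl
    · exact (h t a).symm
  let f' : C(unitInterval × RP N, RP N) := hP.lift ((RP.proj N).comp K) hl
  have hf : ∀ t x, f' (t, RP.proj N x) = RP.proj N (K (t, x)) := fun t x =>
    DFunLike.congr_fun (hP.lift_comp ((RP.proj N).comp K) hl) (t, x)
  refine ⟨⟨⟨f', ?_, ?_⟩, ?_⟩⟩
  · intro x
    obtain ⟨x, rfl⟩ := proj_surj x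
    exact (hf 0 x).trans (h0 x)
  · intro x
    obtain ⟨x, rfl⟩ := proj_surj x
    exact (hf 1 x).trans (h1 x)
  · rintro t x rfl
    change f' (t, RP.pt N) = f.1 (RP.pt N)
    rw [f.2, RP.pt, hf, hp]

theorem deg_wd (hN : 1 ≤ N) {f g : PtdSelfMap (RP N) (RP.pt N)}
    (H : ContinuousMap.HomotopicRel f.1 g.1 {RP.pt N}) {a b : C(Sph N, Sph N)}
    (ha : ∀ x, RP.proj N (a x) = f.1 (RP.proj N x)) (ha0 : a (Sph.pt N) = Sph.pt N)
    (hb : ∀ x, RP.proj N (b x) = g.1 (RP.proj N x)) (hb0 : b (Sph.pt N) = Sph.pt N) : a.Homotopic b := by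
  haveI := sph_conn hN
  obtain ⟨H⟩ := H
  have F : (f.1.comp (RP.proj N)).HomotopyRel (g.1.comp (RP.proj N)) {Sph.pt N} :=
    { toFun := fun p => H (p.1, RP.proj N p.2)
      continuous_toFun := by fun_prop
      map_zero_left := fun x => H.apply_zero _
      map_one_left := fun x => H.apply_one _
      prop' := by
        rintro t x rfl
        exact H.prop t _ rfl }
  exact ⟨((proj_cov (N := N)).liftHomotopyRel F (f₀' := a) (f₁' := b) ⟨Sph.pt N, rfl, ha0.trans hb0.symm⟩
    (funext ha) (funext hb)).toHomotopy⟩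

theorem deg_inj (hN : 1 ≤ N) (hev : Even (N + 1)) (hu : Uniq (EE N)) {f g : PtdSelfMap (RP N) (RP.pt N)}
    {a b : C(Sph N, Sph N)} (hab : a.Homotopic b)
    (ha : ∀ x, RP.proj N (a x) = f.1 (RP.proj N x)) (ha0 : a (Sph.pt N) = Sph.pt N)
    (hb : ∀ x, RP.proj N (b x) = g.1 (RP.proj N x)) (hb0 : b (Sph.pt N) = Sph.pt N) :
    ContinuousMap.HomotopicRel f.1 g.1 {RP.pt N} := by
  obtain ⟨σ, hσ, hA⟩ := lift_eqM hN ha ha0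
  obtain ⟨σ', hσ', hB⟩ := lift_eqM hN hb hb0
  have hh : Hom (sphere (0:EE N) 1) (hmg (ext a)) (hmg (ext b)) :=
    ((hom_iff a b).2 hab).congr (fun x hx => (hmg_unit hx).symm) (fun x hx => (hmg_unit hx).symm)
  have hs : σ' = σ := by
    rcases hσ with rfl | rfl <;> rcases hσ' with rfl | rfl
    · rfl
    · exact (odd_even hN hev hu hA hB hh).elim
    · exact (odd_even hN hev hu hB hA hh.symm).elim
    · rfl
  subst hs
  have hSg : Sg σ' := by
    rcases hσ with rfl | rfl
    · exact Sg_sp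
    · exact Sg_sm hev
  obtain ⟨H, Hc, H0, H1, Hn, Hs, Hp⟩ := eq_hom hN hev hu hSg hA hB hh
  have K0 : ∀ x, nrm H Hc Hn (0, x) = a x := fun x => nrm_val H Hc Hn 0 x _ one_pos (by
    rw [one_smul, ← ext_val]; exact (H0 x.1 x.2).trans (hmg_unit x.2))
  have K1 : ∀ x, nrm H Hc Hn (1, x) = b x := fun x => nrm_val H Hc Hn 1 x _ one_pos (by
    rw [one_smul, ← ext_val]; exact (H1 x.1 x.2).trans (hmg_unit x.2))
  refine descend_hom (nrm H Hc Hn) ?_ ?_ (fun x => by rw [K0, ha]) (fun x => by rw [K1, hb])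
  · intro t x
    have hx := Hs t.1 t.2 x.1 x.2
    have hpos : 0 < ‖H (t.1, x.1)‖ := norm_pos_iff.2 (Hn t.1 t.2 x.1 x.2)
    have hv : H (t.1, x.1) = ‖H (t.1, x.1)‖ • (nrm H Hc Hn (t, x)).1 := by
      change _ = _ • (‖H (t.1, x.1)‖⁻¹ • H (t.1, x.1))
      rw [smul_smul, mul_inv_cancel₀ hpos.ne', one_smul]
    rcases hσ with rfl | rfl
    · rw [sp_apply] at hx
      rw [nrm_val H Hc Hn t (Sph.antipode N x) (nrm H Hc Hn (t, x)) hpos (hx.trans hv)]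
    · rw [sm_apply] at hx
      rw [nrm_val H Hc Hn t (Sph.antipode N x) (Sph.antipode N (nrm H Hc Hn (t, x))) hpos
        (by rw [ant_val, ant_val, smul_neg, ← hv]; exact hx), proj_ant]
  · intro t
    obtain ⟨c, hc, h⟩ := Hp t.1 t.2
    exact nrm_val H Hc Hn t _ _ hc h

theorem deg_surj (hN : 1 ≤ N) (hev : Even (N + 1)) (hu : Uniq (EE N)) (φ : C(Sph N, Sph N)) :
    ∃ (f : PtdSelfMap (RP N) (RP.pt N)) (ψ : C(Sph N, Sph N)),
      (∀ x, RP.proj N (ψ x) = f.1 (RP.proj N x)) ∧ ψ (Sph.pt N) = Sph.pt N ∧ ψ.Homotopic φ := by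
  obtain ⟨σ, g, hσ, hg, hh⟩ := surj hN hev hu (ext_nv φ)
  obtain ⟨H, Hc, H0, H1, Hn⟩ := hh
  let K := nrm H Hc Hn
  let ψ : C(Sph N, Sph N) := K.comp ⟨fun x => (0, x), by fun_prop⟩
  have hψ : ∀ x y : Sph N, ∀ c : ℝ, 0 < c → g x.1 = c • y.1 → ψ x = y := fun x y c hc h =>
    nrm_val H Hc Hn 0 x y hc ((H0 x.1 x.2).trans h)
  have hψ0 : ψ (Sph.pt N) = Sph.pt N := hψ _ _ 1 one_pos (by rw [one_smul]; exact hg.pt)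
  have hpr : ∀ x, RP.proj N (ψ (Sph.antipode N x)) = RP.proj N (ψ x) := by
    intro x
    have hpos : 0 < ‖g x.1‖ := norm_pos_iff.2 (by rw [← H0 x.1 x.2]; exact Hn 0 (by simp) x.1 x.2)
    have hy : g x.1 = ‖g x.1‖ • (⟨‖g x.1‖⁻¹ • g x.1, unit_mem (norm_pos_iff.1 hpos)⟩ : Sph N).1 := by
      change _ = _ • (‖g x.1‖⁻¹ • g x.1)
      rw [smul_smul, mul_inv_cancel₀ hpos.ne', one_smul]
    rw [hψ x _ _ hpos hy]
    have hx := hg.neg x.1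
    rcases hσ with rfl | rfl
    · rw [sp_apply] at hx
      rw [hψ (Sph.antipode N x) _ _ hpos (hx.trans hy)]
    · rw [sm_apply] at hx
      rw [hψ (Sph.antipode N x) (Sph.antipode N ⟨‖g x.1‖⁻¹ • g x.1, unit_mem (norm_pos_iff.1 hpos)⟩) _ hpos
        (by rw [ant_val, ant_val, smul_neg, ← hy]; exact hx), proj_ant]
  obtain ⟨f, hf⟩ := descend_map ψ hpr hψ0
  refine ⟨f, ψ, hf, hψ0, ⟨⟨K, fun x => rfl, fun x => ?_⟩⟩⟩
  exact nrm_val H Hc Hn 1 x _ one_pos (by rw [one_smul, ← ext_val]; exact H1 x.1 x.2)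

theorem main (hN : 1 ≤ N) (hev : Even (N + 1)) (D : SphereDegree N) :
    ∃ e : PtdSelfMapClass (RP N) (RP.pt N) ≃ ℤ,
      (∀ f g : PtdSelfMap (RP N) (RP.pt N),
        e (PtdSelfMapClass.mk (f.comp g)) = e (PtdSelfMapClass.mk f) * e (PtdSelfMapClass.mk g)) ∧
      e (PtdSelfMapClass.mk (PtdSelfMap.id (RP N) (RP.pt N))) = 1 ∧
      (∀ (f : PtdSelfMap (RP N) (RP.pt N)) (ft : C(Sph N, Sph N)),
        (∀ x, RP.proj N (ft x) = f.1 (RP.proj N x)) → ft (Sph.pt N) = Sph.pt N →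
        e (PtdSelfMapClass.mk f) = D.deg ft) := by
  have hu := uniq_of_degree hN D
  choose l hl hl0 using lift_exists (N := N) hN
  let d : PtdSelfMapClass (RP N) (RP.pt N) → ℤ := Quot.lift (fun f => D.deg (l f)) (fun f g H =>
    (D.homotopic_iff _ _).1 (deg_wd hN H (hl f) (hl0 f) (hl g) (hl0 g)))
  have hd : ∀ (f : PtdSelfMap (RP N) (RP.pt N)) (ft : C(Sph N, Sph N)),
      (∀ x, RP.proj N (ft x) = f.1 (RP.proj N x)) → ft (Sph.pt N) = Sph.pt N →
      d (PtdSelfMapClass.mk f) = D.deg ft := by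
    intro f ft h h0
    change D.deg (l f) = D.deg ft
    rw [lift_unique hN h (hl f) ((hl0 f).trans h0.symm)]
  have hbij : Function.Bijective d := by
    constructor
    · rintro ⟨f⟩ ⟨g⟩ h
      exact Quot.sound (deg_inj hN hev hu ((D.homotopic_iff _ _).2 h) (hl f) (hl0 f) (hl g) (hl0 g))
    · intro k
      obtain ⟨φ, rfl⟩ := D.deg_surjective k
      obtain ⟨f, ψ, h1, h2, h3⟩ := deg_surj hN hev hu φ
      exact ⟨PtdSelfMapClass.mk f, (hd f ψ h1 h2).trans ((D.homotopic_iff _ _).1 h3)⟩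
  refine ⟨Equiv.ofBijective d hbij, ?_, ?_, hd⟩
  · intro f g
    simp only [Equiv.ofBijective_apply]
    rw [hd _ ((l f).comp (l g)) ?_ ?_, D.deg_comp]
    · rfl
    · intro x
      change RP.proj N (l f (l g x)) = f.1 (g.1 _)
      rw [hl, hl]
    · change l f (l g _) = _
      rw [hl0, hl0]
  · simp only [Equiv.ofBijective_apply]
    rw [hd _ (ContinuousMap.id _) (fun x => rfl) rfl, D.deg_id]

end fin
end RPD
end

/-- Corollary, `ℝP^{2n+1}`: The monoid of pointed homotopy classes
of self-maps of `ℝP^{2n+1}` under composition is isomorphic to the multiplicative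
monoid `(ℤ, ×)`, via the mapping degree: the class of `f` is sent to the degree
of a (pointed) lift `f̃ : S^{2n+1} → S^{2n+1}` of `f`. -/
theorem selfMaps_RP_odd_iso_int (n : ℕ) (D : SphereDegree (2 * n + 1)) :
    ∃ e : PtdSelfMapClass (RP (2 * n + 1)) (RP.pt (2 * n + 1)) ≃ ℤ,
      (∀ f g : PtdSelfMap (RP (2 * n + 1)) (RP.pt (2 * n + 1)),
        e (PtdSelfMapClass.mk (f.comp g)) =
          e (PtdSelfMapClass.mk f) * e (PtdSelfMapClass.mk g)) ∧
      e (PtdSelfMapClass.mk (PtdSelfMap.id (RP (2 * n + 1)) (RP.pt (2 * n + 1)))) = 1 ∧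
      (∀ (f : PtdSelfMap (RP (2 * n + 1)) (RP.pt (2 * n + 1)))
          (ft : C(Sph (2 * n + 1), Sph (2 * n + 1))),
        (∀ x, RP.proj (2 * n + 1) (ft x) = f.1 (RP.proj (2 * n + 1) x)) →
        ft (Sph.pt (2 * n + 1)) = Sph.pt (2 * n + 1) →
        e (PtdSelfMapClass.mk f) = D.deg ft) := by
  exact RPD.main (by omega) ⟨n + 1, by omega⟩ D
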